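/- There exists a unimodal map f ∈ 𝒜* which has a wild attractor ω(c) (a Cantor attractor of a non-infinitely-renormalizable map) such that f restricted to ω(c) is topologically conjugate to an adding machine f_α : Δ_α → Δ_α for some sequence α, and hence f restricted to ω(c) is equicontinuous. -/

import Mathlib

open Set Function MeasureTheory Filter Topology
open scoped Classical

noncomputable section

/-- Length (Lebesgue measure) of a set of reals. -/
def len (S : Set ℝ) : ℝ := (volume S).toReal

/-- A bounded open interval. -/
def IsOpenInterval (S : Set ℝ) : Prop := ∃ a b : ℝ, a < b ∧ S = Set.Ioo a b

/-- The ω-limit set of a point under iteration of `f`. -/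
def omegaLimitSet (f : ℝ → ℝ) (x : ℝ) : Set ℝ :=
  ⋂ N : ℕ, closure ((fun n => f^[n] x) '' {n : ℕ | N ≤ n})

/-- Unimodal maps of class 𝒜 with turning point `c`, which is non-flat of order `ℓ`:
continuous on `[0,1]`, strictly increasing on `[0,c]`, strictly decreasing on `[c,1]`,
`C³` outside `c` with non-vanishing derivative, and `|ψ⁻¹ ∘ f ∘ φ (x)| = |x|^ℓ`
near `0` for `C³` local diffeomorphisms `φ, ψ` with `φ 0 = c`, `ψ 0 = f c`. -/
structure UnimodalA (f : ℝ → ℝ) (c ℓ : ℝ) : Prop where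
  cont : ContinuousOn f (Set.Icc 0 1)
  maps : Set.MapsTo f (Set.Icc 0 1) (Set.Icc 0 1)
  c_mem : c ∈ Set.Ioo (0:ℝ) 1
  mono : StrictMonoOn f (Set.Icc 0 c)
  anti : StrictAntiOn f (Set.Icc c 1)
  smooth : ContDiffOn ℝ 3 f (Set.Icc 0 1 \ {c})
  deriv_ne : ∀ x ∈ Set.Icc 0 1 \ {c}, deriv f x ≠ 0
  ell_gt_one : 1 < ℓ
  nonflat : ∃ φ ψ : ℝ → ℝ, φ 0 = c ∧ ψ 0 = f c ∧
    (∃ U ∈ 𝓝 (0:ℝ), ContDiffOn ℝ 3 φ U ∧ ContDiffOn ℝ 3 ψ U) ∧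
    deriv φ 0 ≠ 0 ∧ deriv ψ 0 ≠ 0 ∧
    ∃ s : ℝ, |s| = 1 ∧ ∀ᶠ x in 𝓝 (0:ℝ), f (φ x) = ψ (s * |x| ^ ℓ)

/-- All periodic points of `f` in `[0,1]` are hyperbolic repelling. -/
def AllPeriodicHyperbolicRepelling (f : ℝ → ℝ) : Prop :=
  ∀ x ∈ Set.Icc (0:ℝ) 1, ∀ p : ℕ, 0 < p → f^[p] x = x → 1 < |deriv (f^[p]) x|

/-- The class 𝒜₊ : maps in 𝒜 with all periodic points hyperbolic repelling. -/
def UnimodalAStar (f : ℝ → ℝ) (c ℓ : ℝ) : Prop :=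
  UnimodalA f c ℓ ∧ AllPeriodicHyperbolicRepelling f

/-- A (minimal) metric attractor: a compact invariant set whose realm of attraction has
positive Lebesgue measure, while no proper compact invariant subset has this property. -/
def IsMetricAttractor (f : ℝ → ℝ) (X : Set ℝ) : Prop :=
  IsCompact X ∧ X ⊆ Set.Icc 0 1 ∧ f '' X ⊆ X ∧
  0 < volume {x ∈ Set.Icc (0:ℝ) 1 | omegaLimitSet f x ⊆ X} ∧
  ∀ X' : Set ℝ, X' ⊂ X → IsCompact X' → f '' X' ⊆ X' →
    volume {x ∈ Set.Icc (0:ℝ) 1 | omegaLimitSet f x ⊆ X'} = 0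

/-- A Cantor set: nonempty, compact, perfect, totally disconnected. -/
def IsCantorSet (X : Set ℝ) : Prop :=
  X.Nonempty ∧ IsCompact X ∧ Perfect X ∧ IsTotallyDisconnected X

/-- A nice interval: an open interval `T ⊆ [0,1]` such that the forward orbit of `∂T`
never enters `T`, and `T` contains no fixed point of `f`. -/
def IsNiceInterval (f : ℝ → ℝ) (T : Set ℝ) : Prop :=
  IsOpenInterval T ∧ T ⊆ Set.Icc 0 1 ∧
  (∀ n : ℕ, ∀ x ∈ frontier T, f^[n] x ∉ T) ∧
  (∀ x ∈ T, f x ≠ x)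

/-- A symmetric nice interval containing `c`: `f(∂T)` is a single point. -/
def IsSymmNice (f : ℝ → ℝ) (c : ℝ) (T : Set ℝ) : Prop :=
  IsNiceInterval f T ∧ c ∈ T ∧ ∃ y : ℝ, ∀ x ∈ frontier T, f x = y

/-- `D(T)`: the set of points entering `T` under some positive iterate. -/
def entryDomain (f : ℝ → ℝ) (T : Set ℝ) : Set ℝ :=
  {x | ∃ k : ℕ, 1 ≤ k ∧ f^[k] x ∈ T}

/-- The return domain of `T` containing `x` (component of `D(T) ∩ T`). -/
def returnDomain (f : ℝ → ℝ) (T : Set ℝ) (x : ℝ) : Set ℝ :=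
  connectedComponentIn (entryDomain f T ∩ T) x

/-- `U` is a return domain of `T`. -/
def IsReturnDomain (f : ℝ → ℝ) (T U : Set ℝ) : Prop :=
  ∃ x ∈ entryDomain f T ∩ T, U = returnDomain f T x

/-- `k` is the first return time of `x` to `T`. -/
def IsFirstReturnTime (f : ℝ → ℝ) (T : Set ℝ) (x : ℝ) (k : ℕ) : Prop :=
  1 ≤ k ∧ f^[k] x ∈ T ∧ ∀ j : ℕ, 1 ≤ j → j < k → f^[j] x ∉ T

/-- `J` is a pull back of `V` by `f^k`, i.e. a connected component of `f^{-k}(V)`. -/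
def IsPullbackBy (f : ℝ → ℝ) (V J : Set ℝ) (k : ℕ) : Prop :=
  ∃ x ∈ f^[k] ⁻¹' V, J = connectedComponentIn (f^[k] ⁻¹' V) x

/-- `J` is a child of `T` with transition time `k`: a unimodal pull back of `T`
containing `c`, i.e. `f^{k-1}` maps a neighborhood of `f(J)` diffeomorphically
(injectively) onto `T`. -/
def IsChildWithTime (f : ℝ → ℝ) (c : ℝ) (T J : Set ℝ) (k : ℕ) : Prop :=
  1 ≤ k ∧ c ∈ J ∧ IsPullbackBy f T J k ∧
  ∃ W : Set ℝ, IsOpen W ∧ f '' J ⊆ W ∧ Set.InjOn (f^[k - 1]) W ∧ f^[k - 1] '' W = T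

/-- `J` is a child of `T`. -/
def IsChild (f : ℝ → ℝ) (c : ℝ) (T J : Set ℝ) : Prop :=
  ∃ k : ℕ, IsChildWithTime f c T J k

/-- The number `ν(T)` of children of `T`. -/
def numChildren (f : ℝ → ℝ) (c : ℝ) (T : Set ℝ) : ℕ :=
  {J : Set ℝ | IsChild f c T J}.ncard

/-- The interval `J` is `τ`-well inside the interval `I`: both components of `I ∖ J`
have length at least `τ·|J|`. -/
def WellInside (τ : ℝ) (J I : Set ℝ) : Prop :=
  ∃ a b a' b' : ℝ, a' ≤ a ∧ a < b ∧ b ≤ b' ∧ J = Set.Ioo a b ∧ I = Set.Ioo a' b' ∧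
    τ * (b - a) ≤ a - a' ∧ τ * (b - a) ≤ b' - b

/-- A `τ`-nice interval: every return domain is `τ`-well inside it. -/
def IsTauNice (f : ℝ → ℝ) (τ : ℝ) (T : Set ℝ) : Prop :=
  ∀ x ∈ entryDomain f T ∩ T, WellInside τ (returnDomain f T x) T

/-- A `τ`-non-central-nice interval: every return domain, except possibly the one
containing `c`, is `τ`-well inside it. -/
def IsNonCentralTauNice (f : ℝ → ℝ) (c : ℝ) (τ : ℝ) (T : Set ℝ) : Prop :=
  ∀ x ∈ entryDomain f T ∩ T, c ∉ returnDomain f T x →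
    WellInside τ (returnDomain f T x) T

/-- `I` is a restrictive interval of period `s` for `f`. -/
def IsRenormInterval (f : ℝ → ℝ) (c : ℝ) (I : Set ℝ) (s : ℕ) : Prop :=
  (∃ a b : ℝ, a < b ∧ I = Set.Icc a b) ∧ c ∈ interior I ∧ 2 ≤ s ∧
  (∀ i j : ℕ, i < j → j < s → interior (f^[i] '' I) ∩ interior (f^[j] '' I) = ∅) ∧
  f^[s] '' I ⊆ I ∧ f^[s] '' frontier I ⊆ frontier I

/-- `f` is renormalizable. -/
def Renormalizable (f : ℝ → ℝ) (c : ℝ) : Prop :=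
  ∃ I s, IsRenormInterval f c I s

/-- `f` is infinitely renormalizable: restrictive intervals of arbitrarily large period. -/
def InfinitelyRenormalizable (f : ℝ → ℝ) (c : ℝ) : Prop :=
  ∀ N : ℕ, ∃ I s, N ≤ s ∧ IsRenormInterval f c I s

/-- `X` is a minimal set for `f`. -/
def IsMinimalOn (f : ℝ → ℝ) (X : Set ℝ) : Prop :=
  X.Nonempty ∧ IsClosed X ∧ f '' X ⊆ X ∧
  ∀ x ∈ X, X ⊆ closure {y | ∃ n : ℕ, f^[n] x = y}

/-- The collection of connected components of `S` which intersect `ω(c)`. -/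
def componentsMeeting (f : ℝ → ℝ) (c : ℝ) (S : Set ℝ) : Set (Set ℝ) :=
  {U | (∃ x ∈ S, U = connectedComponentIn S x) ∧ (U ∩ omegaLimitSet f c).Nonempty}

/-- The nice cover 𝒴 of `ω(c)` associated with a symmetric nice interval `Y`:
components of `Y ∪ D(Y)` meeting `ω(c)`. -/
def niceCover (f : ℝ → ℝ) (c : ℝ) (Y : Set ℝ) : Set (Set ℝ) :=
  componentsMeeting f c (Y ∪ entryDomain f Y)

/-- `q(𝒴, n)`: the number of components of `f^{-n}(Y ∪ D(Y))` intersecting `ω(c)`. -/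
def qCount (f : ℝ → ℝ) (c : ℝ) (Y : Set ℝ) (n : ℕ) : ℕ :=
  (componentsMeeting f c (f^[n] ⁻¹' (Y ∪ entryDomain f Y))).ncard

/-- `Y₋ₙ`: the component of `f^{-n}(Y ∪ D(Y))` containing `c`. -/
def criticalPullbackOfEntry (f : ℝ → ℝ) (c : ℝ) (Y : Set ℝ) (n : ℕ) : Set ℝ :=
  connectedComponentIn (f^[n] ⁻¹' (Y ∪ entryDomain f Y)) c

/-- `𝒰` is an open cover of `X`. -/
def IsOpenCover (X : Set ℝ) (𝒰 : Set (Set ℝ)) : Prop :=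
  (∀ U ∈ 𝒰, IsOpen U) ∧ X ⊆ ⋃₀ 𝒰

/-- The cover `⋁_{i=0}^{n-1} f^{-i} 𝒰`. -/
def coverJoin (f : ℝ → ℝ) (𝒰 : Set (Set ℝ)) (n : ℕ) : Set (Set ℝ) :=
  {V | ∃ U : Fin n → Set ℝ, (∀ i, U i ∈ 𝒰) ∧ V = ⋂ i : Fin n, f^[(i : ℕ)] ⁻¹' U i}

/-- The topological complexity function `p(𝒰, n) = N(⋁_{i=0}^{n-1} f^{-i} 𝒰)`:
the minimal cardinality of a finite subcover of `X` from the joined cover. -/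
def complexity (f : ℝ → ℝ) (X : Set ℝ) (𝒰 : Set (Set ℝ)) (n : ℕ) : ℕ :=
  sInf {m : ℕ | ∃ 𝒱 : Set (Set ℝ), 𝒱 ⊆ coverJoin f 𝒰 n ∧ 𝒱.Finite ∧
        X ⊆ ⋃₀ 𝒱 ∧ 𝒱.ncard = m}

/-- A maximal central cascade `T⁰ ⊃ T¹ ⊃ ⋯ ⊃ Tᵐ` with common first return time `s`. -/
def IsMaximalCentralCascade (f : ℝ → ℝ) (c : ℝ) (T : ℕ → Set ℝ) (m s : ℕ) : Prop :=
  1 ≤ m ∧ 1 ≤ s ∧ (∀ i ≤ m, IsSymmNice f c (T i)) ∧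
  (∀ i < m, T (i + 1) = returnDomain f (T i) c) ∧
  (∀ i < m, IsFirstReturnTime f (T i) c s) ∧ f^[s] c ∉ T m

/-- `Λ`: the union of the components of `I ∪ D(I)` which intersect `ω(c)`. -/
def LambdaSet (f : ℝ → ℝ) (c : ℝ) (I : Set ℝ) : Set ℝ :=
  {x | x ∈ I ∪ entryDomain f I ∧
       (connectedComponentIn (I ∪ entryDomain f I) x ∩ omegaLimitSet f c).Nonempty}

/-- `Λ(T)`: points which enter `T` while staying in `Λ` before doing so. -/
def LambdaT (f : ℝ → ℝ) (c : ℝ) (I T : Set ℝ) : Set ℝ :=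
  {x | ∃ k : ℕ, 1 ≤ k ∧ (∀ j < k, f^[j] x ∈ LambdaSet f c I) ∧ f^[k] x ∈ T}

/-- The fixed base interval `I`: a symmetric nice interval containing `c` such that
the associated `Λ` is compactly contained in `[f²(c), f(c)]`. -/
def GoodBase (f : ℝ → ℝ) (c : ℝ) (I : Set ℝ) : Prop :=
  IsSymmNice f c I ∧ closure (LambdaSet f c I) ⊆ Set.Ioo (f (f c)) (f c)

/-- `λ(Y'|Y)`: the supremum over diffeomorphisms `f^s : J → Y` of
`|(f^s|J)^{-1}(Y')| / |J|`. -/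
def lamRatio (f : ℝ → ℝ) (Y' Y : Set ℝ) : ℝ :=
  sSup {r : ℝ | ∃ (s : ℕ) (J : Set ℝ), IsOpenInterval J ∧
        Set.InjOn (f^[s]) J ∧ f^[s] '' J = Y ∧
        r = len (J ∩ f^[s] ⁻¹' Y') / len J}

/-- `ξ(Y'|Y) = 1 − λ(Y'|Y)`. -/
def xiRel (f : ℝ → ℝ) (Y' Y : Set ℝ) : ℝ := 1 - lamRatio f Y' Y

/-- The empty space `ξ(T) = ξ(Λ(T) ∩ T | T)`. -/
def xiT (f : ℝ → ℝ) (c : ℝ) (I T : Set ℝ) : ℝ :=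
  xiRel f (LambdaT f c I T ∩ T) T

/-- `Y_{-j}` in the chain of pull backs of `Y` along the orbit `c, f(c), …, fⁿ(c)`:
the component of `f^{-j}(Y)` containing `f^{n-j}(c)`. -/
def chainAt (f : ℝ → ℝ) (c : ℝ) (Y : Set ℝ) (n j : ℕ) : Set ℝ :=
  connectedComponentIn (f^[j] ⁻¹' Y) (f^[n - j] c)

/-- The set of transition times `s_j` occurring in the chain from `Y_{-n}` to `Y`:
gaps between consecutive critical positions in the chain. -/
def essentialTimes (f : ℝ → ℝ) (c : ℝ) (Y : Set ℝ) (n : ℕ) : Set ℕ :=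
  {s : ℕ | ∃ j j' : ℕ, j < j' ∧ j' ≤ n ∧ c ∈ chainAt f c Y n j ∧ c ∈ chainAt f c Y n j' ∧
    (∀ i : ℕ, j < i → i < j' → c ∉ chainAt f c Y n i) ∧ s = j' - j}

/-- The essential order `M_n(Y)`: the number of distinct transition times in the chain. -/
def essentialOrder (f : ℝ → ℝ) (c : ℝ) (Y : Set ℝ) (n : ℕ) : ℕ :=
  (essentialTimes f c Y n).ncard

/-- The first (largest) child of `T`. -/
def IsFirstChild (f : ℝ → ℝ) (c : ℝ) (T J : Set ℝ) : Prop :=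
  IsChild f c T J ∧ ∀ J', IsChild f c T J' → J' ⊆ J

/-- The second child of `T`: the second largest child. -/
def IsSecondChild (f : ℝ → ℝ) (c : ℝ) (T J : Set ℝ) : Prop :=
  IsChild f c T J ∧ ∃ J₁, IsFirstChild f c T J₁ ∧ J ⊂ J₁ ∧
    ∀ J', IsChild f c T J' → J' ≠ J₁ → J' ⊆ J

/-- The principal nest `Y = Y₀ ⊃ Y₁ ⊃ ⋯` starting from `Y`. -/
def principalNest (f : ℝ → ℝ) (c : ℝ) (Y : Set ℝ) : ℕ → Set ℝ
  | 0 => Y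
  | n + 1 => returnDomain f (principalNest f c Y n) c

/-- `f` has special combinatorics, witnessed by the symmetric nice interval `Y`:
`ω(c) ∋ c` is minimal and each annulus `Yₙ ∖ Yₙ₊₁` of the principal nest has
exactly one component intersecting `ω(c)`. -/
def SpecialCombinatorics (f : ℝ → ℝ) (c : ℝ) (Y : Set ℝ) : Prop :=
  c ∈ omegaLimitSet f c ∧ IsMinimalOn f (omegaLimitSet f c) ∧ IsSymmNice f c Y ∧
  ∀ n : ℕ, ∃! U : Set ℝ,
    U ∈ componentsMeeting f c (principalNest f c Y n \ principalNest f c Y (n + 1))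

/-- The adding machine map `f_α` on `Δ_α = Π i, {0, …, pᵢ − 1}`. -/
def addingMachine (p : ℕ → ℕ) (hp : ∀ i, 2 ≤ p i) (x : ∀ i, Fin (p i)) :
    ∀ i, Fin (p i) :=
  if h : ∃ l, (x l : ℕ) + 1 < p l then fun i =>
    if i < Nat.find h then ⟨0, by have := hp i; omega⟩
    else if hi : i = Nat.find h then
      ⟨(x i : ℕ) + 1, by rw [hi]; exact Nat.find_spec h⟩
    else x i
  else fun i => ⟨0, by have := hp i; omega⟩

/-- `f` restricted to `X` is topologically conjugate to an adding machine. -/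
def ConjugateToAddingMachine (f : ℝ → ℝ) (X : Set ℝ) : Prop :=
  ∃ (p : ℕ → ℕ) (hp : ∀ i, 2 ≤ p i) (φ : ℝ → ∀ i, Fin (p i)),
    ContinuousOn φ X ∧ Set.InjOn φ X ∧ φ '' X = Set.univ ∧
    ∀ x ∈ X, φ (f x) = addingMachine p hp (φ x)

/-- `f` restricted to `X` is equicontinuous (w.r.t. all iterates). -/
def EquicontinuousOnSet (f : ℝ → ℝ) (X : Set ℝ) : Prop :=
  ∀ ε > 0, ∃ δ > 0, ∀ x ∈ X, ∀ y ∈ X, |x - y| < δ →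
    ∀ n : ℕ, |f^[n] x - f^[n] y| < ε

/-- Maps which contract the cross-ratio of four ordered points. -/
def CRC (ψ : ℝ → ℝ) (S : Set ℝ) : Prop :=
  ∀ a ∈ S, ∀ b ∈ S, ∀ c ∈ S, ∀ d ∈ S, a < b → b < c → c < d →
    (ψ c - ψ b) * (ψ d - ψ a) * ((b - a) * (d - c)) ≤
      (c - b) * (d - a) * ((ψ b - ψ a) * (ψ d - ψ c))

/-- Strictly increasing cross-ratio contracting maps. -/
structure Inc (ψ : ℝ → ℝ) (S : Set ℝ) : Prop where
  mono : StrictMonoOn ψ S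
  crc : CRC ψ S

namespace Inc

variable {ψ φ : ℝ → ℝ} {S S' : Set ℝ}

theorem mono_set (h : Inc ψ S) (hS : S' ⊆ S) : Inc ψ S' :=
  ⟨h.mono.mono hS, fun a ha b hb c hc d hd =>
    h.crc a (hS ha) b (hS hb) c (hS hc) d (hS hd)⟩

theorem comp (h : Inc ψ S) (g : Inc φ S') (hm : MapsTo φ S' S) :
    Inc (fun x => ψ (φ x)) S' := by
  refine ⟨h.mono.comp g.mono hm, ?_⟩
  intro a ha b hb c hc d hd hab hbc hcd
  have h1 := h.crc _ (hm ha) _ (hm hb) _ (hm hc) _ (hm hd) (g.mono ha hb hab)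
    (g.mono hb hc hbc) (g.mono hc hd hcd)
  have h2 := g.crc a ha b hb c hc d hd hab hbc hcd
  have p1 := sub_pos.2 (g.mono ha hb hab)
  have p2 := sub_pos.2 (g.mono hb hc hbc)
  have p3 := sub_pos.2 (g.mono hc hd hcd)
  have p4 := sub_pos.2 (g.mono ha hd (hab.trans (hbc.trans hcd)))
  have q1 := sub_pos.2 (h.mono (hm ha) (hm hb) (g.mono ha hb hab))
  have q2 := sub_pos.2 (h.mono (hm hb) (hm hc) (g.mono hb hc hbc))
  have q3 := sub_pos.2 (h.mono (hm hc) (hm hd) (g.mono hc hd hcd))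
  have q4 := sub_pos.2 (h.mono (hm ha) (hm hd) (g.mono ha hd (hab.trans (hbc.trans hcd))))
  have r1 : 0 < (b - a) * (d - c) := mul_pos (sub_pos.2 hab) (sub_pos.2 hcd)
  have key := mul_le_mul h1 h2 (by positivity) (by positivity)
  have hP : 0 < (φ c - φ b) * (φ d - φ a) * ((φ b - φ a) * (φ d - φ c)) := by positivity
  refine le_of_mul_le_mul_left ?_ hP
  calc _ = _ := ?_
    _ ≤ _ := key
    _ = _ := ?_
  · ring
  · ring

theorem neg_neg (h : Inc ψ S) (hS : ∀ x ∈ S', -x ∈ S) : Inc (fun x => -ψ (-x)) S' := by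
  refine ⟨fun x hx y hy hxy => neg_lt_neg (h.mono (hS y hy) (hS x hx) (neg_lt_neg hxy)), ?_⟩
  intro a ha b hb c hc d hd hab hbc hcd
  have := h.crc _ (hS d hd) _ (hS c hc) _ (hS b hb) _ (hS a ha)
    (neg_lt_neg hcd) (neg_lt_neg hbc) (neg_lt_neg hab)
  linarith

theorem id (S : Set ℝ) : Inc (fun x => x) S :=
  ⟨fun _ _ _ _ h => h, fun a _ b _ c _ d _ _ _ _ => le_of_eq (by ring)⟩

theorem const_add (c : ℝ) (S : Set ℝ) : Inc (fun x => c + x) S :=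
  ⟨fun _ _ _ _ h => by simpa using h, fun a _ b _ c _ d _ _ _ _ => le_of_eq (by ring)⟩

theorem const_mul {c : ℝ} (hc : 0 < c) (S : Set ℝ) : Inc (fun x => c * x) S :=
  ⟨fun _ _ _ _ h => mul_lt_mul_of_pos_left h hc,
    fun a _ b _ c _ d _ _ _ _ => le_of_eq (by ring)⟩

theorem sqrt : Inc Real.sqrt (Ici 0) := by
  refine ⟨fun x hx y _ hxy => Real.sqrt_lt_sqrt hx hxy, ?_⟩
  intro a ha b hb c hc d hd hab hbc hcd
  have h1 := Real.sqrt_lt_sqrt ha hab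
  have h2 := Real.sqrt_lt_sqrt hb hbc
  have h3 := Real.sqrt_lt_sqrt hc hcd
  have ea := Real.sq_sqrt ha
  have eb := Real.sq_sqrt hb
  have ec := Real.sq_sqrt hc
  have ed := Real.sq_sqrt hd
  have h0 := Real.sqrt_nonneg a
  generalize √a = α at *
  generalize √b = β at *
  generalize √c = γ at *
  generalize √d = δ at *
  rw [← ea, ← eb, ← ec, ← ed]
  have hP : 0 ≤ (γ - β) * (δ - α) * ((β - α) * (δ - γ)) :=
    mul_nonneg (mul_nonneg (by linarith) (by linarith)) (mul_nonneg (by linarith) (by linarith))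
  have hQ : (β + α) * (δ + γ) ≤ (γ + β) * (δ + α) := by nlinarith
  have := mul_le_mul_of_nonneg_left hQ hP
  linarith

theorem k1 (h : Inc ψ S) {a b c d : ℝ} (ha : a ∈ S) (hb : b ∈ S) (hc : c ∈ S) (hd : d ∈ S)
    (hab : a ≤ b) (hbc : b ≤ c) (hcd : c ≤ d) :
    (ψ c - ψ b) * ((b - a) * (d - c)) ≤ (c - b) * (d - a) * (ψ b - ψ a) := by
  have wm := h.mono.monotoneOn
  have m1 := sub_nonneg.2 (wm ha hb hab)
  rcases hab.eq_or_lt with rfl | hab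
  · simp
  rcases hbc.eq_or_lt with rfl | hbc
  · simp
  rcases hcd.eq_or_lt with rfl | hcd
  · have : 0 ≤ (c - b) * (c - a) * (ψ b - ψ a) :=
      mul_nonneg (mul_nonneg (by linarith) (by linarith)) m1
    simpa using this
  have p1 := sub_pos.2 (h.mono ha hb hab)
  have p2 := sub_pos.2 (h.mono hb hc hbc)
  have p3 := sub_pos.2 (h.mono hc hd hcd)
  have p4 := sub_pos.2 (h.mono ha hd (hab.trans (hbc.trans hcd)))
  have hle : ψ d - ψ c ≤ ψ d - ψ a := by linarith
  have key := h.crc a ha b hb c hc d hd hab hbc hcd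
  have hq : 0 ≤ (c - b) * (d - a) * (ψ b - ψ a) :=
    mul_nonneg (mul_nonneg (by linarith) (by linarith)) p1.le
  have k3 := mul_le_mul_of_nonneg_left hle hq
  refine le_of_mul_le_mul_left ?_ p4
  linarith

theorem k2 (h : Inc ψ S) {a b c d : ℝ} (ha : a ∈ S) (hb : b ∈ S) (hc : c ∈ S) (hd : d ∈ S)
    (hab : a ≤ b) (hbc : b ≤ c) (hcd : c ≤ d) :
    (ψ c - ψ b) * ((b - a) * (d - c)) ≤ (c - b) * (d - a) * (ψ d - ψ c) := by
  have hS : ∀ x ∈ -S, -x ∈ S := fun x hx => hx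
  have := (h.neg_neg (S' := -S) hS).k1 (a := -d) (b := -c) (c := -b) (d := -a) (by simpa)
    (by simpa) (by simpa) (by simpa) (neg_le_neg hcd) (neg_le_neg hbc) (neg_le_neg hab)
  simp only [_root_.neg_neg] at this
  linarith

theorem iterate (h : Inc ψ S) (hm : MapsTo ψ S S) (j : ℕ) : Inc (ψ^[j]) S := by
  induction j with
  | zero => exact Inc.id S
  | succ j ih =>
    have := ih.comp h hm
    simpa [Function.iterate_succ, Function.comp_def] using this

theorem congr (h : Inc ψ S) (he : ∀ x ∈ S, φ x = ψ x) : Inc φ S := by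
  refine ⟨fun x hx y hy hxy => by rw [he x hx, he y hy]; exact h.mono hx hy hxy, ?_⟩
  intro a ha b hb c hc d hd hab hbc hcd
  rw [he a ha, he b hb, he c hc, he d hd]
  exact h.crc a ha b hb c hc d hd hab hbc hcd

end Inc

theorem sqrt_iterate_inc (m : ℕ) : Inc (Real.sqrt^[m]) (Ici 0) :=
  Inc.sqrt.iterate (fun x _ => Real.sqrt_nonneg x) m

theorem sqrt_iterate_mono (m : ℕ) : Monotone (Real.sqrt^[m]) :=
  (show Monotone Real.sqrt from fun _ _ h => Real.sqrt_le_sqrt h).iterate m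

theorem sqrt_iterate_pow (m : ℕ) {x : ℝ} (hx : 0 ≤ x) : (Real.sqrt^[m] x) ^ 2 ^ m = x := by
  induction m generalizing x with
  | zero => simp
  | succ m ih =>
    rw [Function.iterate_succ_apply, pow_succ, pow_mul, ih (Real.sqrt_nonneg x),
      Real.sq_sqrt hx]

theorem sqrt_iterate_of_pow (m : ℕ) {x : ℝ} (hx : 0 ≤ x) : Real.sqrt^[m] (x ^ 2 ^ m) = x := by
  induction m generalizing x with
  | zero => simp
  | succ m ih =>
    rw [Function.iterate_succ_apply, pow_succ, pow_mul, Real.sqrt_sq (by positivity), ih hx]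

theorem sqrt_iterate_nonneg {m : ℕ} (hm : 1 ≤ m) (x : ℝ) : 0 ≤ Real.sqrt^[m] x := by
  obtain ⟨m, rfl⟩ : ∃ j, m = j + 1 := ⟨m - 1, by omega⟩
  rw [Function.iterate_succ_apply']
  exact Real.sqrt_nonneg _

theorem sqrt_iterate_nonpos {m : ℕ} (hm : 1 ≤ m) {x : ℝ} (hx : x ≤ 0) : Real.sqrt^[m] x = 0 := by
  obtain ⟨m, rfl⟩ : ∃ j, m = j + 1 := ⟨m - 1, by omega⟩
  rw [Function.iterate_succ_apply, Real.sqrt_eq_zero_of_nonpos hx]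
  induction m with
  | zero => rfl
  | succ m ih => rw [Function.iterate_succ_apply, Real.sqrt_zero, ih (by omega)]

/-- Parameters: the map is `x ↦ x ^ (2 ^ m) / B - 1`. -/
structure Par where
  m : ℕ
  k : ℕ
  B : ℝ

namespace Par

variable (P : Par)

/-- The positive inverse branch of `x ↦ x ^ (2 ^ m) / B`. -/
def rt (y : ℝ) : ℝ := Real.sqrt^[P.m] (P.B * y)

/-- The pairs of affine-diffeomorphic inverse branches at all levels. -/
def TU : ℕ → (ℝ → ℝ) × (ℝ → ℝ)
  | 0 => (fun y => 1 + y, fun v => 1 - P.rt (1 + -v))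
  | n + 1 =>
    (fun y => (TU n).2 (-(P.rt ((TU n).1 (-y)))),
      fun v => (TU n).2 (-(P.rt ((TU n).1 (- -((fun y => P.rt ((TU n).2 (-(P.rt ((TU n).1 (-y))))))^[P.k]
        (P.rt ((TU n).2 (P.rt ((TU n).1 (-v)))))))))))

def T (n : ℕ) : ℝ → ℝ := (P.TU n).1
def U (n : ℕ) : ℝ → ℝ := (P.TU n).2
def X (n : ℕ) (y : ℝ) : ℝ := P.rt (P.T n y)
def Xi (n : ℕ) (v : ℝ) : ℝ := P.rt (P.U n v)

theorem T_zero (y : ℝ) : P.T 0 y = 1 + y := rfl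
theorem U_zero (v : ℝ) : P.U 0 v = 1 - P.X 0 (-v) := rfl
theorem T_succ (n : ℕ) (y : ℝ) : P.T (n + 1) y = P.U n (-(P.X n (-y))) := rfl
theorem U_succ (n : ℕ) (v : ℝ) :
    P.U (n + 1) v = P.T (n + 1) (-((P.X (n + 1))^[P.k] (P.Xi n (P.X n (-v))))) := rfl
theorem X_succ (n : ℕ) (y : ℝ) : P.X (n + 1) y = P.Xi n (-(P.X n (-y))) := rfl
theorem Xi_succ (n : ℕ) (v : ℝ) :
    P.Xi (n + 1) v = P.X (n + 1) (-((P.X (n + 1))^[P.k] (P.Xi n (P.X n (-v))))) := rfl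

/-- The relation between consecutive closest returns of the critical orbit. -/
def R (n : ℕ) (t : ℝ) : ℝ :=
  (P.X (n + 1))^[P.k] (P.Xi n (P.X n (P.X (n + 1) t)))

section mono

variable (hB : 0 ≤ P.B)
include hB

theorem rt_mono : Monotone P.rt := fun _ _ h =>
  sqrt_iterate_mono _ (mul_le_mul_of_nonneg_left h hB)

theorem TU_mono (n : ℕ) : Monotone (P.T n) ∧ Monotone (P.U n) := by
  have hr := P.rt_mono hB
  induction n with
  | zero =>
    refine ⟨fun x y h => by simpa [T_zero] using h, fun x y h => ?_⟩
    simp only [U_zero, X, T_zero]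
    have := hr (show 1 + -y ≤ 1 + -x by linarith)
    linarith
  | succ n ih =>
    obtain ⟨h1, h2⟩ := ih
    have hT : Monotone (P.T (n + 1)) := fun x y h => by
      simp only [T_succ, X]
      exact h2 (neg_le_neg (hr (h1 (neg_le_neg h))))
    refine ⟨hT, fun x y h => ?_⟩
    simp only [U_succ]
    refine hT (neg_le_neg ?_)
    have hX : Monotone (P.X (n + 1)) := fun x y h => hr (hT h)
    exact hX.iterate _ (hr (h2 (hr (h1 (neg_le_neg h)))))

theorem X_mono (n : ℕ) : Monotone (P.X n) := fun _ _ h => P.rt_mono hB ((P.TU_mono hB n).1 h)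
theorem Xi_mono (n : ℕ) : Monotone (P.Xi n) := fun _ _ h => P.rt_mono hB ((P.TU_mono hB n).2 h)

end mono

theorem rt_nonneg (hm : 1 ≤ P.m) (y : ℝ) : 0 ≤ P.rt y := sqrt_iterate_nonneg hm _
theorem X_nonneg (hm : 1 ≤ P.m) (n : ℕ) (y : ℝ) : 0 ≤ P.X n y := P.rt_nonneg hm _
theorem Xi_nonneg (hm : 1 ≤ P.m) (n : ℕ) (y : ℝ) : 0 ≤ P.Xi n y := P.rt_nonneg hm _

theorem rt_pow (hB : 0 ≤ P.B) {y : ℝ} (hy : 0 ≤ y) : P.rt y ^ 2 ^ P.m = P.B * y :=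
  sqrt_iterate_pow _ (mul_nonneg hB hy)

theorem rt_of_nonpos (hm : 1 ≤ P.m) (hB : 0 ≤ P.B) {y : ℝ} (hy : y ≤ 0) : P.rt y = 0 :=
  sqrt_iterate_nonpos hm (mul_nonpos_of_nonneg_of_nonpos hB hy)

theorem rt_inc (hB : 0 < P.B) : Inc P.rt (Ici 0) :=
  (sqrt_iterate_inc P.m).comp (Inc.const_mul hB _) (fun _ hx => mul_nonneg hB.le hx)

theorem rt_le_one (hm : 1 ≤ P.m) (hB : 0 ≤ P.B) {y : ℝ} (hy : P.B * y ≤ 1) : P.rt y ≤ 1 := by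
  by_contra! h
  rcases le_total y 0 with h0 | h0
  · rw [P.rt_of_nonpos hm hB h0] at h; linarith
  · have := P.rt_pow hB h0
    have := one_lt_pow₀ h (show 2 ^ P.m ≠ 0 by positivity)
    linarith

theorem TU_le_one (hm : 1 ≤ P.m) (n : ℕ) : (∀ y, P.T (n + 1) y ≤ 1) ∧ ∀ y, P.U n y ≤ 1 := by
  have h0 : ∀ v, P.U 0 v ≤ 1 := fun v => by
    have := P.X_nonneg hm 0 (-v)
    rw [U_zero]; linarith
  induction n with
  | zero => exact ⟨fun y => h0 _, h0⟩
  | succ n ih => exact ⟨fun y => ih.1 _, fun y => ih.1 _⟩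

end Par

section continuity

variable (m k : ℕ)

theorem continuous_iterate_param {F : ℝ → ℝ → ℝ} (hF : Continuous fun q : ℝ × ℝ => F q.1 q.2)
    (j : ℕ) : Continuous fun q : ℝ × ℝ => (F q.1)^[j] q.2 := by
  induction j with
  | zero => exact continuous_snd
  | succ j ih =>
    simp only [Function.iterate_succ_apply']
    exact hF.comp (continuous_fst.prodMk ih)

theorem Par.rt_continuous : Continuous fun q : ℝ × ℝ => (Par.mk m k q.1).rt q.2 := by
  have : Continuous (Real.sqrt^[m]) := Real.continuous_sqrt.iterate m
  exact this.comp (continuous_fst.mul continuous_snd)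

theorem Par.TU_continuous (n : ℕ) : (Continuous fun q : ℝ × ℝ => (Par.mk m k q.1).T n q.2) ∧
    Continuous fun q : ℝ × ℝ => (Par.mk m k q.1).U n q.2 := by
  have hr := Par.rt_continuous m k
  induction n with
  | zero =>
    refine ⟨continuous_const.add continuous_snd, continuous_const.sub ?_⟩
    exact hr.comp (continuous_fst.prodMk (continuous_const.add continuous_snd.neg))
  | succ n ih =>
    obtain ⟨h1, h2⟩ := ih
    have hX : Continuous fun q : ℝ × ℝ => (Par.mk m k q.1).X n q.2 :=
      hr.comp (continuous_fst.prodMk h1)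
    have hXi : Continuous fun q : ℝ × ℝ => (Par.mk m k q.1).Xi n q.2 :=
      hr.comp (continuous_fst.prodMk h2)
    have hT : Continuous fun q : ℝ × ℝ => (Par.mk m k q.1).T (n + 1) q.2 :=
      h2.comp (continuous_fst.prodMk (hX.comp (continuous_fst.prodMk continuous_snd.neg)).neg)
    refine ⟨hT, ?_⟩
    have hX' : Continuous fun q : ℝ × ℝ => (Par.mk m k q.1).X (n + 1) q.2 :=
      hr.comp (continuous_fst.prodMk hT)
    have hi := continuous_iterate_param (F := fun b => (Par.mk m k b).X (n + 1)) hX' k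
    have e1 := hX.comp (continuous_fst.prodMk continuous_snd.neg)
    have e2 := hXi.comp (continuous_fst.prodMk e1)
    have e3 := hi.comp (continuous_fst.prodMk e2)
    exact hT.comp (continuous_fst.prodMk e3.neg)

theorem Par.X_continuous (n : ℕ) : Continuous fun q : ℝ × ℝ => (Par.mk m k q.1).X n q.2 :=
  (Par.rt_continuous m k).comp (continuous_fst.prodMk (Par.TU_continuous m k n).1)

theorem Par.Xi_continuous (n : ℕ) : Continuous fun q : ℝ × ℝ => (Par.mk m k q.1).Xi n q.2 :=
  (Par.rt_continuous m k).comp (continuous_fst.prodMk (Par.TU_continuous m k n).2)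

theorem Par.R_continuous (n : ℕ) : Continuous fun q : ℝ × ℝ => (Par.mk m k q.1).R n q.2 := by
  have hi := continuous_iterate_param (F := fun b => (Par.mk m k b).X (n + 1))
    (Par.X_continuous m k (n + 1)) k
  have e0 := Par.X_continuous m k (n + 1)
  have e1 := (Par.X_continuous m k n).comp (continuous_fst.prodMk e0)
  have e2 := (Par.Xi_continuous m k n).comp (continuous_fst.prodMk e1)
  exact hi.comp (continuous_fst.prodMk e2)

end continuity

/-- Backward solution of the relations `a (i + 1) = R i (a (i + 2))`, after `s` steps. -/
def Par.av (P : Par) : ℕ → ℕ → ℝ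
  | 0, _ => 0
  | s + 1, i => P.R i (P.av s (i + 1))

theorem Par.av_continuous (m k s i : ℕ) : Continuous fun b => (Par.mk m k b).av s i := by
  induction s generalizing i with
  | zero => exact continuous_const
  | succ s ih => exact (Par.R_continuous m k i).comp (continuous_id.prodMk (ih (i + 1)))

theorem Par.R_mem (P : Par) (hm : 1 ≤ P.m) (hk : 1 ≤ P.k) (hB : 0 ≤ P.B) (hB1 : P.B ≤ 1) (i : ℕ)
    (t : ℝ) : P.R i t ∈ Icc (0 : ℝ) 1 := by
  obtain ⟨k, hk⟩ : ∃ j, P.k = j + 1 := ⟨P.k - 1, by omega⟩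
  rw [R, hk, Function.iterate_succ_apply']
  refine ⟨P.X_nonneg hm _ _, P.rt_le_one hm hB ?_⟩
  have := (P.TU_le_one hm i).1
  calc P.B * _ ≤ P.B * 1 := mul_le_mul_of_nonneg_left (this _) hB
    _ ≤ 1 := by linarith

theorem Par.av_mem (P : Par) (hm : 1 ≤ P.m) (hk : 1 ≤ P.k) (hB : 0 ≤ P.B) (hB1 : P.B ≤ 1)
    (s i : ℕ) : P.av s i ∈ Icc (0 : ℝ) 1 := by
  cases s with
  | zero => simp [av]
  | succ s => exact P.R_mem hm hk hB hB1 _ _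

theorem Par.exists_sequence (m k : ℕ) (hm : 1 ≤ m) (hk : 1 ≤ k) :
    ∃ (b : ℝ) (a : ℕ → ℝ), b ∈ Icc (1 / 2 : ℝ) 1 ∧ (∀ n, a n ∈ Icc (0 : ℝ) 1) ∧
      (Par.mk m k b).X 0 ((Par.mk m k b).X 0 (a 0)) = 1 ∧
      ∀ n, a n = (Par.mk m k b).R n (a (n + 1)) := by
  let C : Set (ℝ × (ℕ → ℝ)) := Icc (1 / 2 : ℝ) 1 ×ˢ (Set.univ.pi fun _ => Icc (0 : ℝ) 1)
  have hC : IsCompact C := isCompact_Icc.prod (isCompact_univ_pi fun _ => isCompact_Icc)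
  let Z : ℕ → Set (ℝ × (ℕ → ℝ)) := fun N => C ∩
    ({q | (Par.mk m k q.1).X 0 ((Par.mk m k q.1).X 0 (q.2 0)) = 1} ∩
      {q | ∀ n < N, q.2 n = (Par.mk m k q.1).R n (q.2 (n + 1))})
  have hcl : ∀ N, IsClosed (Z N) := by
    intro N
    refine hC.isClosed.inter (IsClosed.inter ?_ ?_)
    · refine isClosed_eq ?_ continuous_const
      have e1 : Continuous fun q : ℝ × (ℕ → ℝ) => (Par.mk m k q.1).X 0 (q.2 0) :=
        (Par.X_continuous m k 0).comp
          (continuous_fst.prodMk ((continuous_apply 0).comp continuous_snd))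
      exact (Par.X_continuous m k 0).comp (continuous_fst.prodMk e1)
    · simp only [Set.ofPred_forall]
      refine isClosed_iInter fun n => isClosed_iInter fun _ => isClosed_eq ?_ ?_
      · exact (continuous_apply n).comp continuous_snd
      · exact (Par.R_continuous m k n).comp
          (continuous_fst.prodMk ((continuous_apply (n + 1)).comp continuous_snd))
  have hne : ∀ N, (Z N).Nonempty := by
    intro N
    have hθ : Continuous fun b => (Par.mk m k b).X 0 ((Par.mk m k b).X 0
        ((Par.mk m k b).av N 0)) := by
      have e1 := (Par.X_continuous m k 0).comp
        (continuous_id.prodMk (Par.av_continuous m k N 0))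
      exact (Par.X_continuous m k 0).comp (continuous_id.prodMk e1)
    have h1 : (Par.mk m k (1/2)).X 0 ((Par.mk m k (1/2)).X 0
        ((Par.mk m k (1/2)).av N 0)) ≤ 1 := by
      have key : ∀ y ≤ 1, (Par.mk m k (1/2)).X 0 y ≤ 1 := fun y hy =>
        Par.rt_le_one _ hm (by norm_num) (by simp only [T_zero]; linarith)
      exact key _ (key _ (Par.av_mem _ hm hk (by norm_num) (by norm_num) _ _).2)
    have h2 : 1 ≤ (Par.mk m k 1).X 0 ((Par.mk m k 1).X 0 ((Par.mk m k 1).av N 0)) := by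
      have key : ∀ y, 0 ≤ y → 1 ≤ (Par.mk m k 1).X 0 y := fun y hy => by
        have := sqrt_iterate_mono m (show (1:ℝ) ^ 2 ^ m ≤ 1 * (1 + y) by rw [one_pow]; linarith)
        rwa [sqrt_iterate_of_pow m zero_le_one] at this
      exact key _ (zero_le_one.trans (key _ (Par.av_mem _ hm hk (by norm_num) (by norm_num) _ _).1))
    obtain ⟨b, hb, hb1⟩ := intermediate_value_Icc (by norm_num : (1/2 : ℝ) ≤ 1)
      hθ.continuousOn ⟨h1, h2⟩
    have hb0 : (0:ℝ) ≤ b := by linarith [hb.1]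
    refine ⟨(b, fun n => (Par.mk m k b).av (N - n) n), ⟨hb, fun n _ => ?_⟩, ?_, ?_⟩
    · exact Par.av_mem _ hm hk hb0 hb.2 _ _
    · exact hb1
    · intro n hn
      have : N - n = (N - (n + 1)) + 1 := by omega
      change (Par.mk m k b).av (N - n) n = _
      rw [this]
      rfl
  have hdir : ∀ N, Z (N + 1) ⊆ Z N := fun N q hq =>
    ⟨hq.1, hq.2.1, fun n hn => hq.2.2 n (by omega)⟩
  obtain ⟨q, hq⟩ := IsCompact.nonempty_iInter_of_sequence_nonempty_isCompact_isClosed Z hdir hne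
    (hC.of_isClosed_subset (hcl 0) inter_subset_left) hcl
  rw [mem_iInter] at hq
  exact ⟨q.1, q.2, (hq 0).1.1, fun n => (hq 0).1.2 n trivial, (hq 0).2.1,
    fun n => (hq (n + 1)).2.2 n (by omega)⟩

/-- Parameters together with the closest returns `a n` of the critical orbit. -/
structure Sys extends Par where
  a : ℕ → ℝ
  hm : 24 ≤ m
  hk : k = 2 ^ m
  hB : B ∈ Icc (1 / 2 : ℝ) 1
  a_zero : a 0 = 1
  a_mem : ∀ n, a n ∈ Icc (0 : ℝ) 1
  a_one : toPar.X 0 (toPar.X 0 (a 1)) = 1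
  a_rec : ∀ n, a (n + 1) = toPar.R n (a (n + 2))

theorem exists_sys_of (m : ℕ) (hm : 24 ≤ m) : Nonempty Sys := by
  obtain ⟨b, a, hb, ha, h1, h2⟩ := Par.exists_sequence m (2 ^ m) (by omega) Nat.one_le_two_pow
  refine ⟨⟨⟨m, 2 ^ m, b⟩, fun n => (Nat.casesOn n 1 a : ℝ), hm, rfl, hb, rfl, ?_, h1, h2⟩⟩
  intro n
  cases n with
  | zero => exact ⟨zero_le_one, le_rfl⟩
  | succ n => exact ha n

theorem exists_sys : Nonempty Sys := exists_sys_of 24 le_rfl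

namespace Sys

variable (S : Sys)

def s (n : ℕ) : ℝ := S.a (n - 1)
def v (n : ℕ) : ℝ := S.X n (S.a (n + 1))
def z (n : ℕ) : ℝ := S.X n 0
/-- Left extension of the domain of `U n`. -/
def lam : ℕ → ℝ
  | 0 => 2
  | n + 1 => S.X n 0
def p (n : ℕ) : ℝ := S.Xi n (S.X n (S.v (n + 1)))

theorem s_succ (n : ℕ) : S.s (n + 1) = S.a n := rfl
theorem s_zero : S.s 0 = 1 := S.a_zero
theorem lam_succ (n : ℕ) : S.lam (n + 1) = S.z n := rfl

theorem hm1 : 1 ≤ S.m := by have := S.hm; omega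
theorem k_pos : 1 ≤ S.k := by rw [S.hk]; exact Nat.one_le_two_pow
theorem B_pos : 0 < S.B := by have := S.hB.1; linarith
theorem B_nonneg : 0 ≤ S.B := S.B_pos.le

theorem Xm (n : ℕ) : Monotone (S.X n) := S.X_mono S.B_nonneg n
theorem Xim (n : ℕ) : Monotone (S.Xi n) := S.Xi_mono S.B_nonneg n
theorem Tm (n : ℕ) : Monotone (S.T n) := (S.TU_mono S.B_nonneg n).1
theorem Um (n : ℕ) : Monotone (S.U n) := (S.TU_mono S.B_nonneg n).2
theorem X0 (n : ℕ) (y : ℝ) : 0 ≤ S.X n y := S.X_nonneg S.hm1 n y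
theorem Xi0 (n : ℕ) (y : ℝ) : 0 ≤ S.Xi n y := S.Xi_nonneg S.hm1 n y
theorem Xiter_nonneg (n : ℕ) (j : ℕ) {y : ℝ} (hy : 0 ≤ y) : 0 ≤ (S.X n)^[j] y := by
  cases j with
  | zero => exact hy
  | succ j => rw [Function.iterate_succ_apply']; exact S.X0 _ _
theorem Xiterm (n j : ℕ) : Monotone ((S.X n)^[j]) := (S.Xm n).iterate j
theorem a_nonneg (n : ℕ) : 0 ≤ S.a n := (S.a_mem n).1
theorem s_nonneg (n : ℕ) : 0 ≤ S.s n := S.a_nonneg _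
theorem v_nonneg (n : ℕ) : 0 ≤ S.v n := S.X0 _ _
theorem z_nonneg (n : ℕ) : 0 ≤ S.z n := S.X0 _ _
theorem z_le_v (n : ℕ) : S.z n ≤ S.v n := S.Xm n (S.a_nonneg _)
theorem p_nonneg (n : ℕ) : 0 ≤ S.p n := S.Xi0 _ _

theorem a_succ (n : ℕ) : S.a (n + 1) = (S.X (n + 1))^[S.k] (S.p n) := S.a_rec n

theorem TU_root (n : ℕ) : S.T n (-S.a n) = 0 ∧ S.U n (-S.v n) = 0 := by
  induction n with
  | zero =>
    refine ⟨by rw [Par.T_zero, S.a_zero]; norm_num, ?_⟩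
    rw [Par.U_zero, neg_neg]
    have := S.a_one
    simp only [v]; linarith
  | succ n ih =>
    have h1 : S.T (n + 1) (-S.a (n + 1)) = 0 := by
      rw [Par.T_succ, neg_neg]; exact ih.2
    refine ⟨h1, ?_⟩
    rw [Par.U_succ, neg_neg]
    have := S.a_succ n
    simp only [p] at this
    rw [← this]; exact h1

theorem T_nonneg {n : ℕ} {y : ℝ} (h : -S.a n ≤ y) : 0 ≤ S.T n y := by
  rw [← (S.TU_root n).1]; exact S.Tm n h
theorem U_nonneg {n : ℕ} {y : ℝ} (h : -S.v n ≤ y) : 0 ≤ S.U n y := by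
  rw [← (S.TU_root n).2]; exact S.Um n h

theorem X_neg_a (n : ℕ) : S.X n (-S.a n) = 0 := by
  rw [Par.X, (S.TU_root n).1]; exact S.rt_of_nonpos S.hm1 S.B_nonneg le_rfl
theorem Xi_neg_v (n : ℕ) : S.Xi n (-S.v n) = 0 := by
  rw [Par.Xi, (S.TU_root n).2]; exact S.rt_of_nonpos S.hm1 S.B_nonneg le_rfl

theorem Xi_le_z (n : ℕ) (y : ℝ) : S.Xi n y ≤ S.z n := by
  cases n with
  | zero =>
    refine S.rt_mono S.B_nonneg ?_
    rw [Par.U_zero, Par.T_zero]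
    have := S.X0 0 (-y); linarith
  | succ n =>
    rw [Par.Xi_succ]
    refine S.Xm _ ?_
    have := S.Xiter_nonneg (n + 1) S.k (S.Xi0 n (S.X n (-y)))
    linarith

theorem X_succ_le_z (n : ℕ) (y : ℝ) : S.X (n + 1) y ≤ S.z n := S.Xi_le_z n _

theorem p_le_z (n : ℕ) : S.p n ≤ S.z n := S.Xi_le_z _ _

theorem Xiter_succ_le_z (n j : ℕ) {y : ℝ} (hy : y ≤ S.z n) : (S.X (n + 1))^[j] y ≤ S.z n := by
  cases j with
  | zero => exact hy
  | succ j => rw [Function.iterate_succ_apply']; exact S.X_succ_le_z _ _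

theorem a_succ_le_z (n : ℕ) : S.a (n + 1) ≤ S.z n := by
  rw [a_succ]; exact S.Xiter_succ_le_z n _ (S.p_le_z n)

theorem z_le_a (n : ℕ) : S.z n ≤ S.a n := by
  cases n with
  | zero =>
    rw [S.a_zero]
    refine S.rt_le_one S.hm1 S.B_nonneg ?_
    rw [Par.T_zero]; linarith [S.hB.2]
  | succ n =>
    rw [a_succ]
    obtain ⟨j, hj⟩ : ∃ j, S.k = j + 1 := ⟨S.k - 1, by have := S.k_pos; omega⟩
    rw [hj, Function.iterate_succ_apply']
    exact S.Xm _ (S.Xiter_nonneg _ _ (S.p_nonneg _))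

theorem z_le_one (n : ℕ) : S.z n ≤ 1 := (S.z_le_a n).trans (S.a_mem n).2

theorem a_succ_le (n : ℕ) : S.a (n + 1) ≤ S.a n := (S.a_succ_le_z n).trans (S.z_le_a n)
theorem z_succ_le (n : ℕ) : S.z (n + 1) ≤ S.z n := (S.z_le_a _).trans (S.a_succ_le_z n)
theorem a_le_s (n : ℕ) : S.a n ≤ S.s n := by
  cases n with
  | zero => rfl
  | succ n => exact S.a_succ_le n

theorem B_v0 : S.B * (1 + S.v 0) = 1 := by
  have h := S.a_one
  have h2 := S.rt_pow S.B_nonneg (y := 1 + S.v 0) (by have := S.v_nonneg 0; linarith)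
  change S.rt (1 + S.v 0) = 1 at h
  rw [h, one_pow] at h2
  exact h2.symm

theorem v0_le_one : S.v 0 ≤ 1 := by
  have h := S.B_v0
  have h1 := S.hB.1
  have h2 := S.v_nonneg 0
  nlinarith

theorem X_le_lam {n : ℕ} {y : ℝ} (hy : y ≤ S.s n) : S.X n y ≤ S.lam n := by
  cases n with
  | zero =>
    rw [S.s_zero] at hy
    change S.rt (1 + y) ≤ 2
    by_contra! h
    rcases le_total (1 + y) 0 with h0 | h0
    · rw [S.rt_of_nonpos S.hm1 S.B_nonneg h0] at h; linarith
    · have h1 := S.rt_pow S.B_nonneg h0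
      have h2 := S.hB
      have h3 : (2:ℝ) < S.rt (1 + y) ^ 2 ^ S.m := h.trans_le
        (le_self_pow₀ (by linarith) (by positivity))
      nlinarith [h2.1, h2.2]
  | succ n => exact S.X_succ_le_z n y

theorem X_z_le_s (n : ℕ) {y : ℝ} (hy : y ≤ S.z n) : S.X n y ≤ S.s n := by
  cases n with
  | zero =>
    rw [S.s_zero, ← S.a_one]
    exact S.Xm _ (hy.trans (S.z_le_v 0))
  | succ n => exact (S.X_succ_le_z n _).trans (S.z_le_a n)

theorem TU_inc (n : ℕ) : Inc (S.T n) (Icc (-S.s n) (S.s n)) ∧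
    Inc (S.U n) (Icc (-S.lam n) (S.s n)) := by
  have X_of : ∀ n, Inc (S.T n) (Icc (-S.s n) (S.s n)) → Inc (S.X n) (Icc (-S.a n) (S.s n)) :=
    fun n h => (S.rt_inc S.B_pos).comp (h.mono_set (Icc_subset_Icc_left
      (neg_le_neg (S.a_le_s n)))) (fun y hy => S.T_nonneg hy.1)
  induction n with
  | zero =>
    have h0 : Inc (S.T 0) (Icc (-S.s 0) (S.s 0)) := Inc.const_add 1 _
    refine ⟨h0, ?_⟩
    have h1 : Inc (S.X 0) (Ici (-1)) := (S.rt_inc S.B_pos).comp (Inc.const_add 1 _)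
      (fun y hy => by simp only [mem_Ici] at *; show 0 ≤ 1 + y; linarith)
    have h2 := h1.neg_neg (S' := Iic 1) (fun y hy => by simp only [mem_Ici, mem_Iic] at *; linarith)
    have h3 := (Inc.const_add 1 univ).comp h2 (fun _ _ => trivial)
    refine (h3.mono_set ?_).congr fun y _ => ?_
    · rw [s_zero]; exact fun y hy => hy.2
    · rw [Par.U_zero]; ring
  | succ n ih =>
    obtain ⟨hT, hU⟩ := ih
    have hX := X_of n hT
    have hT' : Inc (S.T (n + 1)) (Icc (-S.s (n + 1)) (S.s (n + 1))) := by
      have h1 := hX.neg_neg (S' := Icc (-S.a n) (S.a n)) (fun y hy =>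
        ⟨neg_le_neg hy.2, (neg_le.1 hy.1).trans (S.a_le_s n)⟩)
      exact hU.comp h1 (fun y hy => ⟨neg_le_neg (S.X_le_lam ((neg_le.1 hy.1).trans (S.a_le_s n))),
        (neg_nonpos.2 (S.X0 _ _)).trans (S.s_nonneg n)⟩)
    refine ⟨hT', ?_⟩
    have hX' := X_of (n + 1) hT'
    rw [lam_succ, s_succ]
    have hn0 : -S.a (n + 1) ≤ 0 := neg_nonpos.2 (S.a_nonneg _)
    have hXi : Inc (S.Xi n) (Icc 0 (S.s n)) := (S.rt_inc S.B_pos).comp (hU.mono_set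
      (Icc_subset_Icc_left ((neg_nonpos.2 ((S.X0 n 0).trans (S.X_le_lam (S.s_nonneg n)))))))
      (fun y hy => S.U_nonneg ((neg_nonpos.2 (S.v_nonneg n)).trans hy.1))
    have h1 := hX.neg_neg (S' := Icc (-S.z n) (S.a n)) (fun y hy =>
        ⟨neg_le_neg hy.2, (neg_le.1 hy.1).trans ((S.z_le_a n).trans (S.a_le_s n))⟩)
    have h2 := hXi.neg_neg (S' := Icc (-S.s n) 0) (fun y hy =>
        ⟨neg_nonneg.2 hy.2, neg_le.1 hy.1⟩)
    have h3 := h2.comp h1 (fun y hy => ⟨neg_le_neg (S.X_z_le_s n (neg_le.1 hy.1)),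
      neg_nonpos.2 (S.X0 _ _)⟩)
    have h4 := (hX'.mono_set (Icc_subset_Icc_left hn0)).iterate (fun y hy =>
      ⟨S.X0 _ _, (S.X_succ_le_z n y).trans (S.z_le_a n)⟩) S.k
    have h5 := h4.neg_neg (S' := Icc (-S.a n) 0) (fun y hy =>
        ⟨neg_nonneg.2 hy.2, neg_le.1 hy.1⟩)
    have h6 := h5.comp h3 (fun y hy => ⟨neg_le_neg ((S.Xi_le_z n _).trans (S.z_le_a n)),
      neg_nonpos.2 (S.Xi0 _ _)⟩)
    have h7 := hT'.comp h6 (fun y hy => ⟨neg_le_neg (by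
      simp only [neg_neg]
      exact (S.Xiter_succ_le_z n _ (S.Xi_le_z n _)).trans (S.z_le_a n)), by
      simp only [neg_neg]
      exact (neg_nonpos.2 (S.Xiter_nonneg _ _ (S.Xi0 _ _))).trans (S.s_nonneg _)⟩)
    refine h7.congr fun y _ => ?_
    rw [Par.U_succ]
    simp only [neg_neg]

theorem T_inc (n : ℕ) : Inc (S.T n) (Icc (-S.s n) (S.s n)) := (S.TU_inc n).1
theorem U_inc (n : ℕ) : Inc (S.U n) (Icc (-S.lam n) (S.s n)) := (S.TU_inc n).2

theorem X_inc (n : ℕ) : Inc (S.X n) (Icc (-S.a n) (S.s n)) :=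
  (S.rt_inc S.B_pos).comp ((S.T_inc n).mono_set (Icc_subset_Icc_left
      (neg_le_neg (S.a_le_s n)))) (fun _ hy => S.T_nonneg hy.1)

theorem v_le_lam (n : ℕ) : S.v n ≤ S.lam n := S.X_le_lam ((S.a_succ_le n).trans (S.a_le_s n))

theorem Xi_inc (n : ℕ) : Inc (S.Xi n) (Icc (-S.v n) (S.s n)) :=
  (S.rt_inc S.B_pos).comp ((S.U_inc n).mono_set (Icc_subset_Icc_left
      (neg_le_neg (S.v_le_lam n)))) (fun _ hy => S.U_nonneg hy.1)

theorem a_pos (n : ℕ) : 0 < S.a n := by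
  induction n with
  | zero => rw [S.a_zero]; exact one_pos
  | succ n ih =>
    have hs : 0 < S.s n := ih.trans_le (S.a_le_s n)
    have hz : 0 < S.z n := by
      rw [← S.X_neg_a n]
      exact (S.X_inc n).mono ⟨le_rfl, by linarith⟩ ⟨by linarith, hs.le⟩ (by linarith)
    have hv : 0 < S.v n := hz.trans_le (S.z_le_v n)
    have hy : 0 < S.Xi n 0 := by
      refine (S.Xi_neg_v n).symm.trans_lt ?_
      exact (S.Xi_inc n).mono ⟨le_rfl, by linarith⟩ ⟨by linarith, hs.le⟩ (by linarith)
    have hp : 0 < S.p n := hy.trans_le (S.Xim n (S.X0 _ _))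
    have step : ∀ j, 0 < (S.X (n + 1))^[j] (S.p n) := by
      intro j
      induction j with
      | zero => exact hp
      | succ j ihj =>
        rw [Function.iterate_succ_apply']
        refine (S.X0 (n + 1) 0).trans_lt ((S.X_inc (n + 1)).mono ⟨?_, ?_⟩ ⟨?_, ?_⟩ ihj)
        · exact neg_nonpos.2 (S.a_nonneg _)
        · exact ih.le
        · exact (neg_nonpos.2 (S.a_nonneg _)).trans ihj.le
        · exact (S.Xiter_succ_le_z n _ (S.p_le_z n)).trans (S.z_le_a n)
    rw [a_succ]; exact step _

theorem s_pos (n : ℕ) : 0 < S.s n := S.a_pos _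
theorem z_pos (n : ℕ) : 0 < S.z n := by
  rw [← S.X_neg_a n]
  exact (S.X_inc n).mono ⟨le_rfl, by linarith [S.a_pos n, S.s_pos n]⟩
    ⟨by linarith [S.a_pos n], (S.s_pos n).le⟩ (by linarith [S.a_pos n])
theorem z_lt_v (n : ℕ) : S.z n < S.v n :=
  (S.X_inc n).mono ⟨by linarith [S.a_pos n], (S.s_pos n).le⟩
    ⟨by linarith [S.a_pos n, S.a_pos (n+1)], (S.a_succ_le n).trans (S.a_le_s n)⟩ (S.a_pos _)
theorem v_pos (n : ℕ) : 0 < S.v n := (S.z_pos n).trans (S.z_lt_v n)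

theorem B_lt_one : S.B < 1 := by
  have h := S.B_v0
  nlinarith [S.v_pos 0, S.B_pos]

theorem z0_lt_one : S.z 0 < 1 := by
  by_contra! h
  have h1 := S.rt_pow S.B_nonneg (y := 1) zero_le_one
  have h2 : S.z 0 = S.rt 1 := by simp [z, Par.X, Par.T_zero]
  rw [← h2, mul_one] at h1
  have := one_le_pow₀ h (n := 2 ^ S.m)
  linarith [S.B_lt_one]

theorem v0_pow : S.v 0 ^ 2 ^ S.m = S.B * (1 + S.a 1) :=
  S.rt_pow S.B_nonneg (add_nonneg zero_le_one (S.a_nonneg 1))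

theorem v0_lt_one : S.v 0 < 1 := by
  refine lt_of_le_of_ne S.v0_le_one fun h => ?_
  have h1 := S.v0_pow
  have h2 := S.B_v0
  rw [h, one_pow] at h1
  rw [h] at h2
  have := S.a_succ_le_z 0
  have := S.z0_lt_one
  have := S.B_pos
  nlinarith

theorem B_gt_half : 1 / 2 < S.B := by
  have := S.B_v0; have := S.v0_lt_one; have := S.B_pos; nlinarith

/-! ### Dynamics -/

def f (x : ℝ) : ℝ := x ^ 2 ^ S.m / S.B - 1

def q : ℕ → ℕ
  | 0 => 2
  | _ + 1 => S.k + 2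
def M : ℕ → ℕ
  | 0 => 1
  | n + 1 => (S.q n + 1) * M n
def Q (n : ℕ) : ℕ := S.q n * S.M n
def sg (n : ℕ) : ℝ := (-1) ^ n
def tau : ℕ → ℝ
  | 0 => -1
  | n + 1 => sg (n + 1)

theorem M_succ (n : ℕ) : S.M (n + 1) = S.Q n + S.M n := by simp [M, Q]; ring
theorem M_pos (n : ℕ) : 0 < S.M n := by
  induction n with
  | zero => exact one_pos
  | succ n ih => rw [M_succ]; omega

theorem f_neg (x : ℝ) : S.f (-x) = S.f x := by
  have : Even (2 ^ S.m) := (Nat.even_pow.2 ⟨even_two, by have := S.hm; omega⟩)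
  simp [f, this.neg_pow]
theorem f_abs (x : ℝ) : S.f |x| = S.f x := by
  rcases abs_choice x with h | h <;> rw [h]
  exact S.f_neg x
theorem iter_abs {t : ℕ} (ht : 0 < t) (x : ℝ) : S.f^[t] |x| = S.f^[t] x := by
  obtain ⟨t, rfl⟩ : ∃ j, t = j + 1 := ⟨t - 1, by omega⟩
  rw [Function.iterate_succ_apply, f_abs, ← Function.iterate_succ_apply]
theorem iter_eq_of_abs {t : ℕ} (ht : 0 < t) {x y : ℝ} (h : |x| = |y|) : S.f^[t] x = S.f^[t] y := by
  rw [← S.iter_abs ht, h, S.iter_abs ht]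

theorem f_rt {y : ℝ} (hy : 0 ≤ y) : S.f (S.rt y) = y - 1 := by
  rw [f, S.rt_pow S.B_nonneg hy]; field_simp [S.B_pos.ne']

theorem abs_sg (n : ℕ) : |sg n| = 1 := by simp [sg]
theorem abs_tau (n : ℕ) : |tau n| = 1 := by cases n <;> simp [tau, abs_sg]
theorem sg_succ (n : ℕ) : sg (n + 1) = -sg n := by simp [sg, pow_succ]

/-- One level of the dynamics, given that of the return map. -/
theorem iter_X_of {n : ℕ}
    (h : ∀ y ∈ Icc (-S.a n) (S.s n), ∀ x, |x| = S.X n y → S.f^[S.M n] x = sg n * y)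
    (j : ℕ) {y : ℝ} (hy : ∀ i < j, (S.X n)^[i] y ∈ Icc (-S.a n) (S.s n)) {x : ℝ}
    (hx : |x| = |(S.X n)^[j] y|) : |S.f^[j * S.M n] x| = |y| := by
  induction j generalizing x with
  | zero => simpa using hx
  | succ j ih =>
    rw [Function.iterate_succ_apply', abs_of_nonneg (S.X0 _ _)] at hx
    rw [Nat.succ_mul, Function.iterate_add_apply]
    refine ih (fun i hi => hy i (by omega)) ?_
    rw [h _ (hy j (by omega)) _ hx, abs_mul, abs_sg, one_mul]

theorem dyn (n : ℕ) :
    (∀ y ∈ Icc (-S.a n) (S.s n), ∀ x, |x| = S.X n y → S.f^[S.M n] x = sg n * y) ∧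
    (∀ y ∈ Icc (-S.v n) (S.s n), ∀ x, |x| = S.Xi n y → S.f^[S.Q n] x = tau n * y) := by
  induction n with
  | zero =>
    have h0 : ∀ y ∈ Icc (-S.a 0) (S.s 0), ∀ x, |x| = S.X 0 y → S.f^[S.M 0] x = sg 0 * y := by
      intro y hy x hx
      change S.f x = _
      rw [← f_abs, hx, Par.X, S.f_rt (S.T_nonneg hy.1), Par.T_zero, sg]; ring
    refine ⟨h0, ?_⟩
    intro y hy x hx
    have hq : S.Q 0 = 1 + 1 := rfl
    rw [hq, Function.iterate_add_apply]
    have h1 : S.f^[1] x = -S.X 0 (-y) := by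
      change S.f x = _
      rw [← f_abs, hx, Par.Xi, S.f_rt (S.U_nonneg hy.1), Par.U_zero]; ring
    have h2 := h0 (-y) ⟨?_, ?_⟩ (S.f^[1] x) (by rw [h1, abs_neg, abs_of_nonneg (S.X0 _ _)])
    · change S.f _ = _ at h2
      change S.f _ = _
      rw [h2]; simp [sg, tau]
    · have := hy.2; rw [s_zero] at this; rw [S.a_zero]; linarith
    · rw [s_zero]; have := hy.1; have := S.v0_le_one; linarith
  | succ n ih =>
    obtain ⟨ih1, ih2⟩ := ih
    have h0 : ∀ y ∈ Icc (-S.a (n+1)) (S.s (n+1)), ∀ x, |x| = S.X (n+1) y →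
        S.f^[S.M (n+1)] x = sg (n+1) * y := by
      intro y hy x hx
      rw [s_succ] at hy
      rw [M_succ, add_comm, Function.iterate_add_apply]
      rw [ih2 (-(S.X n (-y))) ⟨neg_le_neg (S.Xm n (neg_le.1 hy.1)),
        (neg_nonpos.2 (S.X0 _ _)).trans (S.s_nonneg n)⟩ x (by rw [hx, Par.X_succ])]
      rw [ih1 (-y) ⟨neg_le_neg hy.2, (neg_le.1 hy.1).trans ((S.a_succ_le n).trans (S.a_le_s n))⟩ _
        (by rw [abs_mul, abs_tau, one_mul, abs_neg, abs_of_nonneg (S.X0 _ _)]), sg_succ]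
      ring
    refine ⟨h0, ?_⟩
    intro y hy x hx
    rw [s_succ] at hy
    have hvl := S.v_le_lam (n + 1)
    rw [lam_succ] at hvl
    set w := S.Xi n (S.X n (-y)) with hw
    have hw0 : 0 ≤ w := S.Xi0 _ _
    have hwz : w ≤ S.z n := S.Xi_le_z n _
    have hwp : w ≤ S.p n := S.Xim n (S.Xm n (neg_le.1 hy.1))
    have hwa : (S.X (n + 1))^[S.k] w ≤ S.a (n + 1) := by
      rw [a_succ]; exact S.Xiterm _ _ hwp
    have hw00 := S.Xiter_nonneg (n + 1) S.k hw0
    have e1 := h0 (-((S.X (n + 1))^[S.k] w)) ⟨neg_le_neg hwa,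
      (neg_nonpos.2 hw00).trans (S.s_nonneg _)⟩ x
      (by rw [hx, Par.Xi_succ])
    have e2 := S.iter_X_of h0 S.k (y := w) (x := S.f^[S.M (n + 1)] x) (fun i _ =>
        ⟨(neg_nonpos.2 (S.a_nonneg _)).trans (S.Xiter_nonneg _ _ hw0),
          (S.Xiter_succ_le_z n _ hwz).trans (S.z_le_a n)⟩)
      (by rw [e1, abs_mul, abs_sg, one_mul, abs_neg])
    have hQ : S.Q (n + 1) = S.M n + (S.Q n + (S.k * S.M (n + 1) + S.M (n + 1))) := by
      have := S.M_succ n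
      simp only [Q, q] at *
      rw [this]; ring
    rw [hQ, Function.iterate_add_apply, Function.iterate_add_apply, Function.iterate_add_apply]
    have hzs : S.X n (-y) ≤ S.s n := S.X_z_le_s n ((neg_le.1 hy.1).trans hvl)
    rw [ih2 (S.X n (-y)) ⟨(neg_nonpos.2 (S.v_nonneg _)).trans (S.X0 _ _), hzs⟩ _
      (by rw [e2, abs_of_nonneg hw0])]
    rw [ih1 (-y) ⟨neg_le_neg hy.2, (neg_le.1 hy.1).trans (hvl.trans
      ((S.z_le_a n).trans (S.a_le_s n)))⟩ _
      (by rw [abs_mul, abs_tau, one_mul, abs_of_nonneg (S.X0 _ _)])]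
    simp only [tau, sg_succ]; ring

theorem dyn_X {n : ℕ} {x y : ℝ} (h : y ∈ Icc (-S.a n) (S.s n)) (hx : |x| = S.X n y) :
    S.f^[S.M n] x = sg n * y := (S.dyn n).1 y h x hx
theorem dyn_Xi {n : ℕ} {x y : ℝ} (h : y ∈ Icc (-S.v n) (S.s n)) (hx : |x| = S.Xi n y) :
    S.f^[S.Q n] x = tau n * y := (S.dyn n).2 y h x hx

end Sys

theorem le_of_pow_le {x y : ℝ} {N : ℕ} (hN : N ≠ 0) (hy : 0 ≤ y) (h : x ^ N ≤ y ^ N) : x ≤ y := by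
  by_contra! hc
  exact absurd h (not_le.2 (pow_lt_pow_left₀ hc hy hN))

theorem root_upper {x y t : ℝ} {N : ℕ} (hN : N ≠ 0) (hx : 0 ≤ x) (ht : 0 ≤ t)
    (h : y ^ N ≤ x ^ N * (1 + t)) : y ≤ x * (1 + t / N) := by
  have hN' : (0 : ℝ) < N := by exact_mod_cast Nat.pos_of_ne_zero hN
  refine le_of_pow_le hN (by positivity) (h.trans ?_)
  rw [mul_pow]
  refine mul_le_mul_of_nonneg_left ?_ (by positivity)
  have := one_add_mul_le_pow (a := t / N) (by have : 0 ≤ t / N := by positivity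
                                              linarith) N
  rwa [mul_div_cancel₀ _ hN'.ne'] at this

theorem one_add_div_pow_le {t : ℝ} {N : ℕ} (hN : N ≠ 0) (ht : 0 ≤ t) (ht1 : t ≤ 1) :
    (1 + t / (2 * N)) ^ N ≤ 1 + t := by
  have hN' : (0 : ℝ) < N := by exact_mod_cast Nat.pos_of_ne_zero hN
  have h1 : 1 + t / (2 * N) ≤ Real.exp (t / (2 * N)) := by
    have := Real.add_one_le_exp (t / (2 * N)); linarith
  have h2 : (1 + t / (2 * N)) ^ N ≤ Real.exp (t / 2) := by
    calc _ ≤ Real.exp (t / (2 * N)) ^ N := pow_le_pow_left₀ (by positivity) h1 N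
      _ = Real.exp (t / 2) := by rw [← Real.exp_nat_mul]; congr 1; field_simp
  have h3 := Real.abs_exp_sub_one_sub_id_le (x := t / 2) (by rw [abs_of_nonneg] <;> linarith)
  have h4 := (abs_le.1 h3).2
  nlinarith

theorem root_lower {x y t : ℝ} {N : ℕ} (hN : N ≠ 0) (hx : 0 ≤ x) (hy : 0 ≤ y) (ht : 0 ≤ t)
    (ht1 : t ≤ 1) (h : x ^ N * (1 + t) ≤ y ^ N) : x * (1 + t / (2 * N)) ≤ y := by
  refine le_of_pow_le hN hy (le_trans ?_ h)
  rw [mul_pow]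
  exact mul_le_mul_of_nonneg_left (one_add_div_pow_le hN ht ht1) (by positivity)

theorem one_sub_pow_le_half {x : ℝ} {N : ℕ} (hx : 0 ≤ x) (hx1 : x ≤ 1) (h : 1 ≤ N * x) :
    (1 - x) ^ N ≤ 1 / 2 := by
  have h1 := one_add_mul_le_pow (a := x) (by linarith) N
  have h2 : (1 - x) ^ N * (1 + x) ^ N ≤ 1 := by
    rw [← mul_pow]; exact pow_le_one₀ (by nlinarith) (by nlinarith)
  have h3 : 0 ≤ (1 - x) ^ N := pow_nonneg (by linarith) N
  nlinarith

theorem pow_sub_pow_le {x y : ℝ} (hx : 0 ≤ x) (hxy : x ≤ y) (hy : y ≤ 1) (N : ℕ) :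
    y ^ N - x ^ N ≤ N * (y - x) := by
  induction N with
  | zero => simp
  | succ N ih =>
    have h1 : y ^ N ≤ 1 := pow_le_one₀ (hx.trans hxy) hy
    have h2 : x ^ N ≤ y ^ N := pow_le_pow_left₀ hx hxy N
    have h3 : 0 ≤ x ^ N := pow_nonneg hx N
    push_cast
    rw [pow_succ, pow_succ]
    nlinarith [mul_le_mul_of_nonneg_right h1 (sub_nonneg.2 hxy),
      mul_le_mul_of_nonneg_left (hxy.trans hy) (sub_nonneg.2 h2),
      mul_nonneg h3 (sub_nonneg.2 hxy), mul_nonneg (sub_nonneg.2 h2) (sub_nonneg.2 (hxy.trans hy))]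

theorem two_pow_ge {m : ℕ} (hm : 24 ≤ m) : 208 * m + 17 ≤ 2 ^ m := by
  induction m, hm using Nat.le_induction with
  | base => norm_num
  | succ m hm ih => rw [pow_succ]; omega

theorem two_pow_ge' {m : ℕ} (hm : 24 ≤ m) : 2 * m + 3 ≤ 2 ^ (m - 16) := by
  induction m, hm using Nat.le_induction with
  | base => norm_num
  | succ m hm ih =>
    have : m + 1 - 16 = (m - 16) + 1 := by omega
    rw [this, pow_succ]; omega

namespace Sys

variable (S : Sys)

/-- The order of the critical point. -/
def N : ℕ := 2 ^ S.m
def L : ℝ := S.N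

theorem N_ne : S.N ≠ 0 := by simp [N]
theorem L_eq : S.L = 2 ^ S.m := by simp [L, N]
theorem L_ge : 16777216 ≤ S.L := by
  rw [L_eq]
  have : (2:ℝ) ^ 24 ≤ 2 ^ S.m := pow_le_pow_right₀ (by norm_num) S.hm
  norm_num at this; exact this
theorem L_pos : 0 < S.L := by linarith [S.L_ge]
theorem k_eq : S.k = S.N := S.hk

theorem num_two : S.L ^ 13 ≤ 2 ^ S.N := by
  rw [L_eq, ← pow_mul]
  exact pow_le_pow_right₀ (by norm_num) (by have := two_pow_ge S.hm; simp only [N]; omega)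

theorem num_ratio : S.L ^ 13 < (17 / 16 : ℝ) ^ (S.N - 1) := by
  have h1 : (2:ℝ) ≤ (17 / 16) ^ 16 := by norm_num
  have h2 : S.L ^ 13 < 2 ^ (13 * S.m + 1) := by
    rw [L_eq, ← pow_mul, mul_comm]
    exact pow_lt_pow_right₀ (by norm_num) (by omega)
  calc S.L ^ 13 < 2 ^ (13 * S.m + 1) := h2
    _ ≤ ((17 / 16 : ℝ) ^ 16) ^ (13 * S.m + 1) := pow_le_pow_left₀ (by norm_num) h1 _
    _ = (17 / 16 : ℝ) ^ (16 * (13 * S.m + 1)) := by rw [← pow_mul]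
    _ ≤ _ := pow_le_pow_right₀ (by norm_num) (by
      have := two_pow_ge S.hm; simp only [N]; omega)

theorem num_poly (c : ℝ) (hc : c ≤ S.L ^ 10) : c * S.L ^ 3 ≤ 2 ^ S.N := by
  refine le_trans ?_ S.num_two
  have := mul_le_mul_of_nonneg_right hc (pow_nonneg S.L_pos.le 3)
  calc _ ≤ _ := this
    _ = _ := by ring

theorem L_pow_ge : 16777216 ≤ S.L ^ 10 :=
  S.L_ge.trans (le_self_pow₀ (by linarith [S.L_ge]) (by norm_num))

theorem num_base : (1 - (1 / 2 : ℝ) ^ 16) ^ S.N ≤ 1 / (8 * S.L ^ 2) := by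
  have h1 : (1 - (1 / 2 : ℝ) ^ 16) ^ (2 ^ 16) ≤ 1 / 2 :=
    one_sub_pow_le_half (by norm_num) (by norm_num) (by norm_num)
  have h0 : (0:ℝ) ≤ 1 - (1 / 2 : ℝ) ^ 16 := by norm_num
  have hN : S.N = 2 ^ 16 * 2 ^ (S.m - 16) := by
    rw [← pow_add, N]; congr 1; have := S.hm; omega
  rw [hN, pow_mul]
  calc _ ≤ (1 / 2 : ℝ) ^ 2 ^ (S.m - 16) := pow_le_pow_left₀ (pow_nonneg h0 _) h1 _
    _ ≤ (1 / 2 : ℝ) ^ (2 * S.m + 3) :=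
        pow_le_pow_of_le_one (by norm_num) (by norm_num) (two_pow_ge' S.hm)
    _ = _ := by
      rw [L_eq, one_div_pow, pow_add, mul_comm 2, pow_mul]; congr 1; ring

theorem num_half : (1 - 1 / S.L) ^ S.N ≤ 1 / 2 := by
  have := S.L_ge
  refine one_sub_pow_le_half (by positivity) (by rw [div_le_one S.L_pos]; linarith) ?_
  change 1 ≤ S.L * (1 / S.L)
  rw [mul_one_div_cancel S.L_pos.ne']

theorem num_below (i : ℕ) (hi : i < 24) : (1 / 2 : ℝ) ^ 2 ^ (i + 1) ≤ (1 - 2 ^ i / S.L) ^ S.N := by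
  have hL : S.L = 2 ^ (i + 1) * 2 ^ (S.m - (i + 1)) := by
    rw [L_eq, ← pow_add]; congr 1; have := S.hm; omega
  have hN : S.N = 2 ^ (S.m - (i + 1)) * 2 ^ (i + 1) := by
    rw [← pow_add, N]; congr 1; have := S.hm; omega
  rw [hN, pow_mul]
  refine pow_le_pow_left₀ (by norm_num) ?_ _
  have e : (2:ℝ) ^ i / S.L = 1 / 2 / ((2 ^ (S.m - (i + 1)) : ℕ) : ℝ) := by
    rw [hL, pow_succ]; push_cast; field_simp
  have hp : (1:ℝ) ≤ ((2 ^ (S.m - (i + 1)) : ℕ) : ℝ) := by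
    exact_mod_cast Nat.one_le_two_pow
  have h1 := one_add_mul_le_pow (a := -(2 ^ i / S.L)) (by
    rw [e]
    have : 1 / 2 / ((2 ^ (S.m - (i + 1)) : ℕ) : ℝ) ≤ 1 := by
      rw [div_le_one (by linarith)]; linarith
    linarith) (2 ^ (S.m - (i + 1)))
  rw [← sub_eq_add_neg] at h1
  refine le_trans (le_of_eq ?_) h1
  rw [e]
  generalize ((2 ^ (S.m - (i + 1)) : ℕ) : ℝ) = q at *
  field_simp; ring

theorem X_pow {n : ℕ} {y : ℝ} (hy : -S.a n ≤ y) : S.X n y ^ S.N = S.B * S.T n y :=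
  S.rt_pow S.B_nonneg (S.T_nonneg hy)
theorem Xi_pow {n : ℕ} {y : ℝ} (hy : -S.v n ≤ y) : S.Xi n y ^ S.N = S.B * S.U n y :=
  S.rt_pow S.B_nonneg (S.U_nonneg hy)

/-- Upper distortion bound for `X n`. -/
theorem X_upper {n : ℕ} {u w : ℝ} (hu : 0 ≤ u) (huw : u ≤ w) (hw : w < S.s n) :
    S.X n w ≤ S.X n u * (1 + (w - u) * (S.s n + S.a n) / ((u + S.a n) * (S.s n - w)) / S.L) := by
  have ha := S.a_pos n
  have hs := S.s_pos n
  have has := S.a_le_s n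
  have h1 : 0 < u + S.a n := by linarith
  have h2 : 0 < S.s n - w := by linarith
  have k1 := (S.T_inc n).k1 (a := -S.a n) (b := u) (c := w) (d := S.s n)
    ⟨by linarith, by linarith⟩ ⟨by linarith, by linarith⟩ ⟨by linarith, by linarith⟩
    ⟨by linarith, by linarith⟩ (by linarith) huw hw.le
  rw [(S.TU_root n).1] at k1
  refine root_upper S.N_ne (S.X0 _ _) ?_ ?_
  · refine div_nonneg (mul_nonneg (by linarith) (by linarith)) (by positivity)
  · rw [S.X_pow (by linarith), S.X_pow (by linarith), mul_assoc]
    refine mul_le_mul_of_nonneg_left ?_ S.B_nonneg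
    have h3 : 0 < (u + S.a n) * (S.s n - w) := by positivity
    rw [mul_add, mul_one, mul_div_assoc', ← sub_le_iff_le_add', le_div_iff₀ h3]
    linarith

/-- Lower distortion bound for `X n`. -/
theorem X_lower {n : ℕ} {u w t : ℝ} (hu : 0 ≤ u) (huw : u ≤ w) (hw : w ≤ S.s n) (ht : 0 ≤ t)
    (ht1 : t ≤ 1) (h : t * ((u + S.a n) * (w + S.s n)) ≤ (S.s n - S.a n) * (w - u)) :
    S.X n u * (1 + t / (2 * S.L)) ≤ S.X n w := by
  have ha := S.a_pos n
  have hs := S.s_pos n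
  have has := S.a_le_s n
  have k2 := (S.T_inc n).k2 (a := -S.s n) (b := -S.a n) (c := u) (d := w)
    ⟨by linarith, by linarith⟩ ⟨by linarith, by linarith⟩ ⟨by linarith, by linarith⟩
    ⟨by linarith, by linarith⟩ (by linarith) (by linarith) huw
  rw [(S.TU_root n).1] at k2
  have h0 : 0 ≤ S.T n u := S.T_nonneg (by linarith)
  refine root_lower S.N_ne (S.X0 _ _) (S.X0 _ _) ht ht1 ?_
  rw [S.X_pow (by linarith), S.X_pow (by linarith), mul_assoc]
  refine mul_le_mul_of_nonneg_left ?_ S.B_nonneg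
  have h3 : 0 < (u + S.a n) * (w + S.s n) := mul_pos (by linarith) (by linarith)
  have h4 := mul_le_mul_of_nonneg_left h h0
  refine le_of_mul_le_mul_right ?_ h3
  linarith

/-- Lower distortion bound for `Xi n`. -/
theorem Xi_lower {n : ℕ} {u w t : ℝ} (hu : 0 ≤ u) (huw : u ≤ w) (hw : w ≤ S.s n) (ht : 0 ≤ t)
    (ht1 : t ≤ 1) (h : t * ((u + S.v n) * (w + S.lam n)) ≤ (S.lam n - S.v n) * (w - u)) :
    S.Xi n u * (1 + t / (2 * S.L)) ≤ S.Xi n w := by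
  have ha := S.v_pos n
  have hs := S.s_pos n
  have has := S.v_le_lam n
  have k2 := (S.U_inc n).k2 (a := -S.lam n) (b := -S.v n) (c := u) (d := w)
    ⟨by linarith, by linarith⟩ ⟨by linarith, by linarith⟩ ⟨by linarith, by linarith⟩
    ⟨by linarith, by linarith⟩ (by linarith) (by linarith) huw
  rw [(S.TU_root n).2] at k2
  have h0 : 0 ≤ S.U n u := S.U_nonneg (by linarith)
  refine root_lower S.N_ne (S.Xi0 _ _) (S.Xi0 _ _) ht ht1 ?_
  rw [S.Xi_pow (by linarith), S.Xi_pow (by linarith), mul_assoc]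
  refine mul_le_mul_of_nonneg_left ?_ S.B_nonneg
  have h3 : 0 < (u + S.v n) * (w + S.lam n) := mul_pos (by linarith) (by linarith)
  have h4 := mul_le_mul_of_nonneg_left h h0
  refine le_of_mul_le_mul_right ?_ h3
  linarith

def r (n : ℕ) : ℝ := S.Xi n (S.X n (S.z (n + 1)))
def h (n : ℕ) : ℝ := S.X n (-(S.X n)^[S.k] (S.z n))

/-- The geometric estimates at level `j + 1`. -/
structure Geo (j : ℕ) : Prop where
  g1 : 8 / S.L * S.a j ≤ S.a j - S.p j
  g2 : S.a j ≤ 20 * S.L ^ 2 * S.z (j + 1)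
  g3 : S.r j * (8 * (S.v (j + 1) - S.z (j + 1)) / (128 * S.L ^ 4 * S.a j)) ≤ S.p j - S.r j
  g4 : S.z j / S.L ≤ S.z j - S.v (j + 1)

theorem h_nonneg (n : ℕ) : 0 ≤ S.h n := S.X0 _ _

theorem z_succ_eq (n : ℕ) : S.z (n + 1) = S.Xi n (-S.z n) := by
  simp only [z]; rw [Par.X_succ, neg_zero]

theorem z_le_Xi (n : ℕ) {y : ℝ} (hy : 0 ≤ y) : S.z (n + 1) ≤ S.Xi n y := by
  rw [z_succ_eq]; exact S.Xim n (by linarith [S.z_nonneg n])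

theorem Xi_succ_le_h (j : ℕ) (y : ℝ) : S.Xi (j + 1) y ≤ S.h (j + 1) := by
  rw [Par.Xi_succ, h]
  exact S.Xm _ (neg_le_neg (S.Xiterm _ _ (S.z_le_Xi j (S.X0 _ _))))

theorem p_succ_le_h (j : ℕ) : S.p (j + 1) ≤ S.h (j + 1) := S.Xi_succ_le_h j _

theorem X_le_p (j : ℕ) (y : ℝ) : S.X (j + 1) y ≤ S.p j := by
  rw [Par.X_succ]
  exact S.Xim j ((neg_nonpos.2 (S.X0 _ _)).trans (S.X0 _ _))

theorem z_le_r (j : ℕ) : S.z (j + 1) ≤ S.r j := S.z_le_Xi j (S.X0 _ _)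
theorem r_le_p (j : ℕ) : S.r j ≤ S.p j := S.Xim j (S.Xm j (S.z_le_v _))

theorem z_succ_eq' (j : ℕ) :
    S.z (j + 2) = S.X (j + 1) (-(S.X (j + 1))^[S.k] (S.r j)) := by
  rw [z_succ_eq, Par.Xi_succ, neg_neg]; rfl

theorem z_le_h (j : ℕ) : S.z (j + 2) ≤ S.h (j + 1) := by
  rw [z_succ_eq]; exact S.Xi_succ_le_h j _

end Sys

namespace Sys

variable (S : Sys) {j : ℕ}

theorem Xiter_le_p (j i : ℕ) : (S.X (j + 1))^[i] (S.p j) ≤ S.p j := by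
  cases i with
  | zero => exact le_rfl
  | succ i => rw [Function.iterate_succ_apply']; exact S.X_le_p _ _

theorem Xiter_p_anti (j i : ℕ) :
    (S.X (j + 1))^[i + 1] (S.p j) ≤ (S.X (j + 1))^[i] (S.p j) := by
  rw [Function.iterate_succ_apply]
  exact S.Xiterm _ _ (S.X_le_p _ _)

theorem a_le_p (j : ℕ) : S.a (j + 1) ≤ S.p j := by rw [a_succ]; exact S.Xiter_le_p j _

theorem X_a_le_a (j : ℕ) : S.X (j + 1) (S.a (j + 1)) ≤ S.a (j + 1) := by
  rw [a_succ, ← Function.iterate_succ_apply' (S.X (j + 1))]; exact S.Xiter_p_anti j _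

theorem Xiter_z_mono (n i : ℕ) : (S.X n)^[i] (S.z n) ≤ (S.X n)^[i + 1] (S.z n) := by
  rw [Function.iterate_succ_apply]
  exact S.Xiterm _ _ (S.Xm n (S.z_nonneg n))

theorem z_le_Xiter_z (n i : ℕ) : S.z n ≤ (S.X n)^[i] (S.z n) := by
  induction i with
  | zero => exact le_rfl
  | succ i ih => exact ih.trans (S.Xiter_z_mono n i)

theorem z_le_p (j : ℕ) : S.z (j + 1) ≤ S.p j := (S.z_le_r j).trans (S.r_le_p j)

theorem Xiter_z_le_a (j : ℕ) {i : ℕ} (hi : i ≤ S.k) :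
    (S.X (j + 1))^[i] (S.z (j + 1)) ≤ S.a (j + 1) := by
  have h1 : (S.X (j + 1))^[i] (S.z (j + 1)) ≤ (S.X (j + 1))^[S.k] (S.z (j + 1)) :=
    monotone_nat_of_le_succ (fun i => S.Xiter_z_mono (j + 1) i) hi
  refine h1.trans ?_
  rw [a_succ]; exact S.Xiterm _ _ (S.z_le_p j)

/-- `b = X^[k] z`. -/
def b (n : ℕ) : ℝ := (S.X n)^[S.k] (S.z n)

theorem z_le_b (n : ℕ) : S.z n ≤ S.b n := S.z_le_Xiter_z n _
theorem b_le_a (j : ℕ) : S.b (j + 1) ≤ S.a (j + 1) := S.Xiter_z_le_a j le_rfl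

theorem b_le_Xa (j : ℕ) : S.b (j + 1) ≤ S.X (j + 1) (S.a (j + 1)) := by
  obtain ⟨i, hi⟩ : ∃ i, S.k = i + 1 := ⟨S.k - 1, by have := S.k_pos; omega⟩
  rw [b, hi, Function.iterate_succ_apply']
  exact S.Xm _ (S.Xiter_z_le_a j (by omega))

theorem four_pow (S : Sys) : (1 / 4 : ℝ) ^ S.N * (20 * S.L ^ 2) ≤ 3 / 4 := by
  have h1 := S.num_poly 32 (by linarith [S.L_pow_ge])
  have h2 : (2:ℝ) ^ S.N * 1 ≤ 2 ^ S.N * 2 ^ S.N :=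
    mul_le_mul_of_nonneg_left (one_le_pow₀ (by norm_num)) (by positivity)
  have h3 : (4:ℝ) ^ S.N = 2 ^ S.N * 2 ^ S.N := by rw [← mul_pow]; norm_num
  have h4 : S.L ^ 2 ≤ S.L ^ 3 := pow_le_pow_right₀ (by linarith [S.L_ge]) (by norm_num)
  have h5 : 0 ≤ S.L ^ 3 := by have := S.L_pos; positivity
  rw [one_div_pow, one_div_mul_eq_div, div_le_iff₀ (by positivity), h3]
  nlinarith

namespace Geo

variable {S} (hg : S.Geo j)
include hg

theorem p_lt : S.p j < S.a j := by
  have := hg.g1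
  have h2 : 0 < 8 / S.L * S.a j := mul_pos (div_pos (by norm_num) S.L_pos) (S.a_pos j)
  linarith

theorem contr {u w : ℝ} (hu : 0 ≤ u) (huw : u ≤ w) (hw : w ≤ S.p j)
    (hX : S.X (j + 1) u ≤ S.a (j + 1)) :
    S.X (j + 1) w - S.X (j + 1) u ≤ 1 / 4 * (w - u) := by
  have hlt := hg.p_lt
  have h1 := S.X_upper (n := j + 1) hu huw (by rw [s_succ]; linarith)
  rw [s_succ] at h1
  have ha := S.a_pos (j + 1)
  have has := S.a_succ_le j
  have hL := S.L_pos
  have hX0 := S.X0 (j + 1) u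
  have g1 : 8 * S.a j ≤ (S.a j - w) * S.L := by
    have := mul_le_mul_of_nonneg_right (hg.g1.trans (sub_le_sub_left hw (S.a j))) hL.le
    rw [div_mul_eq_mul_div, div_mul_cancel₀ _ hL.ne'] at this
    exact this
  have hd : 0 < (u + S.a (j + 1)) * (S.a j - w) * S.L :=
    mul_pos (mul_pos (by linarith) (by linarith)) hL
  have key : S.X (j + 1) u * ((w - u) * (S.a j + S.a (j + 1)) /
      ((u + S.a (j + 1)) * (S.a j - w)) / S.L) ≤ 1 / 4 * (w - u) := by
    rw [div_div, mul_div_assoc', div_le_iff₀ hd]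
    have e1 : S.X (j + 1) u * (8 * S.a j) ≤ (u + S.a (j + 1)) * ((S.a j - w) * S.L) :=
      mul_le_mul (by linarith) g1 (by linarith [S.a_pos j]) (by linarith)
    have e2 : S.X (j + 1) u * (4 * (S.a j + S.a (j + 1))) ≤ S.X (j + 1) u * (8 * S.a j) :=
      mul_le_mul_of_nonneg_left (by linarith) hX0
    have := mul_le_mul_of_nonneg_left (e2.trans e1) (sub_nonneg.2 huw)
    linarith
  rw [mul_add, mul_one] at h1
  linarith

theorem contr_iter {w : ℝ} (hzw : S.z (j + 1) ≤ w) (hw : w ≤ S.p j) {i : ℕ} (hi : i ≤ S.k) :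
    (S.X (j + 1))^[i] w - (S.X (j + 1))^[i] (S.z (j + 1)) ≤ (1 / 4) ^ i * (w - S.z (j + 1)) := by
  induction i with
  | zero => simp
  | succ i ih =>
    have ih := ih (by omega)
    rw [Function.iterate_succ_apply', Function.iterate_succ_apply']
    have := hg.contr (u := (S.X (j + 1))^[i] (S.z (j + 1))) (w := (S.X (j + 1))^[i] w)
      (S.Xiter_nonneg _ _ (S.z_nonneg _)) (S.Xiterm _ _ hzw)
      ((S.Xiterm _ _ hw).trans (S.Xiter_le_p j i))
      (by rw [← Function.iterate_succ_apply' (S.X (j + 1))]; exact S.Xiter_z_le_a j hi)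
    rw [pow_succ]
    linarith

theorem a_sub_b : S.a (j + 1) - S.b (j + 1) ≤ (1 / 4) ^ S.N * (20 * S.L ^ 2 * S.z (j + 1)) := by
  have h1 := hg.contr_iter (S.z_le_p j) le_rfl le_rfl
  rw [← a_succ, k_eq] at h1
  rw [b, k_eq]
  refine h1.trans (mul_le_mul_of_nonneg_left ?_ (by positivity))
  linarith [hg.g2, hg.p_lt, S.z_nonneg (j + 1)]

theorem Xa_le : S.X (j + 1) (S.a (j + 1)) ≤ 5 / 4 * S.z (j + 1) := by
  have hlt := hg.p_lt
  have hap := S.a_le_p j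
  have h1 := S.X_upper (n := j + 1) le_rfl (S.a_nonneg (j + 1)) (by rw [s_succ]; linarith)
  rw [s_succ] at h1
  have ha := S.a_pos (j + 1)
  have hL := S.L_pos
  have g1 : 8 * S.a j ≤ (S.a j - S.a (j + 1)) * S.L := by
    have := mul_le_mul_of_nonneg_right (hg.g1.trans (sub_le_sub_left hap (S.a j))) hL.le
    rw [div_mul_eq_mul_div, div_mul_cancel₀ _ hL.ne'] at this
    exact this
  have hd : 0 < S.a (j + 1) * (S.a j - S.a (j + 1)) * S.L :=
    mul_pos (mul_pos (by linarith) (by linarith)) hL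
  have key : (S.a (j + 1) - 0) * (S.a j + S.a (j + 1)) /
      ((0 + S.a (j + 1)) * (S.a j - S.a (j + 1))) / S.L ≤ 1 / 4 := by
    rw [div_div, zero_add, sub_zero, div_le_iff₀ hd]
    have := mul_le_mul_of_nonneg_left g1 ha.le
    nlinarith [S.a_succ_le j]
  have := mul_le_mul_of_nonneg_left (add_le_add_right key 1) (S.z_nonneg (j + 1))
  change _ ≤ S.z (j + 1) * _ at h1
  linarith

theorem a_le_two_z : S.a (j + 1) ≤ 2 * S.z (j + 1) := by
  have h1 := hg.a_sub_b
  have h2 := (S.b_le_Xa j).trans hg.Xa_le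
  have h3 := mul_le_mul_of_nonneg_right S.four_pow (S.z_nonneg (j + 1))
  linarith

theorem h_le : S.h (j + 1) ≤ 1 / 2 * S.z (j + 1) := by
  have hlt := hg.p_lt
  have hap := S.a_le_p j
  have hba := S.b_le_a j
  have hzb := S.z_le_b (j + 1)
  have hz := S.z_pos (j + 1)
  have hL := S.L_pos
  have k2 := (S.T_inc (j + 1)).k2 (a := -S.s (j + 1)) (b := -S.a (j + 1)) (c := -S.b (j + 1)) (d := 0)
  rw [s_succ] at k2
  have k2 := k2 ⟨by linarith, by linarith⟩ ⟨by linarith, by linarith⟩ ⟨by linarith, by linarith⟩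
    ⟨by linarith, by linarith⟩ (by linarith) (by linarith) (by linarith)
  rw [(S.TU_root _).1] at k2
  have hT0 : 0 ≤ S.T (j + 1) 0 := S.T_nonneg (by linarith [S.a_nonneg (j + 1)])
  have hTb : 0 ≤ S.T (j + 1) (-S.b (j + 1)) := S.T_nonneg (by linarith)
  have g1 : 8 / S.L * S.a j ≤ S.a j - S.a (j + 1) := hg.g1.trans (by linarith)
  -- the ratio bound
  have e1 : S.T (j + 1) (-S.b (j + 1)) * (8 / S.L * S.a j * S.z (j + 1)) ≤
      (S.a (j + 1) - S.b (j + 1)) * S.a j * S.T (j + 1) 0 := by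
    have h1 : 8 / S.L * S.a j * S.z (j + 1) ≤ (S.a j - S.a (j + 1)) * S.b (j + 1) :=
      mul_le_mul g1 hzb hz.le (by linarith)
    have h2 := mul_le_mul_of_nonneg_left h1 hTb
    have h3 : 0 ≤ (S.a (j + 1) - S.b (j + 1)) * S.a j * S.T (j + 1) (-S.b (j + 1)) :=
      mul_nonneg (mul_nonneg (by linarith) (by linarith)) hTb
    linarith
  have e2 : S.T (j + 1) (-S.b (j + 1)) ≤ (1 / 2) ^ S.N * S.T (j + 1) 0 := by
    have hpos : 0 < 8 / S.L * S.a j * S.z (j + 1) :=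
      mul_pos (mul_pos (div_pos (by norm_num) hL) (S.a_pos j)) hz
    refine le_of_mul_le_mul_right (e1.trans ?_) hpos
    have h1 : S.a (j + 1) - S.b (j + 1) ≤ (1 / 2) ^ S.N * (8 / S.L * S.z (j + 1)) := by
      refine hg.a_sub_b.trans ?_
      have h4 : (1 / 4 : ℝ) ^ S.N = (1 / 2) ^ S.N * (1 / 2) ^ S.N := by
        rw [← mul_pow]; norm_num
      rw [h4, mul_assoc]
      refine mul_le_mul_of_nonneg_left ?_ (by positivity)
      rw [← mul_assoc]
      refine mul_le_mul_of_nonneg_right ?_ hz.le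
      have h5 := S.num_poly 20 (by linarith [S.L_pow_ge])
      rw [one_div_pow, one_div_mul_eq_div, div_le_div_iff₀ (by positivity) hL]
      have : (0:ℝ) < 2 ^ S.N := by positivity
      nlinarith
    have := mul_le_mul_of_nonneg_right h1 (mul_nonneg (S.a_nonneg j) hT0)
    linarith
  refine le_of_pow_le S.N_ne (by linarith) ?_
  have x1 := S.X_pow (n := j + 1) (y := -S.b (j + 1)) (by linarith)
  have x2 := S.X_pow (n := j + 1) (y := 0) (by linarith [S.a_nonneg (j + 1)])
  rw [mul_pow]
  change S.h (j + 1) ^ S.N = _ at x1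
  change S.z (j + 1) ^ S.N = _ at x2
  rw [x1, x2]
  have := mul_le_mul_of_nonneg_left e2 S.B_nonneg
  linarith

/-- Expansion bound from below. -/
theorem lower {u w : ℝ} (hu : 0 ≤ u) (huw : u ≤ w) (hw : w ≤ S.p j) (hua : u ≤ S.a (j + 1))
    (hwu : w - u ≤ S.a (j + 1)) :
    S.X (j + 1) u * (1 + (w - u) / (S.L ^ 2 * S.a (j + 1))) ≤ S.X (j + 1) w := by
  have hlt := hg.p_lt
  have hap := S.a_le_p j
  have hL := S.L_pos
  have ha := S.a_pos (j + 1)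
  have h0 := S.a_pos j
  have e1 : 2 * (w - u) / (S.L * S.a (j + 1)) * (S.L * S.a (j + 1)) = 2 * (w - u) := by
    field_simp
  have hL1 := S.L_ge
  set t := 2 * (w - u) / (S.L * S.a (j + 1)) with ht
  have t0 : 0 ≤ t := by rw [ht]; exact div_nonneg (by linarith) (by positivity)
  have := S.X_lower (n := j + 1) (t := t) hu huw (by rw [s_succ]; linarith) t0 ?_ ?_
  · have e2 : t / (2 * S.L) = (w - u) / (S.L ^ 2 * S.a (j + 1)) := by
      rw [ht]; field_simp
    rwa [e2] at this
  · rw [ht, div_le_one (by positivity)]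
    nlinarith
  · rw [s_succ]
    have g1 : 8 * S.a j ≤ (S.a j - S.a (j + 1)) * S.L := by
      have := mul_le_mul_of_nonneg_right (hg.g1.trans (sub_le_sub_left hap (S.a j))) hL.le
      rw [div_mul_eq_mul_div, div_mul_cancel₀ _ hL.ne'] at this
      exact this
    have h1 : t * ((u + S.a (j + 1)) * (w + S.a j)) ≤ t * ((2 * S.a (j + 1)) * (2 * S.a j)) := by
      refine mul_le_mul_of_nonneg_left (mul_le_mul (by linarith) (by linarith) ?_ (by linarith)) t0
      linarith
    have h2 : (t * ((2 * S.a (j + 1)) * (2 * S.a j))) * S.L = 8 * S.a j * (w - u) := by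
      calc _ = (t * (S.L * S.a (j + 1))) * (4 * S.a j) := by ring
        _ = _ := by rw [e1]; ring
    refine h1.trans ?_
    refine le_of_mul_le_mul_right ?_ hL
    rw [h2]
    have := mul_le_mul_of_nonneg_right g1 (sub_nonneg.2 huw)
    linarith

theorem lower' {u w : ℝ} (hu : 0 ≤ u) (huw : u ≤ w) (hw : w ≤ S.p j) (hua : u ≤ S.a (j + 1))
    (hwu : w - u ≤ S.a (j + 1)) :
    1 / (2 * S.L ^ 2) * (w - u) ≤ S.X (j + 1) w - S.X (j + 1) u := by
  have h1 := hg.lower hu huw hw hua hwu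
  have h2 := hg.a_le_two_z
  have h3 : S.z (j + 1) ≤ S.X (j + 1) u := S.Xm _ hu
  have ha := S.a_pos (j + 1)
  have hL := S.L_pos
  have e : 1 / (2 * S.L ^ 2) * (w - u) = S.a (j + 1) / 2 * ((w - u) / (S.L ^ 2 * S.a (j + 1))) := by
    field_simp
  have := mul_le_mul_of_nonneg_right (show S.a (j + 1) / 2 ≤ S.X (j + 1) u by linarith)
    (div_nonneg (sub_nonneg.2 huw) (by positivity : 0 ≤ S.L ^ 2 * S.a (j + 1)))
  linarith

theorem z_lower {w : ℝ} (hw0 : 0 ≤ w) (hw : w ≤ S.a (j + 1)) :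
    S.z (j + 1) * (w / (S.L ^ 2 * S.a (j + 1))) ≤ S.X (j + 1) w - S.z (j + 1) := by
  have := hg.lower le_rfl hw0 (hw.trans (S.a_le_p j)) (S.a_nonneg _) (by linarith)
  rw [sub_zero] at this
  change S.z (j + 1) * _ ≤ _ at this
  linarith

theorem a_sub_b_ge : (1 / (2 * S.L ^ 2)) ^ (S.N + 1) * S.z (j + 1) ≤ S.a (j + 1) - S.b (j + 1) := by
  have hL := S.L_pos
  have hz := S.z_pos (j + 1)
  have ha := S.a_pos (j + 1)
  have h0 : 1 / (2 * S.L ^ 2) * S.z (j + 1) ≤ S.a (j + 1) - S.z (j + 1) := by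
    have h1 := hg.z_lower (S.a_nonneg (j + 1)) le_rfl
    have h2 := S.X_a_le_a j
    have e : S.z (j + 1) * (S.a (j + 1) / (S.L ^ 2 * S.a (j + 1))) =
      2 * (1 / (2 * S.L ^ 2) * S.z (j + 1)) := by field_simp
    have : 0 < 1 / (2 * S.L ^ 2) * S.z (j + 1) := by positivity
    linarith
  have hza := S.z_le_a (j + 1)
  have key : ∀ i ≤ S.k, (1 / (2 * S.L ^ 2)) ^ i * (S.a (j + 1) - S.z (j + 1)) ≤
      (S.X (j + 1))^[i] (S.a (j + 1)) - (S.X (j + 1))^[i] (S.z (j + 1)) := by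
    intro i hi
    induction i with
    | zero => simp
    | succ i ih =>
      have ih := ih (by omega)
      have hc := hg.contr_iter hza (S.a_le_p j) (show i ≤ S.k by omega)
      have h1 := hg.lower' (u := (S.X (j + 1))^[i] (S.z (j + 1)))
        (w := (S.X (j + 1))^[i] (S.a (j + 1)))
        (S.Xiter_nonneg _ _ (S.z_nonneg _)) (S.Xiterm _ _ hza)
        ((S.Xiterm _ _ (S.a_le_p j)).trans (S.Xiter_le_p j i))
        (S.Xiter_z_le_a j (by omega)) (by
          have : (1 / 4 : ℝ) ^ i ≤ 1 := pow_le_one₀ (by norm_num) (by norm_num)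
          nlinarith)
      rw [Function.iterate_succ_apply', Function.iterate_succ_apply', pow_succ']
      have := mul_le_mul_of_nonneg_left ih (show 0 ≤ 1 / (2 * S.L ^ 2) by positivity)
      linarith
  have h1 := key S.k le_rfl
  have h2 : (S.X (j + 1))^[S.k] (S.a (j + 1)) ≤ S.a (j + 1) := by
    conv_rhs => rw [a_succ]
    exact S.Xiterm _ _ (S.a_le_p j)
  have h3 := mul_le_mul_of_nonneg_left h0 (show 0 ≤ (1 / (2 * S.L ^ 2)) ^ S.N by positivity)
  rw [pow_succ, b]
  rw [k_eq] at *
  linarith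

theorem z_le_h : S.z (j + 1) ≤ 5 * S.L ^ 2 * S.h (j + 1) := by
  have hap := S.a_le_p j
  have hba := S.b_le_a j
  have hzb := S.z_le_b (j + 1)
  have hz := S.z_pos (j + 1)
  have has := S.a_succ_le j
  have hL := S.L_pos
  have hL1 := S.L_ge
  have hab := hg.a_sub_b_ge
  have hp : 0 < (1 / (2 * S.L ^ 2)) ^ (S.N + 1) := by positivity
  have hab0 : 0 < S.a (j + 1) - S.b (j + 1) := (mul_pos hp hz).trans_le hab
  have k1 := (S.T_inc (j + 1)).k1 (a := -S.a (j + 1)) (b := -S.b (j + 1)) (c := 0) (d := S.s (j + 1))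
  rw [s_succ] at k1
  have k1 := k1 ⟨by linarith, by linarith⟩ ⟨by linarith, by linarith⟩ ⟨by linarith, by linarith⟩
    ⟨by linarith, by linarith⟩ (by linarith) (by linarith) (by linarith)
  rw [(S.TU_root _).1] at k1
  have hTb : 0 ≤ S.T (j + 1) (-S.b (j + 1)) := S.T_nonneg (by linarith)
  have e1 : S.T (j + 1) 0 * (S.a (j + 1) - S.b (j + 1)) ≤
      5 * S.z (j + 1) * S.T (j + 1) (-S.b (j + 1)) := by
    refine le_of_mul_le_mul_right ?_ (S.a_pos j)
    have h2 : S.b (j + 1) * (S.a j + S.a (j + 1)) + (S.a (j + 1) - S.b (j + 1)) * S.a j ≤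
      5 * S.z (j + 1) * S.a j := by
      have h3 := hg.a_le_two_z
      have h4 := (S.b_le_Xa j).trans hg.Xa_le
      have h5 := S.a_pos j
      nlinarith
    have := mul_le_mul_of_nonneg_left h2 hTb
    linarith
  have e2 : S.T (j + 1) 0 ≤ (5 * S.L ^ 2) ^ S.N * S.T (j + 1) (-S.b (j + 1)) := by
    have hc : 1 ≤ (5 * S.L ^ 2) ^ S.N * ((1 / (2 * S.L ^ 2)) ^ (S.N + 1) / 5) := by
      rw [pow_succ (1 / (2 * S.L ^ 2)) S.N, ← mul_div_assoc, ← mul_assoc, ← mul_pow]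
      have e : 5 * S.L ^ 2 * (1 / (2 * S.L ^ 2)) = 5 / 2 := by field_simp
      rw [e]
      have h1 : (2:ℝ) ^ S.N ≤ (5 / 2) ^ S.N := pow_le_pow_left₀ (by norm_num) (by norm_num) _
      have h2 := S.num_poly 10 (by linarith [S.L_pow_ge])
      have h4 : S.L ^ 2 ≤ S.L ^ 3 := pow_le_pow_right₀ (by linarith [S.L_ge]) (by norm_num)
      have e3 : (5 / 2 : ℝ) ^ S.N * (1 / (2 * S.L ^ 2)) / 5 = (5 / 2 : ℝ) ^ S.N / (10 * S.L ^ 2) := by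
        field_simp; norm_num
      rw [e3, le_div_iff₀ (by positivity)]
      linarith
    have hT0 : 0 ≤ S.T (j + 1) 0 := S.T_nonneg (by linarith)
    refine le_of_mul_le_mul_right ?_ hab0
    calc _ ≤ _ := e1
      _ ≤ 5 * S.z (j + 1) * S.T (j + 1) (-S.b (j + 1)) * ((5 * S.L ^ 2) ^ S.N * ((1 / (2 * S.L ^ 2)) ^ (S.N + 1) / 5)) :=
        le_mul_of_one_le_right (by positivity) hc
      _ = (5 * S.L ^ 2) ^ S.N * S.T (j + 1) (-S.b (j + 1)) * ((1 / (2 * S.L ^ 2)) ^ (S.N + 1) * S.z (j + 1)) := by ring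
      _ ≤ _ := mul_le_mul_of_nonneg_left hab (by positivity)
  have hh := S.h_nonneg (j + 1)
  refine le_of_pow_le S.N_ne (by positivity) ?_
  have x1 := S.X_pow (n := j + 1) (y := -S.b (j + 1)) (by linarith)
  have x2 := S.X_pow (n := j + 1) (y := 0) (by linarith)
  rw [mul_pow]
  change S.h (j + 1) ^ S.N = _ at x1
  change S.z (j + 1) ^ S.N = _ at x2
  rw [x1, x2]
  have := mul_le_mul_of_nonneg_left e2 S.B_nonneg
  linarith

end Geo

end Sys

namespace Sys

variable (S : Sys) {j : ℕ}

theorem Gam_inc (j : ℕ) : Inc (fun x => -S.T (j + 1) (-(S.X (j + 1))^[S.k] x))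
    (Icc 0 (S.a j)) := by
  have h1 : Inc (fun x => -S.T (j + 1) (-x)) (Icc (-S.a j) (S.a j)) :=
    (S.T_inc (j + 1)).neg_neg fun x hx => by
      rw [s_succ]; exact ⟨by linarith [hx.2], by linarith [hx.1]⟩
  have hm : MapsTo (S.X (j + 1)) (Icc 0 (S.a j)) (Icc 0 (S.a j)) := fun x _ =>
    ⟨S.X0 _ _, (S.X_succ_le_z j x).trans (S.z_le_a j)⟩
  have h2 : Inc ((S.X (j + 1))^[S.k]) (Icc 0 (S.a j)) :=
    ((S.X_inc (j + 1)).mono_set (Icc_subset_Icc (by linarith [S.a_pos (j + 1)]) le_rfl)).iterate hm _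
  exact h1.comp h2 fun x hx => by
    have := hm.iterate S.k hx
    exact ⟨by linarith [this.1, S.a_pos j], this.2⟩

namespace Geo

variable {S} (hg : S.Geo j)
include hg

theorem v_sub_z_ge : 1 / (2 * S.L ^ 2) * S.a (j + 2) ≤ S.v (j + 1) - S.z (j + 1) := by
  have h1 := hg.z_lower (S.a_nonneg (j + 2)) (S.a_succ_le (j + 1))
  have h2 := hg.a_le_two_z
  have ha := S.a_pos (j + 1)
  have hL := S.L_pos
  refine le_trans ?_ h1
  have e : 1 / (2 * S.L ^ 2) * S.a (j + 2) =
    S.a (j + 1) / 2 * (S.a (j + 2) / (S.L ^ 2 * S.a (j + 1))) := by field_simp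
  rw [e]
  exact mul_le_mul_of_nonneg_right (by linarith)
    (div_nonneg (S.a_nonneg _) (by positivity))

theorem h_le_z_succ : S.h (j + 1) ≤ 17 / 16 * S.z (j + 2) := by
  have hL := S.L_pos
  have hL1 := S.L_ge
  have hz := S.z_pos (j + 1)
  have hz' := S.z_pos (j + 2)
  have hzr := S.z_le_r j
  have hrp := S.r_le_p j
  have hpa := hg.p_lt
  have haj := S.a_pos j
  have hb := S.b_le_a j
  have hzb := S.z_le_b (j + 1)
  have k2 := (S.Gam_inc j).k2 (a := 0) (b := S.z (j + 1)) (c := S.r j) (d := S.p j)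
    ⟨le_rfl, haj.le⟩ ⟨hz.le, by linarith⟩ ⟨by linarith, by linarith⟩ ⟨by linarith, hpa.le⟩
    hz.le hzr hrp
  rw [← a_succ, (S.TU_root _).1] at k2
  change (-S.T (j + 1) (-(S.X (j + 1))^[S.k] (S.r j)) - -S.T (j + 1) (-S.b (j + 1))) * _ ≤ _ at k2
  have hrA : (S.X (j + 1))^[S.k] (S.r j) ≤ S.a (j + 1) := by
    rw [a_succ]; exact S.Xiterm _ _ hrp
  have x1 := S.X_pow (n := j + 1) (y := -S.b (j + 1)) (by linarith)
  have x2 := S.X_pow (n := j + 1) (y := -(S.X (j + 1))^[S.k] (S.r j)) (by linarith)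
  rw [← z_succ_eq'] at x2
  change S.h (j + 1) ^ S.N = _ at x1
  have hG : 0 ≤ S.T (j + 1) (-(S.X (j + 1))^[S.k] (S.r j)) := S.T_nonneg (by linarith)
  have hG0 : 0 ≤ S.T (j + 1) (-S.b (j + 1)) := S.T_nonneg (by linarith)
  generalize S.T (j + 1) (-(S.X (j + 1))^[S.k] (S.r j)) = G at *
  generalize S.T (j + 1) (-S.b (j + 1)) = G0 at *
  have hv := hg.v_sub_z_ge
  have haz := S.z_le_a (j + 2)
  have h3 := hg.g3
  have g2 := hg.g2
  have hzh := hg.z_le_h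
  have hh := S.h_nonneg (j + 1)
  have c1 : 1 / (2 * S.L ^ 2) * S.z (j + 2) ≤ S.v (j + 1) - S.z (j + 1) :=
    (mul_le_mul_of_nonneg_left haz (by positivity)).trans hv
  have hr : 0 < S.r j := hz.trans_le hzr
  have c2 : S.r j * (S.z (j + 2) / (640 * S.L ^ 8 * S.z (j + 1))) ≤ S.p j - S.r j := by
    refine le_trans (mul_le_mul_of_nonneg_left ?_ hr.le) h3
    calc S.z (j + 2) / (640 * S.L ^ 8 * S.z (j + 1))
        = 8 * (1 / (2 * S.L ^ 2) * S.z (j + 2)) / (128 * S.L ^ 4 * (20 * S.L ^ 2 * S.z (j + 1))) := by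
          field_simp; norm_num
      _ ≤ 8 * (1 / (2 * S.L ^ 2) * S.z (j + 2)) / (128 * S.L ^ 4 * S.a j) := by gcongr
      _ ≤ _ := by gcongr
  have c3 : G0 * S.z (j + 2) ≤ 640 * S.L ^ 8 * S.p j * G := by
    have e1 : G0 * (S.z (j + 1) * (S.p j - S.r j)) ≤ S.r j * S.p j * G := by
      have : 0 ≤ S.p j * S.r j - S.r j * (S.p j - S.z (j + 1)) := by
        nlinarith
      have := mul_nonneg this hG
      linarith
    have e2 := mul_le_mul_of_nonneg_left (mul_le_mul_of_nonneg_left c2 hz.le) hG0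
    have e3 : G0 * (S.z (j + 1) * (S.r j * (S.z (j + 2) / (640 * S.L ^ 8 * S.z (j + 1))))) =
      S.r j / (640 * S.L ^ 8) * (G0 * S.z (j + 2)) := by field_simp
    refine le_of_mul_le_mul_left ?_ (show 0 < S.r j / (640 * S.L ^ 8) by positivity)
    rw [← e3]
    refine (e2.trans e1).trans_eq ?_
    field_simp
  have c4 : S.p j ≤ 100 * S.L ^ 4 * S.h (j + 1) := by
    have := mul_le_mul_of_nonneg_left hzh (show 0 ≤ 20 * S.L ^ 2 by positivity)
    nlinarith
  have c5 : S.h (j + 1) ^ S.N * S.z (j + 2) ≤ S.L ^ 13 * S.h (j + 1) * S.z (j + 2) ^ S.N := by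
    rw [x1, x2]
    have hBG : 0 ≤ S.B * G := mul_nonneg S.B_nonneg hG
    have d1 := mul_le_mul_of_nonneg_left c3 S.B_nonneg
    have d2 : 640 * S.L ^ 8 * S.p j ≤ S.L ^ 13 * S.h (j + 1) := by
      have := mul_le_mul_of_nonneg_left c4 (show 0 ≤ 640 * S.L ^ 8 by positivity)
      have h4 : 64000 * (S.L ^ 12 * S.h (j + 1)) ≤ S.L * (S.L ^ 12 * S.h (j + 1)) :=
        mul_le_mul_of_nonneg_right (by linarith) (by positivity)
      calc _ ≤ _ := this
        _ = 64000 * (S.L ^ 12 * S.h (j + 1)) := by ring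
        _ ≤ _ := h4
        _ = _ := by ring
    have := mul_le_mul_of_nonneg_right d2 hBG
    linarith
  have hh0 : 0 < S.h (j + 1) := hz'.trans_le (S.z_le_h j)
  obtain ⟨N, hN⟩ : ∃ N, S.N = N + 1 := ⟨S.N - 1, by have := S.N_ne; omega⟩
  have c6 : S.h (j + 1) ^ N ≤ S.L ^ 13 * S.z (j + 2) ^ N := by
    rw [hN, pow_succ (S.h (j + 1)), pow_succ (S.z (j + 2))] at c5
    refine le_of_mul_le_mul_right ?_ (mul_pos hh0 hz')
    linarith
  have hr := S.num_ratio
  rw [hN, Nat.add_sub_cancel] at hr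
  have hN0 : N ≠ 0 := by
    rintro rfl
    have : S.N = S.L := rfl
    rw [hN] at this
    norm_num at this
    linarith
  refine le_of_pow_le hN0 (by positivity) (c6.trans ?_)
  rw [mul_pow]
  exact mul_le_mul_of_nonneg_right hr.le (by positivity)

theorem succ : S.Geo (j + 1) := by
  have hL := S.L_pos
  have hL1 := S.L_ge
  have hz := S.z_pos (j + 1)
  have hz' := S.z_pos (j + 2)
  have ha := S.a_pos (j + 1)
  have hza := S.z_le_a (j + 1)
  have haz := hg.a_le_two_z
  have hh := hg.h_le
  have h17 := hg.h_le_z_succ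
  have hzh := hg.z_le_h
  have c8 : 8 / S.L ≤ 1 / 2 := by rw [div_le_iff₀ hL]; linarith
  have c9 : 1 / S.L ≤ 1 / 2 := by rw [div_le_iff₀ hL]; linarith
  have hvh : S.v (j + 2) ≤ S.h (j + 1) := S.Xi_succ_le_h j _
  have hph := S.p_succ_le_h j
  refine ⟨?_, ?_, ?_, ?_⟩
  · have := mul_le_mul_of_nonneg_right c8 ha.le
    linarith
  · have h1 := mul_le_mul_of_nonneg_left h17 (show 0 ≤ 10 * S.L ^ 2 by positivity)
    have : 0 ≤ S.L ^ 2 * S.z (j + 2) := by positivity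
    linarith
  · have hz'h := S.z_le_h j
    have hlow := hg.lower (u := S.z (j + 2)) (w := S.v (j + 2)) hz'.le (S.z_le_v _)
      (by linarith [S.a_le_p j]) (by linarith) (by linarith)
    have hzu : S.z (j + 1) ≤ S.X (j + 1) (S.z (j + 2)) := S.Xm _ hz'.le
    have hva : S.X (j + 1) (S.v (j + 2)) ≤ 5 / 4 * S.z (j + 1) :=
      (S.Xm _ (by linarith)).trans hg.Xa_le
    have hv5 : S.v (j + 1) ≤ 5 / 4 * S.z (j + 1) :=
      (S.Xm _ (S.a_succ_le (j + 1))).trans hg.Xa_le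
    have huw : S.X (j + 1) (S.z (j + 2)) ≤ S.X (j + 1) (S.v (j + 2)) := S.Xm _ (S.z_le_v _)
    have hwz : S.X (j + 1) (S.v (j + 2)) ≤ S.z j := S.X_succ_le_z j _
    have hzv := S.z_le_v (j + 2)
    have hzj := S.z_pos j
    change S.Xi (j + 1) (S.X (j + 1) (S.z (j + 2))) * _ ≤
      S.Xi (j + 1) (S.X (j + 1) (S.v (j + 2))) - S.Xi (j + 1) (S.X (j + 1) (S.z (j + 2)))
    change _ ≤ S.X (j + 1) (S.v (j + 2)) at hlow
    set u := S.X (j + 1) (S.z (j + 2))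
    set w := S.X (j + 1) (S.v (j + 2))
    have hd : S.z (j + 1) * ((S.v (j + 2) - S.z (j + 2)) / (S.L ^ 2 * S.a (j + 1))) ≤ w - u := by
      have := mul_le_mul_of_nonneg_right hzu
        (div_nonneg (sub_nonneg.2 hzv) (by positivity : 0 ≤ S.L ^ 2 * S.a (j + 1)))
      linarith
    have hg4 := hg.g4
    have e1 : (w - u) / (5 * S.L * S.z (j + 1)) * (5 * S.z (j + 1)) = 1 / S.L * (w - u) := by
      field_simp
    have t0 : 0 ≤ (w - u) / (5 * S.L * S.z (j + 1)) :=
      div_nonneg (by linarith) (by positivity)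
    have hXi := S.Xi_lower (n := j + 1) (u := u) (w := w)
      (t := (w - u) / (5 * S.L * S.z (j + 1))) (by linarith) huw
      (by rw [s_succ]; linarith [S.z_le_a j]) t0
      (by rw [div_le_one (by positivity)]; nlinarith) (by
        rw [lam_succ]
        have h1 : (u + S.v (j + 1)) * (w + S.z j) ≤ (5 / 2 * S.z (j + 1)) * (2 * S.z j) :=
          mul_le_mul (by linarith) (by linarith) (by linarith) (by linarith)
        have h2 := mul_le_mul_of_nonneg_left h1 t0
        have h3 := mul_le_mul_of_nonneg_right hg4 (sub_nonneg.2 huw)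
        refine h2.trans (le_trans (le_of_eq ?_) h3)
        calc _ = ((w - u) / (5 * S.L * S.z (j + 1)) * (5 * S.z (j + 1))) * S.z j := by ring
          _ = _ := by rw [e1]; ring)
    have hr0 := S.Xi0 (j + 1) u
    rw [mul_add, mul_one] at hXi
    refine le_trans (mul_le_mul_of_nonneg_left ?_ hr0) (le_sub_iff_add_le'.2 hXi)
    have e2 : (w - u) / (5 * S.L * S.z (j + 1)) / (2 * S.L) =
      (w - u) * (1 / (10 * S.L ^ 2 * S.z (j + 1))) := by field_simp; ring
    rw [e2]
    refine le_trans ?_ (mul_le_mul_of_nonneg_right hd (by positivity))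
    have e3 : S.z (j + 1) * ((S.v (j + 2) - S.z (j + 2)) / (S.L ^ 2 * S.a (j + 1))) *
      (1 / (10 * S.L ^ 2 * S.z (j + 1))) =
        8 * (S.v (j + 2) - S.z (j + 2)) / (80 * S.L ^ 4 * S.a (j + 1)) := by field_simp; ring
    rw [e3]
    refine div_le_div_of_nonneg_left (by linarith) (by positivity) ?_
    have : 0 ≤ S.L ^ 4 * S.a (j + 1) := by positivity
    linarith
  · have := mul_le_mul_of_nonneg_right c9 hz.le
    have e : S.z (j + 1) / S.L = 1 / S.L * S.z (j + 1) := by ring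
    change S.z (j + 1) / S.L ≤ S.z (j + 1) - S.v (j + 2)
    rw [e]
    linarith

end Geo

theorem z0_pow : S.z 0 ^ S.N = S.B := by
  have := S.X_pow (n := 0) (y := 0) (by linarith [S.a_pos 0])
  rw [Par.T_zero, add_zero, mul_one] at this
  exact this

theorem z0_ge : 1 - 1 / S.L ≤ S.z 0 := by
  refine le_of_pow_le S.N_ne (S.z_nonneg 0) ?_
  rw [z0_pow]; exact S.num_half.trans S.B_gt_half.le

theorem z0_ge_half : 1 / 2 ≤ S.z 0 := by
  have h := S.z0_ge
  have : 1 / S.L ≤ 1 / 2 := one_div_le_one_div_of_le (by norm_num) (by linarith [S.L_ge])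
  linarith

theorem X0_pow {y : ℝ} (hy : -1 ≤ y) : S.X 0 y ^ S.N = S.B * (1 + y) :=
  S.X_pow (n := 0) (by rw [S.a_zero]; exact hy)

theorem Xi0_pow {y : ℝ} (hy : -S.v 0 ≤ y) : S.Xi 0 y ^ S.N = S.B * (1 - S.X 0 (-y)) :=
  S.Xi_pow hy

theorem v1_le : S.v 1 ≤ S.z 0 * (1 - 1 / S.L) := by
  have hL := S.L_ge
  have h1 : S.v 1 ≤ S.Xi 0 0 := by
    rw [v, Par.X_succ]; exact S.Xim 0 (neg_nonpos.2 (S.X0 _ _))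
  have h2 := S.Xi0_pow (y := 0) (by linarith [S.v_nonneg 0])
  rw [neg_zero] at h2
  change _ = S.B * (1 - S.z 0) at h2
  have hL0 := S.L_pos
  have hi : 1 / S.L ≤ 1 / 4 := one_div_le_one_div_of_le (by norm_num) (by linarith)
  refine h1.trans (le_of_pow_le S.N_ne (mul_nonneg (S.z_nonneg 0) (by linarith)) ?_)
  rw [h2, mul_pow, z0_pow]
  refine mul_le_mul_of_nonneg_left ?_ S.B_nonneg
  have := S.num_below 0 (by norm_num)
  have h3 := S.z0_ge
  norm_num at this
  rw [one_div] at *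
  linarith

theorem geo_zero : S.Geo 0 := by
  have hL := S.L_pos
  have hL1 := S.L_ge
  have hB := S.B_gt_half
  have hB1 := S.B_lt_one
  have hz0 := S.z0_ge_half
  have hv1 := S.v1_le
  have hv0 := S.z_le_v 0
  have hv01 := S.v0_lt_one
  have hv1n := S.v_nonneg 1
  have hBv := S.B_v0
  have hz1 := S.z_pos 1
  have hzv1 := S.z_le_v 1
  have hi : 0 < 1 / S.L := by positivity
  have hi4 : 1 / S.L ≤ 1 / 4 := one_div_le_one_div_of_le (by norm_num) (by linarith)
  have hv1z : S.v 1 ≤ S.z 0 := by nlinarith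
  refine ⟨?_, ?_, ?_, ?_⟩
  · rw [S.a_zero, mul_one]
    set u := S.X 0 (S.v 1) with hu
    have u1 : u ≤ 1 := by
      rw [← S.a_zero]; exact S.X_z_le_s 0 hv1z
    have u0 : 0 ≤ u := S.X0 _ _
    have hup : u ^ S.N = S.B * (1 + S.v 1) := S.X0_pow (by linarith)
    have h1 := pow_sub_pow_le u0 u1 le_rfl S.N
    rw [one_pow, hup] at h1
    change _ ≤ S.L * (1 - u) at h1
    have h2 : 1 / (4 * S.L) ≤ S.L * (1 - u) := by
      refine le_trans ?_ h1
      have e : 1 / (4 * S.L) = 1 / 4 * (1 / S.L) := by field_simp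
      have h3 : 1 / 2 * (1 / S.L) ≤ S.z 0 * (1 / S.L) := mul_le_mul_of_nonneg_right hz0 hi.le
      have h4 : 1 / 2 * (S.v 0 - S.v 1) ≤ S.B * (S.v 0 - S.v 1) :=
        mul_le_mul_of_nonneg_right hB.le (by linarith)
      rw [e]
      linarith
    have h3 : 1 - (1 / 2 : ℝ) ^ 16 ≤ S.X 0 (-u) := by
      refine le_of_pow_le S.N_ne (S.X0 _ _) (S.num_base.trans ?_)
      rw [S.X0_pow (by linarith)]
      have e : 1 / (8 * S.L ^ 2) * (2 * S.L) = 1 / (4 * S.L) := by field_simp; norm_num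
      refine le_of_mul_le_mul_right ?_ (show 0 < 2 * S.L by positivity)
      rw [e]
      refine h2.trans ?_
      have := mul_le_mul_of_nonneg_right hB.le (mul_nonneg hL.le (sub_nonneg.2 u1))
      linarith
    have h4 : S.p 0 ≤ 1 - 2 ^ 3 / S.L := by
      refine le_of_pow_le S.N_ne ?_ (le_trans ?_ (S.num_below 3 (by norm_num)))
      · rw [sub_nonneg, div_le_one hL]; linarith
      · change S.Xi 0 u ^ S.N ≤ _
        rw [S.Xi0_pow (by linarith [S.v_nonneg 0])]
        have h5 : 0 ≤ S.B * (S.X 0 (-u) - (1 - (1 / 2 : ℝ) ^ 16)) :=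
          mul_nonneg S.B_nonneg (by linarith)
        norm_num at h5 ⊢
        nlinarith
    norm_num at h4
    linarith
  · rw [S.a_zero, zero_add]
    have h1 := pow_sub_pow_le (S.z_nonneg 0) hv0 hv01.le S.N
    have h2 : S.v 0 ^ S.N = S.B * (1 + S.a 1) := S.X0_pow (by linarith [S.a_nonneg 1])
    rw [h2, z0_pow] at h1
    have x1 : S.X 0 (S.z 0) ≤ 1 := by rw [← S.a_zero]; exact S.X_z_le_s 0 le_rfl
    have h3 := pow_sub_pow_le (S.X0 0 (S.z 0)) x1 le_rfl S.N
    rw [one_pow, S.X0_pow (by linarith)] at h3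
    have h4 : S.z 1 ^ S.N = S.B * (1 - S.X 0 (S.z 0)) := by
      rw [S.z_succ_eq 0, S.Xi0_pow (by linarith), neg_neg]
    change _ ≤ S.L * _ at h1
    change _ ≤ S.L * _ at h3
    have hza := S.z_le_a 1
    by_contra! hc
    have hz1' : S.z 1 ≤ 1 := S.z_le_one 1
    have h5 : S.z 1 ^ S.N ≤ S.z 1 ^ 2 := by
      refine pow_le_pow_of_le_one hz1.le hz1' ?_
      have : (2:ℝ) ≤ S.N := by change 2 ≤ S.L; linarith
      exact_mod_cast this
    have e1 : 1 / 2 * S.z 1 ≤ S.L * (S.v 0 - S.z 0) := by nlinarith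
    have e2 : 1 / 2 * (S.v 0 - S.z 0) ≤ S.L * (1 - S.X 0 (S.z 0)) := by
      have := mul_le_mul_of_nonneg_right hB.le (sub_nonneg.2 hv0)
      linarith
    have e3 : 1 / 2 * (1 - S.X 0 (S.z 0)) ≤ S.z 1 ^ 2 := by
      have := mul_le_mul_of_nonneg_right hB.le (sub_nonneg.2 x1)
      linarith
    have f1 : 1 / 8 * S.z 1 ≤ S.L ^ 2 * S.z 1 ^ 2 := by
      have g1 := mul_le_mul_of_nonneg_left e3 (show 0 ≤ S.L ^ 2 by positivity)
      have g2 := mul_le_mul_of_nonneg_left e2 hL.le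
      linarith
    have f2 : 20 * S.L ^ 2 * S.z 1 * S.z 1 < 1 * S.z 1 := mul_lt_mul_of_pos_right hc hz1
    linarith
  · rw [S.a_zero, mul_one, zero_add]
    have hu0 : S.z 0 ≤ S.X 0 (S.z 1) := S.Xm 0 hz1.le
    have huw : S.X 0 (S.z 1) ≤ S.X 0 (S.v 1) := S.Xm 0 hzv1
    have hw1 : S.X 0 (S.v 1) ≤ 1 := by
      rw [← S.a_zero]; exact S.X_z_le_s 0 hv1z
    have hz1' : S.z 1 ≤ 1 := S.z_le_one 1
    have h1 := root_lower (x := S.X 0 (S.z 1)) (y := S.X 0 (S.v 1)) (t := (S.v 1 - S.z 1) / 2)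
      S.N_ne (S.X0 _ _) (S.X0 _ _) (by linarith) (by linarith [S.z0_lt_one]) (by
        rw [S.X0_pow (by linarith), S.X0_pow (by linarith), mul_assoc]
        refine mul_le_mul_of_nonneg_left ?_ S.B_nonneg
        nlinarith)
    change S.X 0 (S.z 1) * (1 + (S.v 1 - S.z 1) / 2 / (2 * S.L)) ≤ _ at h1
    change S.Xi 0 (S.X 0 (S.z 1)) * _ ≤ S.Xi 0 (S.X 0 (S.v 1)) - S.Xi 0 (S.X 0 (S.z 1))
    set u := S.X 0 (S.z 1)
    set w := S.X 0 (S.v 1)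
    have hd : (S.v 1 - S.z 1) / (8 * S.L) ≤ w - u := by
      have e : (S.v 1 - S.z 1) / (8 * S.L) = 1 / 2 * ((S.v 1 - S.z 1) / 2 / (2 * S.L)) := by
        field_simp; ring
      have := mul_le_mul_of_nonneg_right (hz0.trans hu0)
        (show 0 ≤ (S.v 1 - S.z 1) / 2 / (2 * S.L) from
          div_nonneg (by linarith) (by positivity))
      rw [e]; linarith
    have t0 : 0 ≤ (w - u) / 6 := by linarith
    have hXi := S.Xi_lower (n := 0) (u := u) (w := w) (t := (w - u) / 6) (by linarith) huw
      (by rw [s_zero]; exact hw1) t0 (by linarith) (by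
        change _ * ((u + S.v 0) * (w + 2)) ≤ (2 - S.v 0) * _
        have h1 : (u + S.v 0) * (w + 2) ≤ 2 * 3 :=
          mul_le_mul (by linarith) (by linarith) (by linarith) (by norm_num)
        have h2 := mul_le_mul_of_nonneg_left h1 t0
        nlinarith)
    have hr0 := S.Xi0 0 u
    rw [mul_add, mul_one] at hXi
    refine le_trans (mul_le_mul_of_nonneg_left ?_ hr0) (le_sub_iff_add_le'.2 hXi)
    rw [div_div]
    have e3 : (w - u) / (6 * (2 * S.L)) = (w - u) * (1 / (12 * S.L)) := by field_simp; ring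
    rw [e3]
    refine le_trans ?_ (mul_le_mul_of_nonneg_right hd (by positivity))
    have e4 : (S.v 1 - S.z 1) / (8 * S.L) * (1 / (12 * S.L)) =
      8 * (S.v 1 - S.z 1) / (768 * S.L ^ 2) := by field_simp; ring
    rw [e4]
    refine div_le_div_of_nonneg_left (by linarith) (by positivity) ?_
    have h5 : 768 ≤ 128 * S.L ^ 2 := by nlinarith
    have := mul_le_mul_of_nonneg_right h5 (show 0 ≤ S.L ^ 2 by positivity)
    linarith
  · rw [zero_add]
    have e : S.z 0 / S.L = S.z 0 * (1 / S.L) := by ring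
    rw [e]; linarith

theorem geo (j : ℕ) : S.Geo j := by
  induction j with
  | zero => exact S.geo_zero
  | succ j ih => exact ih.succ

end Sys

namespace Sys

variable (S : Sys) {j n : ℕ}

theorem h_le_half (j : ℕ) : S.h (j + 1) ≤ 1 / 2 * S.z (j + 1) := (S.geo j).h_le
theorem h_le_z_succ (j : ℕ) : S.h (j + 1) ≤ 17 / 16 * S.z (j + 2) := (S.geo j).h_le_z_succ
theorem p_lt_a (j : ℕ) : S.p j < S.a j := (S.geo j).p_lt

def rho (n : ℕ) : ℝ := S.X n (S.z (n + 1))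

/-- The domain of the inverse branches at level `n`. -/
def D (n : ℕ) : Set ℝ := Icc (-S.z (n + 1)) (S.rho n)

theorem z_le_rho (n : ℕ) : S.z n ≤ S.rho n := S.Xm n (S.z_nonneg _)
theorem rho_le_v (n : ℕ) : S.rho n ≤ S.v n := S.Xm n (S.z_le_a _)
theorem rho_le_s (n : ℕ) : S.rho n ≤ S.s n := S.X_z_le_s n (S.z_succ_le n)
theorem z_succ_le_half (j : ℕ) : S.z (j + 2) ≤ 1 / 2 * S.z (j + 1) :=
  (S.z_le_h j).trans (S.h_le_half j)

theorem rho_le_a (n : ℕ) : S.rho n ≤ S.a n := by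
  cases n with
  | zero => exact S.rho_le_s 0
  | succ j => exact (S.Xm _ (S.z_le_a _)).trans ((S.Xm _ (S.a_succ_le _)).trans (S.X_a_le_a j))

theorem mem_D {x : ℝ} (h0 : 0 ≤ x) (h1 : x ≤ S.z n) : x ∈ S.D n :=
  ⟨by linarith [S.z_nonneg (n + 1)], h1.trans (S.z_le_rho n)⟩

theorem zero_mem_D (n : ℕ) : (0:ℝ) ∈ S.D n := S.mem_D le_rfl (S.z_nonneg n)
theorem z_mem_D (n : ℕ) : S.z n ∈ S.D n := S.mem_D (S.z_nonneg n) le_rfl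
theorem z_succ_mem_D (n : ℕ) : S.z (n + 1) ∈ S.D n := S.mem_D (S.z_nonneg _) (S.z_succ_le n)

/-- The uniform contraction constant. -/
def con : ℝ := 1 / (100 * S.L ^ 6)

theorem con_pos : 0 < S.con := by have := S.L_pos; unfold con; positivity

theorem con_le : S.con ≤ 1 / (4 * S.L) := by
  have := S.L_pos
  have h1 := S.L_ge
  unfold con
  refine one_div_le_one_div_of_le (by positivity) ?_
  have h2 : S.L * 1 ≤ S.L * S.L ^ 5 := mul_le_mul_of_nonneg_left (one_le_pow₀ (by linarith)) this.le
  linarith [show S.L * S.L ^ 5 = S.L ^ 6 by ring]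

theorem con_lt_one : S.con < 1 := by
  refine S.con_le.trans_lt ?_
  rw [div_lt_one (by linarith [S.L_pos])]; linarith [S.L_ge]

theorem z1_ge : 1 ≤ 20 * S.L ^ 2 * S.z 1 := by
  have := (S.geo 0).g2; rwa [S.a_zero] at this

theorem rho_zero_ge : S.z 1 / (4 * S.L) ≤ S.rho 0 - S.z 0 := by
  have hz := S.z_pos 1
  have h1 := root_lower (x := S.z 0) (y := S.rho 0) (t := S.z 1)
    S.N_ne (S.z_nonneg 0) (S.X0 _ _) hz.le (S.z_le_one 1) (by
      rw [z0_pow, rho, X0_pow]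
      linarith)
  change S.z 0 * (1 + S.z 1 / (2 * S.L)) ≤ _ at h1
  have hL := S.L_pos
  have e : S.z 1 / (4 * S.L) = 1 / 2 * (S.z 1 / (2 * S.L)) := by field_simp; norm_num
  have := mul_le_mul_of_nonneg_right S.z0_ge_half (show 0 ≤ S.z 1 / (2 * S.L) by positivity)
  rw [e]; linarith

theorem inner_small {ψ : ℝ → ℝ} (h : Inc ψ (S.D (j + 1))) :
    ψ (S.h (j + 1)) - ψ (S.z (j + 2)) ≤ 1 / 8 * (ψ (S.z (j + 2)) - ψ 0) := by
  have hz := S.z_pos (j + 1)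
  have hz' := S.z_pos (j + 2)
  have h1 := S.h_le_half j
  have h2 := S.h_le_z_succ j
  have h3 := S.z_le_h j
  have k1 := h.k1 (a := 0) (b := S.z (j + 2)) (c := S.h (j + 1)) (d := S.z (j + 1))
    (S.zero_mem_D _) (S.z_succ_mem_D _) (S.mem_D (S.h_nonneg _) (by linarith)) (S.z_mem_D _)
    hz'.le h3 (by linarith)
  have m1 : 0 ≤ ψ (S.z (j + 2)) - ψ 0 :=
    sub_nonneg.2 (h.mono.monotoneOn (S.zero_mem_D _) (S.z_succ_mem_D _) hz'.le)
  have m2 : 0 ≤ ψ (S.h (j + 1)) - ψ (S.z (j + 2)) :=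
    sub_nonneg.2 (h.mono.monotoneOn (S.z_succ_mem_D _)
      (S.mem_D (S.h_nonneg _) (by linarith)) h3)
  rw [sub_zero, sub_zero] at k1
  refine le_of_mul_le_mul_right ?_ (show 0 < S.z (j + 2) * (1 / 2 * S.z (j + 1)) by positivity)
  have e1 : (ψ (S.h (j + 1)) - ψ (S.z (j + 2))) * (S.z (j + 2) * (1 / 2 * S.z (j + 1))) ≤
    (ψ (S.h (j + 1)) - ψ (S.z (j + 2))) * (S.z (j + 2) * (S.z (j + 1) - S.h (j + 1))) :=
    mul_le_mul_of_nonneg_left (mul_le_mul_of_nonneg_left (by linarith) hz'.le) m2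
  have e2 : (S.h (j + 1) - S.z (j + 2)) * S.z (j + 1) * (ψ (S.z (j + 2)) - ψ 0) ≤
    (1 / 16 * S.z (j + 2)) * S.z (j + 1) * (ψ (S.z (j + 2)) - ψ 0) :=
    mul_le_mul_of_nonneg_right (mul_le_mul_of_nonneg_right (by linarith) hz.le) m1
  linarith

theorem up_large {ψ : ℝ → ℝ} (h : Inc ψ (S.D n)) :
    S.con * (ψ (S.z n) - ψ 0) ≤ ψ (S.z (n + 1)) - ψ 0 := by
  have hL := S.L_pos
  have hL1 := S.L_ge
  have hz := S.z_pos n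
  have hz' := S.z_pos (n + 1)
  have hzz := S.z_succ_le n
  have hzr := S.z_le_rho n
  have m1 : 0 ≤ ψ (S.z (n + 1)) - ψ 0 :=
    sub_nonneg.2 (h.mono.monotoneOn (S.zero_mem_D _) (S.z_succ_mem_D _) hz'.le)
  have m2 : 0 ≤ ψ (S.z n) - ψ (S.z (n + 1)) :=
    sub_nonneg.2 (h.mono.monotoneOn (S.z_succ_mem_D _) (S.z_mem_D _) hzz)
  have k1 := h.k1 (a := 0) (b := S.z (n + 1)) (c := S.z n) (d := S.rho n)
    (S.zero_mem_D _) (S.z_succ_mem_D _) (S.z_mem_D _)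
    ⟨by linarith, le_rfl⟩ hz'.le hzz hzr
  rw [sub_zero, sub_zero] at k1
  have key : ∃ e > 0, e ≤ S.z (n + 1) * (S.rho n - S.z n) ∧
      (S.z n - S.z (n + 1)) * S.rho n ≤ (100 * S.L ^ 6 - 1) * e := by
    cases n with
    | zero =>
      have h1 := S.rho_zero_ge
      have h2 := S.z1_ge
      have h3 : S.rho 0 ≤ 1 := by have := S.rho_le_s 0; rwa [s_zero] at this
      have h4 := S.z0_lt_one
      refine ⟨1 / (1600 * S.L ^ 5), by positivity, ?_, ?_⟩
      · refine le_trans ?_ (mul_le_mul_of_nonneg_left h1 hz'.le)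
        have e1 : S.z 1 * (S.z 1 / (4 * S.L)) = (20 * S.L ^ 2 * S.z 1) ^ 2 * (1 / (1600 * S.L ^ 5)) := by
          field_simp; norm_num
        rw [zero_add, e1]
        exact le_mul_of_one_le_left (by positivity) (one_le_pow₀ h2)
      · have h5 : (S.z 0 - S.z (0 + 1)) * S.rho 0 ≤ 1 * 1 :=
          mul_le_mul (by linarith) h3 (S.X0 _ _) (by norm_num)
        refine h5.trans ?_
        rw [mul_one_div, le_div_iff₀ (by positivity)]
        have h6 : S.L ^ 5 * 16777216 ≤ S.L ^ 5 * S.L := mul_le_mul_of_nonneg_left hL1 (by positivity)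
        have h7 : 1 ≤ S.L ^ 5 := one_le_pow₀ (by linarith)
        linarith [show S.L ^ 5 * S.L = S.L ^ 6 by ring]
    | succ j =>
      have hg := S.geo j
      have h1 := hg.z_lower (S.z_nonneg (j + 2)) ((S.z_le_a _).trans (S.a_succ_le _))
      have h2 := hg.a_le_two_z
      have ha := S.a_pos (j + 1)
      change _ ≤ S.rho (j + 1) - _ at h1
      have h3 : S.rho (j + 1) ≤ 5 / 4 * S.z (j + 1) :=
        (S.Xm _ ((S.z_le_a _).trans (S.a_succ_le _))).trans hg.Xa_le
      have h4 := hg.z_le_h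
      have h5 := S.h_le_z_succ j
      refine ⟨S.z (j + 2) * (1 / (2 * S.L ^ 2) * S.z (j + 2)), by positivity,
        mul_le_mul_of_nonneg_left (le_trans ?_ h1) hz'.le, ?_⟩
      · have e : 1 / (2 * S.L ^ 2) * S.z (j + 2) =
          S.a (j + 1) / 2 * (S.z (j + 2) / (S.L ^ 2 * S.a (j + 1))) := by field_simp
        rw [e]
        exact mul_le_mul_of_nonneg_right (by linarith) (by positivity)
      · have h6 : S.z (j + 1) ≤ 6 * S.L ^ 2 * S.z (j + 2) := by
          have := mul_le_mul_of_nonneg_left h5 (show 0 ≤ 5 * S.L ^ 2 by positivity)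
          have : 0 ≤ S.L ^ 2 * S.z (j + 2) := by positivity
          linarith
        have h7 : (S.z (j + 1) - S.z (j + 1 + 1)) * S.rho (j + 1) ≤
            (6 * S.L ^ 2 * S.z (j + 2)) * (5 / 4 * (6 * S.L ^ 2 * S.z (j + 2))) :=
          mul_le_mul (by linarith) (by linarith) (S.X0 _ _) (by positivity)
        refine h7.trans ?_
        have e : S.z (j + 2) * (1 / (2 * S.L ^ 2) * S.z (j + 2)) =
          S.z (j + 2) ^ 2 * (1 / (2 * S.L ^ 2)) := by ring
        have e2 : (6 * S.L ^ 2 * S.z (j + 2)) * (5 / 4 * (6 * S.L ^ 2 * S.z (j + 2))) =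
          90 * S.L ^ 6 * (S.z (j + 2) ^ 2 * (1 / (2 * S.L ^ 2))) := by field_simp; norm_num
        rw [e, e2]
        refine mul_le_mul_of_nonneg_right ?_ (by positivity)
        have : 1 ≤ S.L ^ 6 := one_le_pow₀ (by linarith)
        linarith
  obtain ⟨e, he, h1, h2⟩ := key
  have f1 := mul_le_mul_of_nonneg_left h1 m2
  have f2 := mul_le_mul_of_nonneg_right h2 m1
  have f3 : ψ (S.z n) - ψ (S.z (n + 1)) ≤ (100 * S.L ^ 6 - 1) * (ψ (S.z (n + 1)) - ψ 0) := by
    refine le_of_mul_le_mul_right ?_ he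
    linarith
  rw [con, one_div_mul_eq_div, div_le_iff₀ (by positivity)]
  linarith

theorem up_small {ψ : ℝ → ℝ} (h : Inc ψ (S.D n)) :
    ψ (S.z (n + 1)) - ψ 0 ≤ (1 - S.con) * (ψ (S.z n) - ψ 0) := by
  have hL := S.L_pos
  have hL1 := S.L_ge
  have hz := S.z_pos n
  have hz' := S.z_pos (n + 1)
  have hzz := S.z_succ_le n
  have m1 : 0 ≤ ψ (S.z (n + 1)) - ψ 0 :=
    sub_nonneg.2 (h.mono.monotoneOn (S.zero_mem_D _) (S.z_succ_mem_D _) hz'.le)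
  have m2 : 0 ≤ ψ (S.z n) - ψ (S.z (n + 1)) :=
    sub_nonneg.2 (h.mono.monotoneOn (S.z_succ_mem_D _) (S.z_mem_D _) hzz)
  have k2 := h.k2 (a := -S.z (n + 1)) (b := 0) (c := S.z (n + 1)) (d := S.z n)
    ⟨le_rfl, by linarith [S.z_le_rho n]⟩ (S.zero_mem_D _) (S.z_succ_mem_D _) (S.z_mem_D _)
    (by linarith) hz'.le hzz
  have h1 : S.z n * (1 / S.L) ≤ S.z n - S.z (n + 1) := by
    cases n with
    | zero => have := S.v1_le; have := S.z_le_v 1; rw [zero_add]; linarith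
    | succ j =>
      have h2 := S.z_succ_le_half j
      have : 1 / S.L ≤ 1 / 2 := one_div_le_one_div_of_le (by norm_num) (by linarith)
      have := mul_le_mul_of_nonneg_left this hz.le
      change _ ≤ _ - S.z (j + 2)
      linarith
  have f1 : (ψ (S.z (n + 1)) - ψ 0) * (1 / S.L) ≤ 2 * (ψ (S.z n) - ψ (S.z (n + 1))) := by
    refine le_of_mul_le_mul_right ?_ (mul_pos hz' hz)
    have g1 := mul_le_mul_of_nonneg_left (mul_le_mul_of_nonneg_left h1 hz'.le) m1
    have g2 : (S.z (n + 1) - 0) * (S.z n - -S.z (n + 1)) * (ψ (S.z n) - ψ (S.z (n + 1))) ≤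
        S.z (n + 1) * (2 * S.z n) * (ψ (S.z n) - ψ (S.z (n + 1))) := by
      rw [sub_zero]
      exact mul_le_mul_of_nonneg_right (mul_le_mul_of_nonneg_left (by linarith) hz'.le) m2
    rw [sub_neg_eq_add, zero_add] at k2
    linarith
  have f2 : ψ (S.z (n + 1)) - ψ 0 ≤ 2 * S.L * (ψ (S.z n) - ψ (S.z (n + 1))) := by
    have := mul_le_mul_of_nonneg_right f1 hL.le
    rw [mul_assoc, one_div_mul_cancel hL.ne'] at this
    linarith
  have f3 := mul_le_mul_of_nonneg_right S.con_le (add_nonneg m1 m2)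
  have f4 : 1 / (4 * S.L) * (ψ (S.z (n + 1)) - ψ 0) ≤ 1 / 2 * (ψ (S.z n) - ψ (S.z (n + 1))) := by
    rw [one_div_mul_eq_div, div_le_iff₀ (by positivity)]; linarith
  have f5 : 1 / (4 * S.L) * (ψ (S.z n) - ψ (S.z (n + 1))) ≤ 1 / 2 * (ψ (S.z n) - ψ (S.z (n + 1))) :=
    mul_le_mul_of_nonneg_right (one_div_le_one_div_of_le (by norm_num) (by linarith)) m2
  linarith

end Sys

namespace Sys

variable (S : Sys)

/-- The inverse branches of the induced Markov map: `Br S n m t χ` means that `χ` maps the base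
interval of level `m` into that of level `n`, and is inverted (up to sign) by `f^t`. -/
inductive Br : ℕ → ℕ → ℕ → (ℝ → ℝ) → Prop
  | up (n : ℕ) : Br n (n + 1) 0 (fun y => y)
  | far (n : ℕ) : Br n n (S.Q n) (fun y => S.Xi n (-y))
  | downNeg (j : ℕ) : Br (j + 1) j ((S.k + 1) * S.M (j + 1) + S.Q j)
      (fun y => S.X (j + 1) (-(S.X (j + 1))^[S.k] (S.Xi j (-y))))
  | downPos (j : ℕ) : Br (j + 1) j ((S.k + 1) * S.M (j + 1) + S.Q j)
      (fun y => S.X (j + 1) (-(S.X (j + 1))^[S.k] (S.Xi j y)))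
  | near : Br 0 0 (S.M 0) (fun y => S.X 0 (-y))
  | turn (j i : ℕ) (hi : i ≤ S.k) : Br (j + 1) (j + 1) ((i + 1) * S.M (j + 1))
      (fun y => S.X (j + 1) (-(S.X (j + 1))^[i] y))

/-- Monotone maps on the domain of level `n`, increasing or decreasing, expanding cross-ratios. -/
def Good (n : ℕ) (ψ : ℝ → ℝ) : Prop :=
  Inc ψ (S.D n) ∨ Inc (fun y => -ψ y) (S.D n)

structure BrOk (n m t : ℕ) (χ : ℝ → ℝ) : Prop where
  good : S.Good m χ
  mapsD : MapsTo χ (S.D m) (S.D n)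
  cont : Continuous χ
  dyn : ∀ y ∈ Icc 0 (S.z m), |S.f^[t] (χ y)| = y
  maps : MapsTo χ (Icc 0 (S.z m)) (Icc 0 (S.z n))

variable {S}

theorem X_cont (S : Sys) (n : ℕ) : Continuous (S.X n) :=
  (Par.X_continuous S.m S.k n).comp (continuous_const (y := S.B).prodMk continuous_id)

theorem Xi_cont (S : Sys) (n : ℕ) : Continuous (S.Xi n) :=
  (Par.Xi_continuous S.m S.k n).comp (continuous_const (y := S.B).prodMk continuous_id)

theorem dyn_turn {n i : ℕ} {u : ℝ} (h0 : 0 ≤ (S.X n)^[i] u)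
    (ha : (S.X n)^[i] u ≤ S.a n)
    (hu : ∀ l < i, (S.X n)^[l] u ∈ Icc (-S.a n) (S.s n)) :
    |S.f^[(i + 1) * S.M n] (S.X n (-(S.X n)^[i] u))| = |u| := by
  rw [Nat.add_mul, one_mul, Function.iterate_add_apply]
  refine S.iter_X_of (fun y hy x hx => S.dyn_X hy hx) i hu ?_
  have hs := S.s_nonneg n
  rw [S.dyn_X (y := -(S.X n)^[i] u) ⟨by linarith, by linarith⟩
    (abs_of_nonneg (S.X0 _ _)), abs_mul, abs_sg, one_mul, abs_neg]

theorem X_inc_a (j : ℕ) : Inc (S.X (j + 1)) (Icc (-S.a (j + 1)) (S.a (j + 1))) :=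
  (S.X_inc _).mono_set (Icc_subset_Icc_right (S.a_le_s _))

theorem X_maps_a (j : ℕ) : MapsTo (S.X (j + 1)) (Icc (-S.a (j + 1)) (S.a (j + 1)))
    (Icc (-S.a (j + 1)) (S.a (j + 1))) := fun _ hy =>
  ⟨by linarith [S.X0 (j + 1) ‹_›, S.a_nonneg (j + 1)], (S.Xm _ hy.2).trans (S.X_a_le_a j)⟩

theorem X_inc_s (j : ℕ) : Inc (S.X (j + 1)) (Icc 0 (S.a j)) :=
  (S.X_inc _).mono_set (Icc_subset_Icc_left (by linarith [S.a_nonneg (j+1)]))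

theorem X_maps_s (j : ℕ) : MapsTo (S.X (j + 1)) (Icc 0 (S.a j)) (Icc 0 (S.a j)) := fun _ _ =>
  ⟨S.X0 _ _, (S.X_succ_le_z _ _).trans (S.z_le_a j)⟩

/-- `X_n(-·)` reverses orientation. -/
theorem inc_neg_X_neg (n : ℕ) : Inc (fun y => -S.X n (-y)) (Icc (-S.s n) (S.a n)) :=
  (S.X_inc n).neg_neg fun x hx => ⟨by linarith [hx.2], by linarith [hx.1]⟩

theorem D_subset_a (n : ℕ) : S.D n ⊆ Icc (-S.a n) (S.a n) := fun _ hy =>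
  ⟨by linarith [hy.1, S.z_succ_le n, S.z_le_a n], hy.2.trans (S.rho_le_a n)⟩

theorem D_subset_Xi (n : ℕ) : S.D n ⊆ Icc (-S.v n) (S.s n) := fun _ hy =>
  ⟨by linarith [hy.1, S.z_succ_le n, S.z_le_v n], hy.2.trans (S.rho_le_s n)⟩

theorem D_subset_Xi_neg (n : ℕ) {y : ℝ} (hy : y ∈ S.D n) : -y ∈ Icc (-S.v n) (S.s n) :=
  ⟨by linarith [hy.2, S.rho_le_v n], by linarith [hy.1, S.z_succ_le n, S.z_le_a n, S.a_le_s n]⟩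

/-- The points `W(u)` with `0 ≤ u ≤ p`. -/
theorem Xiter_k_mem {j : ℕ} {u : ℝ} (h0 : 0 ≤ u) (hp : u ≤ S.p j) :
    (S.X (j + 1))^[S.k] u ∈ Icc 0 (S.a (j + 1)) :=
  ⟨S.Xiter_nonneg _ _ h0, (S.Xiterm _ _ hp).trans (S.a_succ j).ge⟩

theorem Xi_le_r {j : ℕ} {y : ℝ} (hy : y ≤ S.rho j) : S.Xi j y ≤ S.r j := S.Xim _ hy

theorem neg_le_rho {j : ℕ} {y : ℝ} (hy : y ∈ S.D j) : -y ≤ S.rho j := by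
  linarith [hy.1, S.z_succ_le j, S.z_le_rho j]

theorem X_neg_iter_mem {n i : ℕ} {w : ℝ} (hw : 0 ≤ (S.X n)^[i] w) :
    S.X n (-(S.X n)^[i] w) ∈ Icc 0 (S.z n) := ⟨S.X0 _ _, S.Xm _ (by linarith)⟩

theorem Icc_subset_D (n : ℕ) : Icc 0 (S.z n) ⊆ S.D n := fun _ hy => S.mem_D hy.1 hy.2

theorem down_ok {j : ℕ} {g : ℝ → ℝ} (hg : Inc g (S.D j) ∨ Inc (fun y => -g y) (S.D j))
    (hc : Continuous g) (hg0 : ∀ y, 0 ≤ g y) (hgz : ∀ y, g y ≤ S.z j)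
    (hgp : ∀ y ∈ S.D j, g y ≤ S.p j)
    (hd : ∀ y ∈ Icc 0 (S.z j), ∀ x, |x| = g y → |S.f^[S.Q j] x| = y) :
    S.BrOk (j + 1) j ((S.k + 1) * S.M (j + 1) + S.Q j)
      (fun y => S.X (j + 1) (-(S.X (j + 1))^[S.k] (g y))) := by
  have hI := (X_inc_s (S := S) j).iterate (X_maps_s j) S.k
  have hW : Inc (fun y => -S.X (j + 1) (-(S.X (j + 1))^[S.k] y)) (Icc 0 (S.p j)) :=
    (inc_neg_X_neg (S := S) (j + 1)).comp (hI.mono_set (Icc_subset_Icc_right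
      ((S.p_le_z j).trans (S.z_le_a j)))) fun y hy =>
        Icc_subset_Icc_left (by linarith [S.s_nonneg (j+1)]) (Xiter_k_mem hy.1 hy.2)
  have hmem : ∀ y ∈ S.D j, (S.X (j + 1))^[S.k] (g y) ∈ Icc 0 (S.a (j + 1)) :=
    fun y hy => Xiter_k_mem (hg0 y) (hgp y hy)
  have hmaps : ∀ y ∈ S.D j, S.X (j + 1) (-(S.X (j + 1))^[S.k] (g y)) ∈ Icc 0 (S.z (j + 1)) :=
    fun y hy => X_neg_iter_mem (hmem y hy).1
  refine ⟨?_, fun y hy => Icc_subset_D _ (hmaps y hy), ?_, ?_,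
    fun y hy => hmaps y (Icc_subset_D _ hy)⟩
  · rcases hg with hg | hg
    · exact Or.inr (hW.comp hg fun y hy => ⟨hg0 y, hgp y hy⟩)
    · refine Or.inl (((hW.neg_neg (S' := Icc (-S.p j) 0)
        fun x hx => ⟨by linarith [hx.2], by linarith [hx.1]⟩).comp hg
          fun y hy => ⟨by linarith [hgp y hy], by linarith [hg0 y]⟩).congr fun x _ => ?_)
      simp
  · exact (X_cont S _).comp (((X_cont S _).iterate _).comp hc).neg
  · intro y hy
    rw [Nat.add_comm, Function.iterate_add_apply]
    refine hd y hy _ ?_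
    have hm := hmem y (Icc_subset_D _ hy)
    rw [dyn_turn hm.1 hm.2 fun l _ => ⟨?_, ?_⟩, abs_of_nonneg (hg0 y)]
    · linarith [S.Xiter_nonneg (j + 1) l (hg0 y), S.a_nonneg (j + 1)]
    · exact (S.Xiter_succ_le_z j l (hgz y)).trans (S.z_le_a j)

theorem X_iter_D_mem {j i : ℕ} {y : ℝ} (hy : y ∈ S.D (j + 1)) :
    (S.X (j + 1))^[i] y ∈ Icc (-S.z (j + 2)) (S.a (j + 1)) := by
  refine ⟨?_, ?_⟩
  · cases i with
    | zero => exact hy.1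
    | succ i => rw [iterate_succ_apply']; linarith [S.X0 (j + 1) ((S.X (j + 1))^[i] y), S.z_nonneg (j+2)]
  · exact (((X_maps_a j).iterate i) (D_subset_a _ hy)).2

theorem Br.ok {n m t : ℕ} {χ : ℝ → ℝ} (h : S.Br n m t χ) : S.BrOk n m t χ := by
  cases h with
  | up =>
    refine ⟨Or.inl (Inc.id _), fun y hy => ⟨?_, ?_⟩, continuous_id, fun y hy => ?_, fun y hy => ?_⟩
    · linarith [hy.1, S.z_succ_le (n + 1)]
    · exact hy.2.trans ((S.X_succ_le_z _ _).trans (S.z_le_rho n))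
    · exact abs_of_nonneg hy.1
    · exact ⟨hy.1, hy.2.trans (S.z_succ_le n)⟩
  | far =>
    refine ⟨Or.inr ((S.Xi_inc n).neg_neg fun y hy => D_subset_Xi_neg n hy),
      fun y hy => S.mem_D (S.Xi0 _ _) (S.Xi_le_z _ _), (Xi_cont S n).comp continuous_neg,
      fun y hy => ?_, fun y hy => ⟨S.Xi0 _ _, S.Xi_le_z _ _⟩⟩
    rw [S.dyn_Xi (D_subset_Xi_neg n (Icc_subset_D _ hy)) (abs_of_nonneg (S.Xi0 _ _)), abs_mul,
      abs_tau, one_mul, abs_neg, abs_of_nonneg hy.1]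
  | downNeg j =>
    refine down_ok (g := fun y => S.Xi m (-y)) (Or.inr ((S.Xi_inc m).neg_neg
      fun y hy => D_subset_Xi_neg m hy)) ((Xi_cont S m).comp continuous_neg)
      (fun y => S.Xi0 _ _) (fun y => S.Xi_le_z _ _)
      (fun y hy => (Xi_le_r (neg_le_rho hy)).trans (S.r_le_p m)) fun y hy x hx => ?_
    rw [S.dyn_Xi (D_subset_Xi_neg m (Icc_subset_D _ hy)) hx, abs_mul,
      abs_tau, one_mul, abs_neg, abs_of_nonneg hy.1]
  | downPos j =>
    refine down_ok (g := fun y => S.Xi m y) (Or.inl ((S.Xi_inc m).mono_set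
      (D_subset_Xi m))) (Xi_cont S m)
      (fun y => S.Xi0 _ _) (fun y => S.Xi_le_z _ _)
      (fun y hy => (Xi_le_r hy.2).trans (S.r_le_p m)) fun y hy x hx => ?_
    rw [S.dyn_Xi (D_subset_Xi m (Icc_subset_D _ hy)) hx, abs_mul,
      abs_tau, one_mul, abs_of_nonneg hy.1]
  | near =>
    have hD : S.D 0 ⊆ Icc (-S.s 0) (S.a 0) := D_subset_a (S := S) 0
    refine ⟨Or.inr ((inc_neg_X_neg 0).mono_set hD), fun y hy => ⟨?_, ?_⟩,
      (X_cont S 0).comp continuous_neg, fun y hy => ?_, fun y hy => ⟨S.X0 _ _, S.Xm _ (by linarith [hy.1])⟩⟩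
    · linarith [S.X0 0 (-y), S.z_nonneg 1]
    · exact S.Xm 0 (by linarith [hy.1])
    · have := hD (Icc_subset_D _ hy)
      rw [S.dyn_X (y := -y) ⟨by linarith [this.2], by linarith [this.1]⟩ (abs_of_nonneg (S.X0 _ _)), abs_mul, abs_sg,
        one_mul, abs_neg, abs_of_nonneg hy.1]
  | turn j i hi =>
    have hz : S.z (j + 2) ≤ S.s (j + 1) :=
      (S.z_succ_le (j+1)).trans ((S.z_le_a _).trans (S.a_le_s _))
    refine ⟨Or.inr ((inc_neg_X_neg (j + 1)).comp (((X_inc_a j).iterate (X_maps_a j) i).mono_set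
      (D_subset_a _)) fun y hy => ⟨by linarith [(X_iter_D_mem (i := i) hy).1], (X_iter_D_mem hy).2⟩),
      fun y hy => ⟨?_, ?_⟩, (X_cont S _).comp ((X_cont S _).iterate i).neg, fun y hy => ?_,
      fun y hy => X_neg_iter_mem (S.Xiter_nonneg _ _ hy.1)⟩
    · linarith [S.X0 (j + 1) (-(S.X (j+1))^[i] y), S.z_nonneg (j + 2)]
    · exact S.Xm _ (by linarith [(X_iter_D_mem (i := i) hy).1])
    · have hyD := Icc_subset_D _ hy
      rw [dyn_turn (S.Xiter_nonneg _ _ hy.1) (X_iter_D_mem hyD).2 fun l _ => ⟨?_, ?_⟩,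
        abs_of_nonneg hy.1]
      · linarith [S.Xiter_nonneg (j + 1) l hy.1, S.a_nonneg (j + 1)]
      · exact (X_iter_D_mem hyD).2.trans (S.a_le_s _)

end Sys

namespace Sys

variable {S : Sys}

/-- Length of the image of the base interval of level `n`. -/
def ilen (S : Sys) (n : ℕ) (ψ : ℝ → ℝ) : ℝ := |ψ (S.z n) - ψ 0|

theorem ilen_neg (n : ℕ) (ψ : ℝ → ℝ) : S.ilen n (fun y => -ψ y) = S.ilen n ψ := by
  unfold ilen; rw [← abs_neg]; congr 1; ring

theorem Good.comp {n m t : ℕ} {χ ψ : ℝ → ℝ} (hψ : S.Good n ψ) (h : S.BrOk n m t χ) :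
    S.Good m (fun y => ψ (χ y)) := by
  have hD : ∀ y ∈ {x | -x ∈ S.D n}, -y ∈ S.D n := fun y hy => hy
  have hm : MapsTo (fun y => -χ y) (S.D m) {x | -x ∈ S.D n} := fun y hy => by
    simpa using h.mapsD hy
  rcases hψ with hψ | hψ <;> rcases h.good with hg | hg
  · exact Or.inl (hψ.comp hg h.mapsD)
  · exact Or.inr ((((hψ.neg_neg hD).comp hg hm)).congr fun x _ => by simp)
  · exact Or.inr (hψ.comp hg h.mapsD)
  · exact Or.inl ((((hψ.neg_neg hD).comp hg hm)).congr fun x _ => by simp)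

theorem Xi_zero_zero : S.Xi 0 0 = S.X 0 (-S.z 0) := by
  rw [Par.Xi, Par.U_zero, neg_zero, Par.X, Par.T_zero]; rfl

theorem Br.ge {n m t : ℕ} {χ : ℝ → ℝ} (h : S.Br n m t χ) {y : ℝ} (hy : y ∈ Icc 0 (S.z m)) :
    (m = n + 1 ∧ t = 0 ∧ χ = fun y => y) ∨ S.z (n + 1) ≤ χ y := by
  have key : ∀ j u i, 0 ≤ u → u ≤ S.r j → i ≤ S.k → 
      (S.X (j + 1))^[i] u ≤ (S.X (j + 1))^[S.k] (S.r j) →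
      S.z (j + 2) ≤ S.X (j + 1) (-(S.X (j + 1))^[i] u) := by
    intro j u i h0 hu hi h
    rw [S.z_succ_eq']
    exact S.Xm _ (by linarith)
  have hrho : ∀ j y, y ≤ S.z j → S.Xi j y ≤ S.r j := fun j y h => Xi_le_r (h.trans (S.z_le_rho j))
  cases h with
  | up => exact Or.inl ⟨rfl, rfl, rfl⟩
  | far => exact Or.inr (by rw [S.z_succ_eq]; exact S.Xim _ (by linarith [hy.2]))
  | downNeg j =>
    have := hrho m (-y) (by linarith [hy.1, S.z_nonneg m])
    exact Or.inr (key m _ _ (S.Xi0 _ _) this le_rfl (S.Xiterm _ _ this))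
  | downPos j =>
    have := hrho m y hy.2
    exact Or.inr (key m _ _ (S.Xi0 _ _) this le_rfl (S.Xiterm _ _ this))
  | near =>
    refine Or.inr ?_
    have h1 : S.z (0 + 1) ≤ S.Xi 0 0 := by rw [S.z_succ_eq]; exact S.Xim 0 (by linarith [S.z_nonneg 0])
    rw [Xi_zero_zero] at h1
    exact h1.trans (S.Xm 0 (neg_le_neg hy.2))
  | turn j i hi =>
    have h1 : (S.X (j + 1))^[i] y ≤ (S.X (j + 1))^[S.k] (S.r j) := by
      have h2 : (S.X (j + 1))^[i] (S.z (j + 1)) ≤ (S.X (j + 1))^[S.k] (S.z (j + 1)) :=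
        monotone_nat_of_le_succ (S.Xiter_z_mono (j + 1)) hi
      exact ((S.Xiterm _ _ hy.2).trans h2).trans (S.Xiterm _ _ (S.z_le_r j))
    refine Or.inr ?_
    change S.z (j + 2) ≤ _
    rw [S.z_succ_eq']
    exact S.Xm _ (by linarith)

theorem Br.ilen_le {n m t : ℕ} {χ ψ : ℝ → ℝ} (h : S.Br n m t χ) (hψ : S.Good n ψ) :
    S.ilen m (fun y => ψ (χ y)) ≤ (1 - S.con) * S.ilen n ψ := by
  wlog hI : Inc ψ (S.D n) generalizing ψ
  · rcases hψ with hψ | hψ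
    · exact absurd hψ hI
    · have := this (ψ := fun y => -ψ y) (Or.inl hψ) hψ
      rwa [ilen_neg m (fun y => ψ (χ y)), ilen_neg n ψ] at this
  have hz := S.z_mem_D n
  have hz' := S.z_succ_mem_D n
  have h0 := S.zero_mem_D n
  have hM := hI.mono.monotoneOn
  have hpos : ψ 0 ≤ ψ (S.z n) := hM h0 hz (S.z_nonneg n)
  have e : S.ilen n ψ = ψ (S.z n) - ψ 0 := abs_of_nonneg (by linarith)
  rw [e]
  have hzm : S.z m ∈ Icc 0 (S.z m) := ⟨S.z_nonneg m, le_rfl⟩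
  have h0m : (0:ℝ) ∈ Icc 0 (S.z m) := ⟨le_rfl, S.z_nonneg m⟩
  rcases h.ge hzm with ⟨rfl, -, rfl⟩ | h1
  · have := S.up_small hI
    rw [ilen, abs_of_nonneg]
    · exact this
    · linarith [hM h0 hz' (S.z_nonneg _)]
  rcases h.ge h0m with ⟨rfl, -, rfl⟩ | h2
  · have := S.up_small hI
    rw [ilen, abs_of_nonneg]
    · exact this
    · linarith [hM h0 hz' (S.z_nonneg _)]
  have hu := S.up_large hI
  have m1 := h.ok.maps hzm
  have m2 := h.ok.maps h0m
  have d1 := Icc_subset_D _ m1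
  have d2 := Icc_subset_D _ m2
  rw [ilen, abs_le]
  constructor <;> nlinarith [hM hz' d1 h1, hM hz' d2 h2, hM d1 hz m1.2, hM d2 hz m2.2]

/-- Contraction constant of the drift estimate. -/
def kap (S : Sys) : ℝ := 3 * S.con / 8

theorem kap_pos : 0 < S.kap := by have := S.con_pos; unfold kap; linarith
theorem kap_lt_one : S.kap < 1 := by have := S.con_lt_one; unfold kap; linarith

theorem z_one_eq : S.z 1 = S.Xi 0 (-S.z 0) := S.z_succ_eq 0

theorem drift_zero {ψ : ℝ → ℝ} (hψ : S.Good 0 ψ) :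
    1 / 2 * S.ilen 1 ψ + S.ilen 0 (fun y => ψ (S.Xi 0 (-y))) + S.ilen 0 (fun y => ψ (S.X 0 (-y))) ≤
      (1 - S.kap) * S.ilen 0 ψ := by
  wlog hI : Inc ψ (S.D 0) generalizing ψ
  · rcases hψ with hψ | hψ
    · exact absurd hψ hI
    · have := this (ψ := fun y => -ψ y) (Or.inl hψ) hψ
      simpa only [S.ilen_neg, ilen_neg 0 (fun y => ψ (S.Xi 0 (-y))),
        ilen_neg 0 (fun y => ψ (S.X 0 (-y)))] using this
  have hM := hI.mono.monotoneOn
  have hu := S.up_large hI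
  have hz := S.z_nonneg 0
  have hz1 := S.z_nonneg 1
  have i1 : S.z 1 ≤ S.Xi 0 0 := by rw [z_one_eq]; exact S.Xim 0 (by linarith)
  have i2 : S.Xi 0 0 ≤ S.z 0 := S.Xi_le_z _ _
  have m1 := S.mem_D (hz1.trans i1) i2
  have e1 := hM (S.zero_mem_D 0) (S.z_succ_mem_D 0) hz1
  have e2 := hM (S.z_succ_mem_D 0) m1 i1
  have e3 := hM m1 (S.z_mem_D 0) i2
  simp only [ilen]
  rw [neg_zero, ← z_one_eq, ← Xi_zero_zero]
  change _ + _ + |_ - ψ (S.z 0)| ≤ _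
  rw [zero_add] at hu e1 e2
  rw [abs_of_nonneg (a := ψ (S.z 1) - ψ 0), abs_of_nonpos (a := ψ (S.z 1) - _),
    abs_of_nonpos (a := ψ (S.Xi 0 0) - _), abs_of_nonneg (a := ψ (S.z 0) - ψ 0)]
  · unfold kap
    have := S.con_pos
    nlinarith
  all_goals linarith

theorem sum_turn (j : ℕ) {ψ : ℝ → ℝ} (hI : Inc ψ (S.D (j + 1))) (K : ℕ) :
    ∑ i ∈ Finset.range (K + 1), S.ilen (j + 1) (fun y => ψ (S.X (j + 1) (-(S.X (j + 1))^[i] y))) =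
      ψ (S.z (j + 1)) - ψ (S.X (j + 1) (-(S.X (j + 1))^[K] (S.z (j + 1)))) := by
  set w : ℕ → ℝ := fun i => S.X (j + 1) (-(S.X (j + 1))^[i] 0) with hw
  have hstep : ∀ i, (S.X (j + 1))^[i] (S.z (j + 1)) = (S.X (j + 1))^[i + 1] 0 := fun i => by
    rw [iterate_succ_apply]; rfl
  have hmem : ∀ i, w i ∈ Icc 0 (S.z (j + 1)) := fun i => X_neg_iter_mem (S.Xiter_nonneg _ _ le_rfl)
  have hanti : ∀ i, w (i + 1) ≤ w i := fun i => by
    refine S.Xm _ (neg_le_neg ?_)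
    rw [iterate_succ_apply]; exact S.Xiterm _ _ (S.X0 _ _)
  have hterm : ∀ i, S.ilen (j + 1) (fun y => ψ (S.X (j + 1) (-(S.X (j + 1))^[i] y))) =
      ψ (w i) - ψ (w (i + 1)) := fun i => by
    rw [ilen, hstep, abs_sub_comm]
    refine abs_of_nonneg (sub_nonneg.2 ?_)
    exact hI.mono.monotoneOn (Icc_subset_D _ (hmem _)) (Icc_subset_D _ (hmem _)) (hanti i)
  rw [Finset.sum_congr rfl fun i _ => hterm i, Finset.sum_range_sub' (fun i => ψ (w i)), hstep]
  simp [hw, z]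

theorem drift_succ {j : ℕ} {ψ : ℝ → ℝ} (hψ : S.Good (j + 1) ψ) :
    1 / 2 * S.ilen (j + 2) ψ + S.ilen (j + 1) (fun y => ψ (S.Xi (j + 1) (-y))) +
      2 * (S.ilen j (fun y => ψ (S.X (j + 1) (-(S.X (j + 1))^[S.k] (S.Xi j (-y))))) +
        S.ilen j (fun y => ψ (S.X (j + 1) (-(S.X (j + 1))^[S.k] (S.Xi j y))))) +
      ∑ i ∈ Finset.range (S.k + 1),
        S.ilen (j + 1) (fun y => ψ (S.X (j + 1) (-(S.X (j + 1))^[i] y))) ≤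
      (1 - S.kap) * S.ilen (j + 1) ψ := by
  wlog hI : Inc ψ (S.D (j + 1)) generalizing ψ
  · rcases hψ with hψ | hψ
    · exact absurd hψ hI
    · have := this (ψ := fun y => -ψ y) (Or.inl hψ) hψ
      have e := fun (n : ℕ) (χ : ℝ → ℝ) => ilen_neg (S := S) n (fun y => ψ (χ y))
      simpa only [S.ilen_neg (j + 2) ψ, S.ilen_neg (j + 1) ψ, e _ (fun y => S.Xi (j + 1) (-y)),
        e _ (fun y => S.X (j + 1) (-(S.X (j + 1))^[S.k] (S.Xi j (-y)))),
        e _ (fun y => S.X (j + 1) (-(S.X (j + 1))^[S.k] (S.Xi j y))),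
        e _ (fun y => S.X (j + 1) (-(S.X (j + 1))^[_] y))] using this
  rw [sum_turn j hI S.k]
  have hM := hI.mono.monotoneOn
  have hu := S.up_large hI
  have hin := S.inner_small hI
  have hz := S.z_nonneg (j + 1)
  have hz1 := S.z_nonneg (j + 2)
  set W : ℝ → ℝ := fun u => S.X (j + 1) (-(S.X (j + 1))^[S.k] u) with hW
  have Wanti : Antitone W := fun x y h => S.Xm _ (neg_le_neg (S.Xiterm _ _ h))
  have w0 : S.Xi (j + 1) (-S.z (j + 1)) = S.z (j + 2) := (S.z_succ_eq _).symm
  have w1 : S.Xi (j + 1) (-0) = W (S.Xi j (S.z j)) := by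
    rw [Par.Xi_succ, neg_zero, neg_zero]; rfl
  have w2 : S.h (j + 1) = W (S.Xi j (-S.z j)) := by rw [← S.z_succ_eq]; rfl
  have i1 : S.z (j + 2) ≤ W (S.Xi j (S.z j)) := by rw [← w0, ← w1]; exact S.Xim _ (by linarith)
  have i2 : W (S.Xi j (S.z j)) ≤ W (S.Xi j 0) := Wanti (S.Xim _ (S.z_nonneg j))
  have i3 : W (S.Xi j 0) ≤ S.h (j + 1) := by
    rw [w2]; exact Wanti (S.Xim _ (by linarith [S.z_nonneg j]))
  have i4 : S.h (j + 1) ≤ S.z (j + 1) := by linarith [S.h_le_half j]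
  have hh : S.X (j + 1) (-(S.X (j + 1))^[S.k] (S.z (j + 1))) = S.h (j + 1) := rfl
  have m1 : S.z (j + 2) ∈ S.D (j + 1) := S.z_succ_mem_D (j + 1)
  have m2 := S.mem_D (hz1.trans i1) (i2.trans (i3.trans i4))
  have m3 := S.mem_D (hz1.trans (i1.trans i2)) (i3.trans i4)
  have m4 := S.mem_D (S.h_nonneg (j + 1)) i4
  have e1 := hM (S.zero_mem_D _) m1 hz1
  have e2 := hM m1 m2 i1
  have e3 := hM m2 m3 i2
  have e4 := hM m3 m4 i3
  have e5 := hM m4 (S.z_mem_D _) i4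
  change S.con * _ ≤ ψ (S.z (j + 2)) - ψ 0 at hu
  simp only [ilen]
  rw [w0, w1, hh]
  change _ + _ + 2 * (|ψ (W (S.Xi j (-S.z j))) - ψ (W (S.Xi j (-0)))| +
    |ψ (W (S.Xi j (S.z j))) - ψ (W (S.Xi j 0))|) + _ ≤ _
  rw [← w2, neg_zero, abs_of_nonneg (a := ψ (S.z (j + 2)) - _), abs_of_nonpos (a := ψ (S.z (j + 2)) - _),
    abs_of_nonneg (a := ψ (S.h (j + 1)) - _), abs_of_nonpos (a := ψ (W _) - _),
    abs_of_nonneg (a := ψ (S.z (j + 1)) - ψ 0)]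
  · unfold kap
    have := S.con_pos
    nlinarith
  all_goals linarith

end Sys

namespace Sys

variable {S : Sys}

theorem subset_image_of_endpoints {χ : ℝ → ℝ} (hc : Continuous χ) {a b x : ℝ} (hab : a ≤ b)
    (hx : χ a ≤ x ∧ x ≤ χ b ∨ χ b ≤ x ∧ x ≤ χ a) : ∃ y ∈ Icc a b, χ y = x := by
  rcases hx with hx | hx
  · exact intermediate_value_Icc hab hc.continuousOn hx
  · exact intermediate_value_Icc' hab hc.continuousOn hx

theorem Br.exists_of_mem {n m t : ℕ} {χ : ℝ → ℝ} (h : S.Br n m t χ) {x : ℝ}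
    (hx : χ 0 ≤ x ∧ x ≤ χ (S.z m) ∨ χ (S.z m) ≤ x ∧ x ≤ χ 0) :
    ∃ m t χ, S.Br n m t χ ∧ ∃ y ∈ Icc 0 (S.z m), χ y = x :=
  ⟨m, t, χ, h, subset_image_of_endpoints h.ok.cont (S.z_nonneg m) hx⟩

theorem exists_br {n : ℕ} {x : ℝ} (hx : x ∈ Icc 0 (S.z n)) :
    ∃ m t χ, S.Br n m t χ ∧ ∃ y ∈ Icc 0 (S.z m), χ y = x := by
  rcases le_total x (S.z (n + 1)) with h1 | h1
  · exact (Br.up n).exists_of_mem (Or.inl ⟨hx.1, h1⟩)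
  rcases le_total x (S.Xi n 0) with h2 | h2
  · exact (Br.far n).exists_of_mem (Or.inr ⟨by rwa [← S.z_succ_eq], by rwa [neg_zero]⟩)
  cases n with
  | zero =>
    refine Br.near.exists_of_mem (Or.inr ⟨by rwa [← Xi_zero_zero], ?_⟩)
    rw [neg_zero]; exact hx.2
  | succ j =>
    rw [Par.Xi_succ, neg_zero] at h2
    rcases le_total x (S.X (j + 1) (-(S.X (j + 1))^[S.k] (S.Xi j 0))) with h3 | h3
    · exact (Br.downPos j).exists_of_mem (Or.inr ⟨h2, h3⟩)
    rcases le_total x (S.h (j + 1)) with h4 | h4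
    · refine (Br.downNeg j).exists_of_mem (Or.inl ⟨by rwa [neg_zero], ?_⟩)
      rwa [← S.z_succ_eq]
    have key : ∀ i ≤ S.k + 1, S.X (j + 1) (-(S.X (j + 1))^[i] 0) ≤ x →
        ∃ m t χ, S.Br (j + 1) m t χ ∧ ∃ y ∈ Icc 0 (S.z m), χ y = x := by
      intro i
      induction i with
      | zero =>
        intro _ h
        refine (Br.turn j 0 (Nat.zero_le _)).exists_of_mem (Or.inr ⟨?_, ?_⟩)
        · refine le_trans (S.Xm _ ?_) h
          simpa using S.z_nonneg (j + 1)
        · simpa [z] using hx.2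
      | succ i ih =>
        intro hi h
        rcases le_total x (S.X (j + 1) (-(S.X (j + 1))^[i] 0)) with h5 | h5
        · refine (Br.turn j i (by omega)).exists_of_mem (Or.inr ⟨?_, h5⟩)
          rw [iterate_succ_apply] at h
          exact h
        · exact ih (by omega) h5
    exact key (S.k + 1) le_rfl (by rw [iterate_succ_apply]; exact h4)

/-- Points of the base interval of level `n` admitting an itinerary of length `k` which ends at
a level at most `N`. -/
def Vis (S : Sys) (N : ℕ) : ℕ → ℕ → Set ℝ
  | 0, n => if n ≤ N then Icc 0 (S.z n) else ∅
  | k + 1, n => {x | ∃ m t χ, S.Br n m t χ ∧ ∃ y ∈ Vis S N k m, χ y = x}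

theorem volume_Vis (N k n : ℕ) {ψ : ℝ → ℝ} (hψ : S.Good n ψ) :
    volume (ψ '' S.Vis N k n) ≤
      ENNReal.ofReal (2 ^ N * (1 - S.kap) ^ k * (1 / 2) ^ n * S.ilen n ψ) := by
  induction k generalizing n ψ with
  | zero =>
    unfold Vis
    split_ifs with h
    · have hsub : ψ '' Icc 0 (S.z n) ⊆ uIcc (ψ 0) (ψ (S.z n)) := by
        rintro _ ⟨y, hy, rfl⟩
        have h0 := S.zero_mem_D n
        have hz := S.z_mem_D n
        have hyD := Icc_subset_D _ hy
        rw [mem_uIcc]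
        rcases hψ with hψ | hψ
        · exact Or.inl ⟨hψ.mono.monotoneOn h0 hyD hy.1, hψ.mono.monotoneOn hyD hz hy.2⟩
        · exact Or.inr ⟨neg_le_neg_iff.1 (hψ.mono.monotoneOn hyD hz hy.2),
            neg_le_neg_iff.1 (hψ.mono.monotoneOn h0 hyD hy.1)⟩
      refine (measure_mono hsub).trans ?_
      rw [Real.volume_interval]
      refine ENNReal.ofReal_le_ofReal ?_
      have h1 : (1:ℝ) ≤ 2 ^ N * (1 / 2) ^ n := by
        rw [one_div, inv_pow, ← div_eq_mul_inv, one_le_div (by positivity)]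
        exact pow_le_pow_right₀ (by norm_num) h
      rw [pow_zero, mul_one]
      exact le_mul_of_one_le_left (abs_nonneg _) h1
    · simp
  | succ k ih =>
    set c : ℝ := 2 ^ N * (1 - S.kap) ^ k with hc
    have hc0 : 0 ≤ c := by
      have := S.kap_lt_one
      exact mul_nonneg (by positivity) (pow_nonneg (by linarith) k)
    have piece : ∀ {m t χ}, S.Br n m t χ → volume ((fun y => ψ (χ y)) '' S.Vis N k m) ≤
        ENNReal.ofReal (c * (1 / 2) ^ m * S.ilen m (fun y => ψ (χ y))) :=
      fun {m t χ} h => ih m (hψ.comp h.ok)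
    have hn : ∀ m (χ : ℝ → ℝ), 0 ≤ c * (1 / 2) ^ m * S.ilen m χ := fun m χ =>
      mul_nonneg (mul_nonneg hc0 (by positivity)) (abs_nonneg _)
    cases n with
    | zero =>
      have hsub : ψ '' S.Vis N (k + 1) 0 ⊆ (((fun y => ψ y) '' S.Vis N k 1) ∪
          ((fun y => ψ (S.Xi 0 (-y))) '' S.Vis N k 0)) ∪
          ((fun y => ψ (S.X 0 (-y))) '' S.Vis N k 0) := by
        rintro _ ⟨_, ⟨m, t, χ, h, y, hy, rfl⟩, rfl⟩
        cases h with
        | up => exact Or.inl (Or.inl ⟨y, hy, rfl⟩)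
        | far => exact Or.inl (Or.inr ⟨y, hy, rfl⟩)
        | near => exact Or.inr ⟨y, hy, rfl⟩
      refine (measure_mono hsub).trans (((measure_union_le _ _).trans (add_le_add
        ((measure_union_le _ _).trans (add_le_add (piece (Br.up 0)) (piece (Br.far 0))))
        (piece Br.near))).trans ?_)
      rw [← ENNReal.ofReal_add (hn _ _) (hn _ _), ← ENNReal.ofReal_add (add_nonneg (hn _ _) (hn _ _)) (hn _ _)]
      refine ENNReal.ofReal_le_ofReal ?_
      have := mul_le_mul_of_nonneg_left (drift_zero hψ) hc0
      rw [pow_succ (1 - S.kap), ← mul_assoc, ← hc]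
      simp only [zero_add, pow_zero, mul_one, pow_one]
      linarith
    | succ j =>
      have hsub : ψ '' S.Vis N (k + 1) (j + 1) ⊆ (((((fun y => ψ y) '' S.Vis N k (j + 2)) ∪
          ((fun y => ψ (S.Xi (j + 1) (-y))) '' S.Vis N k (j + 1))) ∪
          (((fun y => ψ (S.X (j + 1) (-(S.X (j + 1))^[S.k] (S.Xi j (-y))))) '' S.Vis N k j) ∪
          ((fun y => ψ (S.X (j + 1) (-(S.X (j + 1))^[S.k] (S.Xi j y)))) '' S.Vis N k j))) ∪
          ⋃ i ∈ Finset.range (S.k + 1),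
            ((fun y => ψ (S.X (j + 1) (-(S.X (j + 1))^[i] y))) '' S.Vis N k (j + 1))) := by
        rintro _ ⟨_, ⟨m, t, χ, h, y, hy, rfl⟩, rfl⟩
        cases h with
        | up => exact Or.inl (Or.inl (Or.inl ⟨y, hy, rfl⟩))
        | far => exact Or.inl (Or.inl (Or.inr ⟨y, hy, rfl⟩))
        | downNeg => exact Or.inl (Or.inr (Or.inl ⟨y, hy, rfl⟩))
        | downPos => exact Or.inl (Or.inr (Or.inr ⟨y, hy, rfl⟩))
        | turn j i hi =>
          exact Or.inr (mem_iUnion₂.2 ⟨i, Finset.mem_range.2 (by omega), ⟨y, hy, rfl⟩⟩)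
      refine (measure_mono hsub).trans (((measure_union_le _ _).trans (add_le_add
        ((measure_union_le _ _).trans (add_le_add
          ((measure_union_le _ _).trans (add_le_add (piece (Br.up _)) (piece (Br.far _))))
          ((measure_union_le _ _).trans (add_le_add (piece (Br.downNeg _)) (piece (Br.downPos _))))))
        ((measure_biUnion_finset_le _ _).trans (Finset.sum_le_sum fun i hi =>
          piece (Br.turn j i (by have := Finset.mem_range.1 hi; omega)))))).trans ?_)
      rw [← ENNReal.ofReal_sum_of_nonneg fun i _ => hn _ _, ← ENNReal.ofReal_add (hn _ _) (hn _ _),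
        ← ENNReal.ofReal_add (hn _ _) (hn _ _),
        ← ENNReal.ofReal_add (add_nonneg (hn _ _) (hn _ _)) (add_nonneg (hn _ _) (hn _ _)),
        ← ENNReal.ofReal_add (add_nonneg (add_nonneg (hn _ _) (hn _ _)) (add_nonneg (hn _ _) (hn _ _)))
          (Finset.sum_nonneg fun i _ => hn _ _)]
      refine ENNReal.ofReal_le_ofReal ?_
      have := mul_le_mul_of_nonneg_left (drift_succ hψ)
        (mul_nonneg hc0 (show (0:ℝ) ≤ (1 / 2) ^ (j + 1) by positivity))
      rw [← Finset.mul_sum]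
      rw [pow_succ (1 - S.kap), ← mul_assoc, ← hc]
      refine le_trans (le_of_eq ?_) (this.trans (le_of_eq (by ring)))
      rw [pow_succ _ (j + 1), pow_succ _ j]
      ring

/-- Almost no orbit visits the low levels infinitely often. -/
theorem ae_not_Vis (S : Sys) (N : ℕ) : ∀ᵐ x : ℝ, ∀ᶠ k in atTop, x ∉ S.Vis N k 0 := by
  refine ae_eventually_notMem (s := fun k => S.Vis N k 0) ?_
  have h1 : ∀ k, volume (S.Vis N k 0) ≤
      ENNReal.ofReal (2 ^ N * S.z 0 * (1 - S.kap) ^ k) := fun k => by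
    have := S.volume_Vis N k 0 (ψ := fun y => y) (Or.inl (Inc.id _))
    rw [image_id'] at this
    refine this.trans (ENNReal.ofReal_le_ofReal (le_of_eq ?_))
    rw [ilen, sub_zero, abs_of_nonneg (S.z_nonneg 0)]; ring
  refine ne_top_of_le_ne_top ?_ (ENNReal.tsum_le_tsum h1)
  have hk := S.kap_lt_one
  have hk' := S.kap_pos
  have hs : Summable fun k : ℕ => 2 ^ N * S.z 0 * (1 - S.kap) ^ k :=
    (summable_geometric_of_lt_one (by linarith) (by linarith)).mul_left _
  rw [← ENNReal.ofReal_tsum_of_nonneg (fun k => by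
    have := S.z_nonneg 0
    have := pow_nonneg (show 0 ≤ 1 - S.kap by linarith) k
    positivity) hs]
  exact ENNReal.ofReal_ne_top

theorem iter_ne_zero_of_br {n m t : ℕ} {χ : ℝ → ℝ} (h : S.Br n m t χ) {y : ℝ}
    (hy : y ∈ Icc 0 (S.z m)) {r : ℕ} (hr : S.f^[r] y = 0) : ∃ r', S.f^[r'] (χ y) = 0 := by
  have h1 := h.ok.dyn y hy
  rcases Nat.eq_zero_or_pos r with rfl | hr0
  · exact ⟨t, by rw [← abs_eq_zero, h1]; exact hr⟩
  · refine ⟨r + t, ?_⟩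
    rw [iterate_add_apply, ← hr]
    exact S.iter_eq_of_abs hr0 (by rw [h1, abs_of_nonneg hy.1])

theorem iter_z (n : ℕ) : S.f^[S.M n] (S.z n) = 0 := by
  rw [S.dyn_X (x := S.z n) (y := 0) ⟨by linarith [S.a_nonneg n], S.s_nonneg n⟩ (abs_of_nonneg (S.z_nonneg n))]
  ring

theorem cylinder_small {k n : ℕ} {ψ : ℝ → ℝ} (hψ : S.Good n ψ) {x y : ℝ} (hx : x ∈ Icc 0 (S.z n))
    (hy : y ∈ Icc 0 (S.z n)) (h : ∀ u ∈ uIcc x y, ∀ r, S.f^[r] u ≠ 0) :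
    |ψ x - ψ y| ≤ (1 - S.con) ^ k * S.ilen n ψ := by
  induction k generalizing n ψ x y with
  | zero =>
    rw [pow_zero, one_mul, ilen]
    have h0 := S.zero_mem_D n
    have hz := S.z_mem_D n
    have hxD := Icc_subset_D _ hx
    have hyD := Icc_subset_D _ hy
    rcases hψ with hψ | hψ
    · have hM := hψ.mono.monotoneOn
      rw [abs_of_nonneg (a := ψ (S.z n) - ψ 0) (by linarith [hM h0 hz (S.z_nonneg n)]), abs_le]
      constructor <;> linarith [hM h0 hxD hx.1, hM hxD hz hx.2, hM h0 hyD hy.1, hM hyD hz hy.2]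
    · have hM := hψ.mono.monotoneOn
      rw [abs_of_nonpos (a := ψ (S.z n) - ψ 0) (by linarith [hM h0 hz (S.z_nonneg n)]), abs_le]
      constructor <;> linarith [hM h0 hxD hx.1, hM hxD hz hx.2, hM h0 hyD hy.1, hM hyD hz hy.2]
  | succ k ih =>
    obtain ⟨m, t, χ, hb, x', hx', rfl⟩ := exists_br hx
    have hzm : S.z m ∈ Icc 0 (S.z m) := ⟨S.z_nonneg m, le_rfl⟩
    have h0m : (0:ℝ) ∈ Icc 0 (S.z m) := ⟨le_rfl, S.z_nonneg m⟩
    have e0 : χ 0 ∉ uIcc (χ x') y := fun hmem => by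
      obtain ⟨r, hr⟩ := iter_ne_zero_of_br hb h0m (r := 0) rfl
      exact h _ hmem r hr
    have ez : χ (S.z m) ∉ uIcc (χ x') y := fun hmem => by
      obtain ⟨r, hr⟩ := iter_ne_zero_of_br hb hzm (S.iter_z m)
      exact h _ hmem r hr
    have hmono : MonotoneOn χ (Icc 0 (S.z m)) ∨ AntitoneOn χ (Icc 0 (S.z m)) := by
      rcases hb.ok.good with hg | hg
      · exact Or.inl (hg.mono.monotoneOn.mono (Icc_subset_D m))
      · refine Or.inr fun a ha b hb hab => neg_le_neg_iff.1 (hg.mono.monotoneOn.mono (Icc_subset_D m) ha hb hab)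
    rw [mem_uIcc] at e0 ez
    push Not at e0 ez
    have hy' : ∃ y' ∈ Icc 0 (S.z m), χ y' = y := by
      refine subset_image_of_endpoints hb.ok.cont (S.z_nonneg m) ?_
      rcases hmono with hm | hm
      · refine Or.inl ⟨?_, ?_⟩
        · by_contra! hlt
          linarith [e0.2 hlt.le, hm h0m hx' hx'.1]
        · by_contra! hlt
          linarith [ez.1 (hm hx' hzm hx'.2)]
      · refine Or.inr ⟨?_, ?_⟩
        · by_contra! hlt
          linarith [ez.2 hlt.le, hm hx' hzm hx'.2]
        · by_contra! hlt
          linarith [e0.1 (hm h0m hx' hx'.1)]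
    obtain ⟨y', hy', rfl⟩ := hy'
    have hsub : uIcc x' y' ⊆ Icc 0 (S.z m) := uIcc_subset_Icc hx' hy'
    have := ih (hψ.comp hb.ok) hx' hy' fun u hu r hr => by
      obtain ⟨r', hr'⟩ := iter_ne_zero_of_br hb (hsub hu) hr
      refine h _ ?_ r' hr'
      rcases hmono with hm | hm
      · exact (hm.mono hsub).image_uIcc_subset ⟨u, hu, rfl⟩
      · exact (hm.mono hsub).image_uIcc_subset ⟨u, hu, rfl⟩
    refine this.trans ?_
    rw [pow_succ, mul_assoc]
    exact mul_le_mul_of_nonneg_left (hb.ilen_le hψ) (pow_nonneg (by linarith [S.con_lt_one]) k)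

/-- There are no homtervals in the base interval. -/
theorem exists_iter_eq_zero {x y : ℝ} (hx : x ∈ Icc 0 (S.z 0)) (hy : y ∈ Icc 0 (S.z 0))
    (hxy : x < y) : ∃ u ∈ Icc x y, ∃ r, S.f^[r] u = 0 := by
  by_contra! h
  rw [← uIcc_of_le hxy.le] at h
  have h1 : ∀ k, |x - y| ≤ (1 - S.con) ^ k * S.ilen 0 (fun y => y) := fun k =>
    cylinder_small (ψ := fun y => y) (Or.inl (Inc.id _)) hx hy h
  have h2 : Tendsto (fun k => (1 - S.con) ^ k * S.ilen 0 (fun y => y)) atTop (𝓝 (0 * _)) :=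
    (tendsto_pow_atTop_nhds_zero_of_lt_one (by linarith [S.con_lt_one])
      (by linarith [S.con_pos])).mul_const _
  have h3 := ge_of_tendsto' h2 h1
  have h4 := abs_pos.2 (sub_ne_zero.2 hxy.ne)
  linarith

end Sys

namespace Sys

variable {S : Sys}

theorem f_cont (S : Sys) : Continuous S.f := by unfold f; fun_prop

theorem iter_cont (S : Sys) (t : ℕ) : Continuous S.f^[t] := S.f_cont.iterate t

theorem f_lt_f {x y : ℝ} (h : |x| < |y|) : S.f x < S.f y := by
  rw [← S.f_abs x, ← S.f_abs y]
  have := pow_lt_pow_left₀ h (abs_nonneg x) (S.N_ne)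
  have hB := S.B_pos
  unfold f
  exact sub_lt_sub_right (div_lt_div_of_pos_right this hB) _

theorem f_le_f {x y : ℝ} (h : |x| ≤ |y|) : S.f x ≤ S.f y := by
  rcases h.lt_or_eq with h | h
  · exact (f_lt_f h).le
  · rw [← S.f_abs x, h, S.f_abs y]

theorem abs_eq_of_f_eq {x y : ℝ} (h : S.f x = S.f y) : |x| = |y| := by
  rcases lt_trichotomy |x| |y| with h1 | h1 | h1
  · exact absurd h (f_lt_f h1).ne
  · exact h1
  · exact absurd h (f_lt_f h1).ne'

theorem f_zero : S.f 0 = -1 := by simp [f]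

theorem f_one : S.f 1 = S.v 0 := by
  have := S.B_v0
  have hB := S.B_pos
  unfold f
  rw [one_pow]; field_simp; linarith

theorem f_v0 : S.f (S.v 0) = S.a 1 := by
  rw [v, Par.X, S.f_rt (by rw [Par.T_zero]; linarith [S.a_nonneg 1]), Par.T_zero]; ring

theorem f_mem {x : ℝ} (h : |x| ≤ 1) : S.f x ∈ Icc (-1) (S.v 0) := by
  rw [← f_zero (S := S), ← f_one (S := S)]
  exact ⟨f_le_f (by simp), f_le_f (by simpa using h)⟩

theorem abs_f_le {x : ℝ} (h : |x| ≤ 1) : |S.f x| ≤ 1 :=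
  abs_le.2 ⟨(f_mem h).1, (f_mem h).2.trans S.v0_lt_one.le⟩

theorem abs_iter_le {x : ℝ} (h : |x| ≤ 1) (t : ℕ) : |S.f^[t] x| ≤ 1 := by
  induction t with
  | zero => exact h
  | succ t ih => rw [iterate_succ_apply']; exact abs_f_le ih

/-- Every orbit enters the base interval. -/
theorem exists_iter_le {x : ℝ} (h : |x| ≤ 1) : ∃ t, |S.f^[t] x| ≤ S.z 0 := by
  have hz := S.z_nonneg 0
  have fz : S.f (S.z 0) = 0 := by simpa [M] using S.iter_z 0
  by_contra! hc
  have h0 : S.z 0 < |x| := hc 0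
  have h1 : 0 < S.f x := by rw [← fz]; exact f_lt_f (by rwa [abs_of_nonneg hz])
  have h2 : S.z 0 < |S.f x| := hc 1
  have h3 : 0 < S.f (S.f x) := by rw [← fz]; exact f_lt_f (by rwa [abs_of_nonneg hz])
  have h4 : S.z 0 < |S.f (S.f x)| := hc 2
  have h5 : S.f (S.f x) ≤ S.a 1 := by
    rw [← f_v0]; exact f_le_f (by
      rw [abs_of_pos h1, abs_of_nonneg (S.v_nonneg 0)]; exact (f_mem h).2)
  rw [abs_of_pos h3] at h4
  linarith [S.a_succ_le_z 0]

theorem injOn_of_ne_zero {x y : ℝ} {t : ℕ} (h : ∀ u ∈ uIcc x y, ∀ i < t, S.f^[i] u ≠ 0) :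
    InjOn S.f^[t] (uIcc x y) := by
  induction t with
  | zero => intro a _ b _ h; exact h
  | succ t ih =>
    intro a ha b hb hab
    rw [iterate_succ_apply', iterate_succ_apply'] at hab
    have h1 := ih fun u hu i hi => h u hu i (by omega)
    rcases abs_eq_abs.1 (abs_eq_of_f_eq hab) with h2 | h2
    · exact h1 ha hb h2
    · exfalso
      have h3 : (0:ℝ) ∈ uIcc (S.f^[t] a) (S.f^[t] b) := by
        rw [h2, mem_uIcc]
        rcases le_total (S.f^[t] b) 0 with h | h
        · right; constructor <;> linarith
        · left; constructor <;> linarith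
      obtain ⟨u, hu, hu0⟩ := intermediate_value_uIcc (S.iter_cont t).continuousOn h3
      exact h u (uIcc_subset_uIcc ha hb hu) t (by omega) hu0

/-- There are no homtervals. -/
theorem exists_iter_eq_zero' {x y : ℝ} (hx : |x| ≤ 1) (hxy : x < y) :
    ∃ u ∈ Icc x y, ∃ r, S.f^[r] u = 0 := by
  by_contra! h
  rw [← uIcc_of_le hxy.le] at h
  obtain ⟨t, ht⟩ := exists_iter_le (S := S) hx
  have hinj := injOn_of_ne_zero (S := S) (t := t) fun u hu i _ => h u hu i
  have hne : S.f^[t] x ≠ S.f^[t] y := fun he =>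
    hxy.ne (hinj left_mem_uIcc right_mem_uIcc he)
  have havoid : ∀ u ∈ uIcc (S.f^[t] x) (S.f^[t] y), ∀ i, S.f^[i] u ≠ 0 := fun u hu i hi => by
    obtain ⟨w, hw, rfl⟩ := intermediate_value_uIcc (S.iter_cont t).continuousOn hu
    exact h w hw (i + t) (by rw [iterate_add_apply, hi])
  generalize S.f^[t] x = x' at *
  generalize S.f^[t] y = y' at *
  have fz : S.f (S.z 0) = 0 := by simpa [M] using S.iter_z 0
  have n0 : (0:ℝ) ∉ uIcc x' y' := fun h => havoid _ h 0 rfl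
  have n1 : S.z 0 ∉ uIcc x' y' := fun h => havoid _ h 1 fz
  have n2 : -S.z 0 ∉ uIcc x' y' := fun h => havoid _ h 1 (by rw [iterate_one, S.f_neg, fz])
  have hxy' : ∃ x y, x < y ∧ x ∈ Icc 0 (S.z 0) ∧ y ∈ Icc 0 (S.z 0) ∧
      ∀ u ∈ Icc x y, u ∈ uIcc x' y' ∨ -u ∈ uIcc x' y' := by
    rw [mem_uIcc] at n0 n1 n2
    push Not at n0 n1 n2
    rw [abs_le] at ht
    rcases lt_or_ge x' 0 with hs | hs
    · have h1 : y' < 0 := by by_contra! h; linarith [n0.1 hs.le]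
      have h2 : -S.z 0 < y' := by by_contra! h; linarith [n2.2 h]
      rcases lt_or_gt_of_ne hne with h3 | h3
      · exact ⟨-y', -x', by linarith, ⟨by linarith, by linarith⟩, ⟨by linarith, by linarith⟩,
          fun u hu => Or.inr (mem_uIcc.2 (Or.inl ⟨by linarith [hu.2], by linarith [hu.1]⟩))⟩
      · exact ⟨-x', -y', by linarith, ⟨by linarith, by linarith⟩, ⟨by linarith, by linarith⟩,
          fun u hu => Or.inr (mem_uIcc.2 (Or.inr ⟨by linarith [hu.2], by linarith [hu.1]⟩))⟩
    · have h1 : 0 < y' := by by_contra! h; linarith [n0.2 h]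
      have h2 : y' < S.z 0 := by by_contra! h; linarith [n1.1 ht.2]
      rcases lt_or_gt_of_ne hne with h3 | h3
      · exact ⟨x', y', by linarith, ⟨by linarith, by linarith⟩, ⟨by linarith, by linarith⟩,
          fun u hu => Or.inl (mem_uIcc.2 (Or.inl ⟨by linarith [hu.1], by linarith [hu.2]⟩))⟩
      · exact ⟨y', x', by linarith, ⟨by linarith, by linarith⟩, ⟨by linarith, by linarith⟩,
          fun u hu => Or.inl (mem_uIcc.2 (Or.inr ⟨by linarith [hu.1], by linarith [hu.2]⟩))⟩
  obtain ⟨x, y, hxy, hx, hy, hu⟩ := hxy'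
  obtain ⟨u, hu', r, hr⟩ := exists_iter_eq_zero hx hy hxy
  rcases hu u hu' with h | h
  · exact havoid u h r hr
  · refine havoid _ h r ?_
    rcases Nat.eq_zero_or_pos r with rfl | hr0
    · simpa using hr
    · rw [← hr]; exact S.iter_eq_of_abs hr0 (abs_neg u)

/-! ### Closest returns -/

theorem a_succ_lt (n : ℕ) : S.a (n + 1) < S.a n := (S.a_le_p n).trans_lt (S.p_lt_a n)

theorem a_strictAnti (S : Sys) : StrictAnti S.a := strictAnti_nat_of_succ_lt S.a_succ_lt

theorem abs_iter_M (n : ℕ) : |S.f^[S.M n] 0| = S.a n := by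
  rw [S.dyn_X (y := -S.a n) ⟨le_rfl, by linarith [S.a_nonneg n, S.s_nonneg n]⟩
    (by rw [S.X_neg_a]; simp), abs_mul, abs_sg, one_mul, abs_neg, abs_of_nonneg (S.a_nonneg n)]

/-- The turning point is not periodic. -/
theorem iter_zero_ne {t : ℕ} (ht : 0 < t) : S.f^[t] 0 ≠ 0 := by
  intro h
  have hp : IsPeriodicPt S.f t 0 := h
  obtain ⟨i, j, hij, he⟩ := Finite.exists_ne_map_eq_of_infinite
    (fun n : ℕ => (⟨S.M n % t, Nat.mod_lt _ ht⟩ : Fin t))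
  have h1 := congrArg Fin.val he
  simp only at h1
  have h2 : S.f^[S.M i] 0 = S.f^[S.M j] 0 := by
    rw [← hp.iterate_mod_apply, h1, hp.iterate_mod_apply]
  refine hij (S.a_strictAnti.injective ?_)
  rw [← abs_iter_M, h2, abs_iter_M]

theorem a_le_of_ge {n : ℕ} : S.a (n + 1) ≤ (1 / 2) ^ n := by
  have h : ∀ n, S.z (n + 1) ≤ (1 / 2) ^ n := fun n => by
    induction n with
    | zero => simpa using S.z_le_one 1
    | succ n ih =>
      have := S.z_succ_le_half n
      rw [pow_succ]; linarith
  cases n with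
  | zero => simpa using (S.a_mem 1).2
  | succ n =>
    have h1 : S.a (n + 2) ≤ S.h (n + 1) := (S.a_le_p _).trans (S.Xi_succ_le_h n _)
    have h2 := S.h_le_half n
    have h3 := h n
    rw [pow_succ]; linarith

theorem tendsto_a (S : Sys) : Tendsto S.a atTop (𝓝 0) := by
  rw [← tendsto_add_atTop_iff_nat 1]
  refine squeeze_zero (fun n => S.a_nonneg _) (fun n => a_le_of_ge)
    (tendsto_pow_atTop_nhds_zero_of_lt_one (by norm_num) (by norm_num))

/-- Radii of the nest of neighbourhoods of the turning point. -/
def pp (S : Sys) : ℕ → ℝ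
  | 0 => 1
  | n + 1 => S.p n

theorem pp_succ (n : ℕ) : S.pp (n + 1) = S.p n := rfl
theorem pp_nonneg (n : ℕ) : 0 ≤ S.pp n := by
  cases n with
  | zero => exact zero_le_one
  | succ n => exact S.p_nonneg n

theorem p_succ_le_p (n : ℕ) : S.p (n + 1) ≤ S.p n := by
  have h2 := S.h_le_half n
  linarith [S.Xi_succ_le_h n (S.X (n + 1) (S.v (n + 2))), S.z_le_p n, S.z_nonneg (n + 1),
    show S.p (n + 1) = S.Xi (n + 1) (S.X (n + 1) (S.v (n + 2))) from rfl]

theorem pp_succ_le (n : ℕ) : S.pp (n + 1) ≤ S.pp n := by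
  cases n with
  | zero => exact ((S.p_lt_a 0).le).trans (S.a_mem 0).2
  | succ n => exact p_succ_le_p n

theorem pp_anti (S : Sys) : Antitone S.pp := antitone_nat_of_succ_le pp_succ_le
theorem pp_le_one (n : ℕ) : S.pp n ≤ 1 := S.pp_anti (Nat.zero_le n)

theorem tendsto_pp (S : Sys) : Tendsto S.pp atTop (𝓝 0) := by
  rw [← tendsto_add_atTop_iff_nat 1]
  exact squeeze_zero (fun n => pp_nonneg _) (fun n => (S.p_lt_a n).le) S.tendsto_a

theorem v_le_p (j : ℕ) : S.v (j + 1) ≤ S.p j := S.X_le_p j _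

/-- Points near the turning point in terms of the far branch. -/
theorem exists_Xi_eq {j : ℕ} {x : ℝ} (hx : |x| ≤ S.p j) :
    ∃ w ∈ Icc (-S.v j) (S.X j (S.v (j + 1))), |x| = S.Xi j w := by
  have h1 : -S.v j ≤ S.X j (S.v (j + 1)) := by linarith [S.v_nonneg j, S.X0 j (S.v (j + 1))]
  obtain ⟨w, hw, he⟩ := intermediate_value_Icc h1 (Xi_cont S j).continuousOn
    (show |x| ∈ Icc _ _ from ⟨by rw [S.Xi_neg_v]; exact abs_nonneg x, hx⟩)
  exact ⟨w, hw, he.symm⟩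

theorem v_succ_lt_s (j : ℕ) : S.v (j + 1) < S.s j := (v_le_p j).trans_lt ((S.p_lt_a j).trans_le (S.a_le_s j))

theorem X_v_le_s (j : ℕ) : S.X j (S.v (j + 1)) ≤ S.s j :=
  S.X_z_le_s j (S.X_succ_le_z _ _)

theorem X_v_lt_X_s (j : ℕ) : S.X j (S.v (j + 1)) < S.X j (S.s j) :=
  (S.X_inc j).mono ⟨by linarith [S.a_nonneg j, S.v_nonneg (j + 1)], (v_succ_lt_s j).le⟩
    ⟨by linarith [S.a_nonneg j, S.s_nonneg j], le_rfl⟩ (v_succ_lt_s j)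

theorem v_lt_X_s (j : ℕ) : S.v j < S.X j (S.s j) :=
  have h : S.a (j + 1) < S.s j := (a_succ_lt j).trans_le (S.a_le_s j)
  (S.X_inc j).mono ⟨by linarith [S.a_nonneg j, S.a_nonneg (j + 1)], h.le⟩
    ⟨by linarith [S.a_nonneg j, S.s_nonneg j], le_rfl⟩ h

theorem p_lt_Xi_s (j : ℕ) : S.p j < S.Xi j (S.s j) := by
  have h : S.X j (S.v (j + 1)) < S.s j := by
    refine (((S.X_inc j).mono ⟨by linarith [S.a_nonneg j, S.v_nonneg (j + 1)], (v_succ_lt_s j).le⟩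
      ⟨by linarith [S.a_nonneg j, S.z_nonneg j], ?_⟩ ?_).trans_le (S.X_z_le_s j le_rfl))
    · exact (S.z_le_a j).trans (S.a_le_s j)
    · have h0 : S.X j (-S.a (j + 2)) ≤ S.v j := S.Xm j (by linarith [S.a_nonneg (j + 2), S.a_nonneg (j + 1)])
      have h1 : -S.X j (-S.a (j + 2)) < S.s j := by linarith [S.X0 j (-S.a (j + 2)), S.s_pos j]
      have h2 := (S.Xi_inc j).mono ⟨by linarith, h1.le⟩
        ⟨by linarith [S.v_nonneg j, S.s_nonneg j], le_rfl⟩ h1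
      refine lt_of_lt_of_le ?_ (S.Xi_le_z j (S.s j))
      rw [v, Par.X_succ]; exact h2
  exact (S.Xi_inc j).mono ⟨by linarith [S.v_nonneg j, S.X0 j (S.v (j + 1))], h.le⟩
    ⟨by linarith [S.v_nonneg j, S.s_nonneg j], le_rfl⟩ h

/-- Returns of the nest. -/
theorem abs_iter_block {n i : ℕ} (hi : i ≤ S.q n) {x : ℝ} (hx : |x| ≤ S.pp (n + 1)) :
    |S.f^[i * S.M n] x| ≤ S.pp n := by
  cases n with
  | zero => exact abs_iter_le (hx.trans (S.pp_le_one 1)) _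
  | succ j =>
    obtain ⟨w, hw, hxw⟩ := exists_Xi_eq hx
    rcases Nat.lt_or_ge i (S.k + 2) with h1 | h1
    · rcases Nat.eq_zero_or_pos i with rfl | h0
      · rw [zero_mul]; exact hx.trans (pp_succ_le _)
      obtain ⟨i, rfl⟩ : ∃ l, i = l + 1 := ⟨i - 1, by omega⟩
      obtain ⟨l, hl⟩ : ∃ l, S.k = i + l := ⟨S.k - i, by omega⟩
      rw [Par.Xi_succ] at hxw
      set u := S.Xi j (S.X j (-w)) with hu
      have hup : u ≤ S.p j := S.Xim j (S.Xm j (by linarith [hw.1]))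
      have hu0 : 0 ≤ u := S.Xi0 _ _
      have h2 : (S.X (j + 1))^[S.k] u = (S.X (j + 1))^[i] ((S.X (j + 1))^[l] u) := by
        rw [hl, iterate_add_apply]
      have hk := Xiter_k_mem hu0 hup
      rw [h2] at hxw hk
      have h3 : |S.f^[(i + 1) * S.M (j + 1)] x| = (S.X (j + 1))^[l] u := by
        rw [S.iter_eq_of_abs (Nat.mul_pos (Nat.succ_pos i) (S.M_pos _)) (y := S.X (j + 1)
          (-((S.X (j + 1))^[i] ((S.X (j + 1))^[l] u)))) (by rw [hxw, abs_of_nonneg (S.X0 _ _)]),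
          dyn_turn hk.1 hk.2 fun r _ => ⟨?_, ?_⟩, abs_of_nonneg (S.Xiter_nonneg _ _ hu0)]
        · linarith [S.Xiter_nonneg (j + 1) r (S.Xiter_nonneg (j + 1) l hu0), S.a_nonneg (j + 1)]
        · rw [← iterate_add_apply]
          exact (S.Xiter_succ_le_z j _ (hup.trans (S.p_le_z j))).trans (S.z_le_a j)
      rw [h3]
      exact (S.Xiterm _ _ hup).trans (S.Xiter_le_p j l)
    · have h2 : i * S.M (j + 1) = S.Q (j + 1) := by
        have : i = S.k + 2 := le_antisymm hi h1
        rw [this]; rfl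
      rw [h2, S.dyn_Xi ⟨hw.1, hw.2.trans (X_v_le_s _)⟩ hxw, abs_mul, abs_tau, one_mul, abs_le]
      have e1 : S.v (j + 1) ≤ S.pp (j + 1) := v_le_p j
      have e2 : S.X (j + 1) (S.v (j + 2)) ≤ S.pp (j + 1) := S.X_le_p j _
      exact ⟨by linarith [hw.1], by linarith [hw.2]⟩

theorem M_dvd_succ (n : ℕ) : S.M n ∣ S.M (n + 1) := ⟨S.q n + 1, mul_comm _ _⟩

theorem M_dvd {n N : ℕ} (h : n ≤ N) : S.M n ∣ S.M N := by
  induction N, h using Nat.le_induction with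
  | base => exact dvd_rfl
  | succ N _ ih => exact ih.trans (M_dvd_succ N)

theorem q_ge_two (n : ℕ) : 2 ≤ S.q n := by cases n <;> simp [q]

theorem lt_M (n : ℕ) : n < S.M n := by
  induction n with
  | zero => exact S.M_pos 0
  | succ n ih =>
    have h1 := q_ge_two (S := S) n
    have h2 : S.M (n + 1) = (S.q n + 1) * S.M n := rfl
    nlinarith

theorem abs_iter_le_pp {n N t : ℕ} (hn : n ≤ N) (ht : t < S.M N) (hd : S.M n ∣ t) {x : ℝ}
    (hx : |x| ≤ S.pp N) : |S.f^[t] x| ≤ S.pp n := by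
  induction N, hn using Nat.le_induction generalizing t x with
  | base =>
    rw [Nat.eq_zero_of_dvd_of_lt hd ht]; exact hx
  | succ N hN ih =>
    have h1 : t / S.M N ≤ S.q N := by
      rw [← Nat.lt_succ_iff, Nat.div_lt_iff_lt_mul (S.M_pos N)]; exact ht
    have h2 := abs_iter_block h1 hx
    have h3 := ih (t := t % S.M N) (Nat.mod_lt _ (S.M_pos N))
      ((Nat.dvd_mod_iff (M_dvd hN)).2 hd) h2
    rw [← iterate_add_apply] at h3
    rwa [mul_comm, Nat.mod_add_div] at h3

theorem abs_orbit_le {n t : ℕ} (h : S.M n ∣ t) : |S.f^[t] 0| ≤ S.pp n := by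
  refine abs_iter_le_pp (N := max n t) (le_max_left _ _) ?_ h (by simpa using pp_nonneg _)
  exact (lt_of_le_of_lt (le_max_right n t) (lt_M _))

theorem iter_ne_zero_of_injOn {t : ℕ} {b : ℝ} (hinj : InjOn S.f^[t] (Icc 0 b)) {i : ℕ} (h0 : 0 < i)
    (hi : i < t) {x : ℝ} (hx : |x| < b) : S.f^[i] x ≠ 0 := by
  intro hz
  rw [← S.iter_abs h0] at hz
  rcases (abs_nonneg x).eq_or_lt with hx0 | hx0
  · rw [← hx0] at hz; exact iter_zero_ne h0 hz
  have hinj1 : InjOn S.f^[i + 1] (Icc 0 b) := fun u hu w hw he => hinj hu hw (by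
    obtain ⟨l, rfl⟩ : ∃ l, t = l + (i + 1) := ⟨t - (i + 1), by omega⟩
    rw [iterate_add_apply, he, ← iterate_add_apply])
  have hinj2 : InjOn S.f^[i] (Icc 0 b) := fun u hu w hw he => hinj1 hu hw (by
    rw [iterate_succ_apply', he, ← iterate_succ_apply' S.f])
  have hxI : |x| ∈ Icc 0 b := ⟨hx0.le, hx.le⟩
  have h0I : (0:ℝ) ∈ Icc 0 b := ⟨le_rfl, hx0.le.trans hx.le⟩
  have hbI : b ∈ Icc 0 b := ⟨hx0.le.trans hx.le, le_rfl⟩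
  set g := S.f^[i] with hg
  have gc : Continuous g := S.iter_cont i
  -- two points with opposite values
  have key : ∃ e, e ≠ 0 ∧ ∃ u ∈ Icc 0 b, ∃ w ∈ Icc 0 b, g u = e ∧ g w = -e := by
    have hmono := gc.continuousOn.strictMonoOn_of_injOn_Icc' (hx0.le.trans hx.le) hinj2
    have hs : ∃ σ : ℝ, |σ| = 1 ∧ σ * g 0 < 0 ∧ 0 < σ * g b := by
      rcases hmono with hm | hm
      · exact ⟨1, by simp, by linarith [hm h0I hxI hx0], by linarith [hm hxI hbI hx]⟩
      · exact ⟨-1, by simp, by linarith [hm h0I hxI hx0], by linarith [hm hxI hbI hx]⟩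
    obtain ⟨σ, hσ, hl, hr⟩ := hs
    have hσ2 : σ * σ = 1 := by rw [← abs_mul_abs_self, hσ, one_mul]
    have hc : Continuous fun u => σ * g u := by fun_prop
    set e := min (-(σ * g 0)) (σ * g b) with he
    have he0 : 0 < e := lt_min (by linarith) hr
    have he1 : e ≤ -(σ * g 0) := min_le_left _ _
    have he2 : e ≤ σ * g b := min_le_right _ _
    obtain ⟨u, hu, hu'⟩ := intermediate_value_Icc (hx0.le.trans hx.le) hc.continuousOn
      (show e ∈ Icc _ _ from ⟨by linarith, he2⟩)
    obtain ⟨w, hw, hw'⟩ := intermediate_value_Icc (hx0.le.trans hx.le) hc.continuousOn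
      (show -e ∈ Icc _ _ from ⟨by linarith, by linarith⟩)
    refine ⟨σ * e, mul_ne_zero (by rintro rfl; simp at hσ) he0.ne', u, hu, w, hw, ?_, ?_⟩
    · have : σ * (σ * g u) = σ * e := congrArg (σ * ·) hu'
      rwa [← mul_assoc, hσ2, one_mul] at this
    · have : σ * (σ * g w) = σ * -e := congrArg (σ * ·) hw'
      rw [← mul_assoc, hσ2, one_mul] at this
      rw [this]; ring
  obtain ⟨e, he, u, hu, w, hw, hgu, hgw⟩ := key
  have : u = w := hinj1 hu hw (by
    rw [iterate_succ_apply', iterate_succ_apply', ← hg, hgu, hgw, S.f_neg])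
  rw [this, hgw] at hgu
  exact he (by linarith)

theorem injOn_M (j : ℕ) : InjOn S.f^[S.M j] (Icc 0 (S.X j (S.s j))) := by
  have key : ∀ u ∈ Icc 0 (S.X j (S.s j)), ∃ y ∈ Icc (-S.a j) (S.s j), S.X j y = u := fun u hu =>
    intermediate_value_Icc (by linarith [S.a_nonneg j, S.s_nonneg j]) (X_cont S j).continuousOn
      (by rwa [S.X_neg_a])
  intro u hu w hw h
  obtain ⟨y, hy, rfl⟩ := key u hu
  obtain ⟨y', hy', rfl⟩ := key w hw
  rw [S.dyn_X hy (abs_of_nonneg (S.X0 _ _)), S.dyn_X hy' (abs_of_nonneg (S.X0 _ _))] at h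
  rw [mul_left_cancel₀ (by simp [sg]) h]

theorem injOn_Q (j : ℕ) : InjOn S.f^[S.Q j] (Icc 0 (S.Xi j (S.s j))) := by
  have key : ∀ u ∈ Icc 0 (S.Xi j (S.s j)), ∃ y ∈ Icc (-S.v j) (S.s j), S.Xi j y = u := fun u hu =>
    intermediate_value_Icc (by linarith [S.v_nonneg j, S.s_nonneg j]) (Xi_cont S j).continuousOn
      (by rwa [S.Xi_neg_v])
  intro u hu w hw h
  obtain ⟨y, hy, rfl⟩ := key u hu
  obtain ⟨y', hy', rfl⟩ := key w hw
  rw [S.dyn_Xi hy (abs_of_nonneg (S.Xi0 _ _)), S.dyn_Xi hy' (abs_of_nonneg (S.Xi0 _ _))] at h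
  rw [mul_left_cancel₀ (by rw [← abs_pos, abs_tau]; exact one_pos) h]

theorem iter_ne_zero {j i : ℕ} (h0 : 0 < i) (hi : i < S.M (j + 1)) (hQ : i ≠ S.Q j) {x : ℝ}
    (hx : |x| ≤ S.p j) : S.f^[i] x ≠ 0 := by
  rcases lt_or_gt_of_ne hQ with h | h
  · exact iter_ne_zero_of_injOn (injOn_Q j) h0 h (hx.trans_lt (p_lt_Xi_s j))
  · obtain ⟨i, rfl⟩ : ∃ l, i = l + S.Q j := ⟨i - S.Q j, by omega⟩
    rw [S.M_succ] at hi
    obtain ⟨w, hw, hxw⟩ := exists_Xi_eq hx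
    rw [iterate_add_apply]
    refine iter_ne_zero_of_injOn (injOn_M j) (by omega) (by omega) ?_
    rw [S.dyn_Xi ⟨hw.1, hw.2.trans (X_v_le_s _)⟩ hxw, abs_mul, abs_tau, one_mul, abs_lt]
    exact ⟨by linarith [hw.1, v_lt_X_s (S := S) j], by linarith [hw.2, X_v_lt_X_s (S := S) j]⟩

theorem abs_iter_M_le {j : ℕ} {x : ℝ} (hx : |x| ≤ S.p j) : |S.f^[S.M (j + 1)] x| ≤ S.a j := by
  obtain ⟨w, hw, hxw⟩ := exists_Xi_eq hx
  rw [S.M_succ, add_comm, iterate_add_apply]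
  set y := S.f^[S.Q j] x with hy
  have hyw : |y| = |w| := by
    rw [hy, S.dyn_Xi ⟨hw.1, hw.2.trans (X_v_le_s _)⟩ hxw, abs_mul, abs_tau, one_mul]
  have h1 : |w| ≤ S.X j (S.a j) := by
    have e1 : S.v j ≤ S.X j (S.a j) := S.Xm j (S.a_succ_le j)
    have e2 : S.X j (S.v (j + 1)) ≤ S.X j (S.a j) := S.Xm j ((v_le_p j).trans (S.p_lt_a j).le)
    exact abs_le.2 ⟨by linarith [hw.1], by linarith [hw.2]⟩
  have ha := S.a_nonneg j
  obtain ⟨u, hu, he⟩ := intermediate_value_Icc (show -S.a j ≤ S.a j by linarith) (X_cont S j).continuousOn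
    (show |w| ∈ Icc _ _ from ⟨by rw [S.X_neg_a]; exact abs_nonneg w, h1⟩)
  rw [S.dyn_X ⟨hu.1, hu.2.trans (S.a_le_s j)⟩ (hyw.trans he.symm), abs_mul, abs_sg, one_mul]
  exact abs_le.2 hu

/-- Every interval contains points with two different hitting times of the turning point. -/
theorem exists_two_hits {x y : ℝ} (hx : |x| ≤ 1) (hy : |y| ≤ 1) (hxy : x < y) :
    ∃ N N', N < N' ∧ (∃ u ∈ Icc x y, S.f^[N] u = 0) ∧ ∃ u ∈ Icc x y, S.f^[N'] u = 0 := by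
  have hex : ∃ N, ∃ u ∈ Icc x y, S.f^[N] u = 0 := by
    obtain ⟨u, hu, r, hr⟩ := exists_iter_eq_zero' (S := S) hx hxy
    exact ⟨r, u, hu, hr⟩
  obtain ⟨u, hu, hN⟩ := Nat.find_spec hex
  set N := Nat.find hex
  have hinj : InjOn S.f^[N] (Icc x y) := by
    rw [← uIcc_of_le hxy.le]
    refine injOn_of_ne_zero fun w hw i hi h => Nat.find_min hex hi ⟨w, ?_, h⟩
    rwa [uIcc_of_le hxy.le] at hw
  have hsub : ∃ x' y', x ≤ x' ∧ x' < y' ∧ y' ≤ y ∧ u ∉ Icc x' y' := by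
    rcases hu.1.eq_or_lt with h | h
    · exact ⟨(u + y) / 2, y, by linarith [hu.2], by linarith, le_rfl, fun h' => by linarith [h'.1]⟩
    · exact ⟨x, (x + u) / 2, le_rfl, by linarith, by linarith [hu.2], fun h' => by linarith [h'.2]⟩
  obtain ⟨x', y', h1, h2, h3, h4⟩ := hsub
  rw [abs_le] at hx hy
  obtain ⟨w, hw, r, hr⟩ := exists_iter_eq_zero' (S := S) (x := x') (abs_le.2 ⟨by linarith, by linarith⟩) h2
  have hw' : w ∈ Icc x y := ⟨h1.trans hw.1, hw.2.trans h3⟩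
  refine ⟨N, r, lt_of_le_of_ne (Nat.find_min' hex ⟨w, hw', hr⟩) ?_, ⟨u, hu, hN⟩, ⟨w, hw', hr⟩⟩
  rintro rfl
  exact h4 (hinj hw' hu (hr.trans hN.symm) ▸ hw)

end Sys

namespace Sys

variable {S : Sys}

/-- An interval is contained in the images of small neighbourhoods of the turning point only for
finitely many levels. -/
theorem eventually_not_cover {x y : ℝ} (hx : |x| ≤ 1) (hy : |y| ≤ 1) (hxy : x < y) :
    ∀ᶠ n in atTop, ∀ r < S.M n, ¬ Icc x y ⊆ S.f^[r] '' {u | |u| ≤ S.pp n} := by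
  obtain ⟨N, N', hN, ⟨w, hw, hwN⟩, w', hw', hwN'⟩ := exists_two_hits (S := S) hx hy hxy
  have hne : ∀ t, ∃ u ∈ Icc x y, S.f^[t] u ≠ 0 := by
    intro t
    by_contra! hcon
    have hit : ∀ r, ∀ u ∈ Icc x y, S.f^[r] u = 0 → r = t := by
      intro r u hu hr
      by_contra hrt
      rcases lt_or_gt_of_ne hrt with h | h
      · obtain ⟨d, rfl⟩ : ∃ d, t = d + r := ⟨t - r, by omega⟩
        have := hcon u hu
        rw [iterate_add_apply, hr] at this
        exact iter_zero_ne (by omega) this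
      · obtain ⟨d, rfl⟩ : ∃ d, r = d + t := ⟨r - t, by omega⟩
        rw [iterate_add_apply, hcon u hu] at hr
        exact iter_zero_ne (by omega) hr
    have h1 := hit N w hw hwN
    have h2 := hit N' w' hw' hwN'
    omega
  choose u hu hu0 using hne
  have e1 : ∀ᶠ j in atTop, ∀ t ∈ Finset.range (N' + 1), S.a j < |S.f^[t] (u t)| := by
    rw [Filter.eventually_all_finset]
    exact fun t _ => S.tendsto_a.eventually_lt_const (abs_pos.2 (hu0 t))
  have e2 : ∀ᶠ j in atTop, S.p j < |u 0| :=
    ((tendsto_add_atTop_iff_nat 1).2 S.tendsto_pp).eventually_lt_const (abs_pos.2 (hu0 0))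
  have key : ∀ᶠ j in atTop, ∀ r < S.M (j + 1), ¬ Icc x y ⊆ S.f^[r] '' {u | |u| ≤ S.pp (j + 1)} := by
    filter_upwards [e1, e2] with j h1 h2 r hr hsub
    rcases Nat.lt_or_ge (r + N') (S.M (j + 1)) with h3 | h3
    · have h4 : 0 < r := by
        rcases Nat.eq_zero_or_pos r with rfl | h
        · obtain ⟨q, hq, he⟩ := hsub (hu 0)
          have hq : |q| ≤ S.p j := hq
          rw [iterate_zero, id] at he
          rw [he] at hq
          linarith
        · exact h
      obtain ⟨q, hq, rfl⟩ := hsub hw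
      obtain ⟨q', hq', rfl⟩ := hsub hw'
      rw [← iterate_add_apply] at hwN hwN'
      have h5 : N + r = S.Q j := by
        by_contra h
        exact iter_ne_zero (by omega) (by omega) h hq hwN
      have h6 : N' + r = S.Q j := by
        by_contra h
        exact iter_ne_zero (by omega) (by omega) h hq' hwN'
      omega
    · obtain ⟨q, hq, he⟩ := hsub (hu (S.M (j + 1) - r))
      have h5 := h1 (S.M (j + 1) - r) (Finset.mem_range.2 (by omega))
      rw [← he, ← iterate_add_apply, Nat.sub_add_cancel hr.le] at h5
      exact absurd h5 (not_lt.2 (abs_iter_M_le hq))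
  rw [← map_add_atTop_eq_nat 1, eventually_map]
  exact key

/-- The first iterates of small neighbourhoods of the turning point are small. -/
theorem eventually_small {ε : ℝ} (hε : 0 < ε) : ∀ᶠ n in atTop, ∀ r < S.M n, ∀ x y : ℝ,
    |x| ≤ S.pp n → |y| ≤ S.pp n → |S.f^[r] x - S.f^[r] y| ≤ ε := by
  have hδ : 0 < ε / 2 := by positivity
  set δ := ε / 2 with hδd
  have h1 : ∀ᶠ n in atTop, ∀ i ∈ Finset.Icc (-⌈1 / δ⌉) ⌈1 / δ⌉, |i * δ| ≤ 1 → |(i + 1) * δ| ≤ 1 →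
      ∀ r < S.M n, ¬ Icc (i * δ) ((i + 1) * δ) ⊆ S.f^[r] '' {u | |u| ≤ S.pp n} := by
    rw [Filter.eventually_all_finset]
    intro i _
    by_cases h : |i * δ| ≤ 1 ∧ |(i + 1) * δ| ≤ 1
    · filter_upwards [eventually_not_cover (S := S) h.1 h.2 (by nlinarith)] with n hn _ _ using hn
    · exact Eventually.of_forall fun n h1 h2 => absurd ⟨h1, h2⟩ h
  filter_upwards [h1] with n hn r hr
  have main : ∀ x y : ℝ, |x| ≤ S.pp n → |y| ≤ S.pp n → S.f^[r] y - S.f^[r] x ≤ ε := by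
    intro x y hx hy
    by_contra! hlt
    have hx1 := abs_le.1 (abs_iter_le (S := S) (hx.trans (pp_le_one n)) r)
    have hy1 := abs_le.1 (abs_iter_le (S := S) (hy.trans (pp_le_one n)) r)
    set X := S.f^[r] x
    set Y := S.f^[r] y
    have c1 : X ≤ ⌈X / δ⌉ * δ := (div_le_iff₀ hδ).1 (Int.le_ceil _)
    have c2 : ⌈X / δ⌉ * δ < X + δ := by
      have := Int.ceil_lt_add_one (X / δ)
      calc ⌈X / δ⌉ * δ < (X / δ + 1) * δ := by gcongr
        _ = X + δ := by field_simp
    have hsub : Icc (⌈X / δ⌉ * δ) ((⌈X / δ⌉ + 1) * δ) ⊆ S.f^[r] '' {u | |u| ≤ S.pp n} := by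
      intro w hw
      have hpre : IsPreconnected {u : ℝ | |u| ≤ S.pp n} := by
        have : {u : ℝ | |u| ≤ S.pp n} = Icc (-S.pp n) (S.pp n) := by ext; simp [abs_le]
        rw [this]; exact isPreconnected_Icc
      have := hpre.intermediate_value (a := x) (b := y) hx hy (S.iter_cont r).continuousOn
      exact this ⟨c1.trans hw.1, hw.2.trans (by linarith)⟩
    refine hn ⌈X / δ⌉ (Finset.mem_Icc.2 ⟨?_, ?_⟩) ?_ ?_ r hr hsub
    · rw [neg_le, ← Int.floor_neg]
      refine (Int.floor_le_floor (a := -(X / δ)) (b := 1 / δ) ?_).trans (Int.floor_le_ceil _)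
      rw [← neg_div]; gcongr; linarith
    · exact Int.ceil_le_ceil (by gcongr; linarith)
    · exact abs_le.2 ⟨by linarith, by linarith⟩
    · exact abs_le.2 ⟨by linarith, by linarith⟩
  exact fun x y hx hy => abs_le.2 ⟨by linarith [main x y hx hy], main y x hy hx⟩

theorem eventually_track {ε : ℝ} (hε : 0 < ε) : ∀ᶠ n in atTop, ∀ r < S.M n, ∀ x : ℝ,
    |x| ≤ S.pp n → |S.f^[r] x - S.f^[r] 0| ≤ ε := by
  filter_upwards [eventually_small (S := S) hε] with n hn r hr x hx
  exact hn r hr x 0 hx (by simpa using pp_nonneg n)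

theorem turn_block {j i s : ℕ} (hs : s ≤ i + 1) {u : ℝ} (h0 : 0 ≤ u) (hu : u ≤ S.p j)
    (ha : (S.X (j + 1))^[i] u ≤ S.a (j + 1)) :
    |S.f^[s * S.M (j + 1)] (S.X (j + 1) (-(S.X (j + 1))^[i] u))| ≤ S.p j := by
  rcases Nat.eq_zero_or_pos s with rfl | hs0
  · rw [zero_mul, iterate_zero, id, abs_of_nonneg (S.X0 _ _)]; exact S.X_le_p _ _
  obtain ⟨s, rfl⟩ : ∃ l, s = l + 1 := ⟨s - 1, by omega⟩
  obtain ⟨l, rfl⟩ : ∃ l, i = s + l := ⟨i - s, by omega⟩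
  have h2 : (S.X (j + 1))^[s + l] u = (S.X (j + 1))^[s] ((S.X (j + 1))^[l] u) := by
    rw [iterate_add_apply]
  rw [h2] at ha ⊢
  rw [dyn_turn (S.Xiter_nonneg _ _ (S.Xiter_nonneg _ _ h0)) ha fun r _ => ⟨?_, ?_⟩,
    abs_of_nonneg (S.Xiter_nonneg _ _ h0)]
  · exact (S.Xiterm _ _ hu).trans (S.Xiter_le_p j l)
  · linarith [S.Xiter_nonneg (j + 1) r (S.Xiter_nonneg (j + 1) l h0), S.a_nonneg (j + 1)]
  · rw [← iterate_add_apply]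
    exact (S.Xiter_succ_le_z j _ (hu.trans (S.p_le_z j))).trans (S.z_le_a j)

theorem z_le_pp (n : ℕ) : S.z n ≤ S.pp n := by
  cases n with
  | zero => exact S.z_le_one 0
  | succ n => exact S.z_le_p n

theorem Br.block {n m t : ℕ} {χ : ℝ → ℝ} (h : S.Br n m t χ) {y : ℝ} (hy : y ∈ Icc 0 (S.z m)) {s : ℕ}
    (hs : s * S.M n < t) : |S.f^[s * S.M n] (χ y)| ≤ S.pp n := by
  have down : ∀ j s : ℕ, s * S.M (j + 1) < (S.k + 1) * S.M (j + 1) + S.Q j → s ≤ S.k + 1 := by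
    intro j s hs
    have h1 := M_succ S j
    have h2 := S.M_pos j
    by_contra! h3
    have : (S.k + 2) * S.M (j + 1) ≤ s * S.M (j + 1) := Nat.mul_le_mul_right _ h3
    nlinarith
  have xi : ∀ j (w : ℝ), w ≤ S.z j → S.Xi j w ≤ S.p j := fun j w hw =>
    S.Xim j (hw.trans (S.Xm j (S.v_nonneg _)))
  cases h with
  | up n => exact absurd hs (Nat.not_lt_zero _)
  | far n =>
    refine abs_iter_block (Nat.lt_of_mul_lt_mul_right hs).le ?_
    rw [abs_of_nonneg (S.Xi0 _ _)]
    exact xi n _ (by linarith [hy.1, S.z_nonneg n])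
  | downNeg j =>
    exact turn_block (down m s hs) (S.Xi0 _ _) (xi m _ (by linarith [hy.1, S.z_nonneg m]))
      (Xiter_k_mem (S.Xi0 _ _) (xi m _ (by linarith [hy.1, S.z_nonneg m]))).2
  | downPos j =>
    exact turn_block (down m s hs) (S.Xi0 _ _) (xi m _ hy.2)
      (Xiter_k_mem (S.Xi0 _ _) (xi m _ hy.2)).2
  | near =>
    refine abs_iter_le ?_ _
    rw [abs_of_nonneg (S.X0 _ _)]
    exact (S.Xm 0 (neg_nonpos.2 hy.1)).trans (S.z_le_one 0)
  | turn j i hi =>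
    exact turn_block (Nat.lt_of_mul_lt_mul_right hs).le hy.1 (hy.2.trans (S.z_le_p j))
      ((S.Xiterm _ _ hy.2).trans (S.Xiter_z_le_a j hi))

/-- The post-critical set. -/
def Om (S : Sys) : Set ℝ := closure (range fun t => S.f^[t] 0)

theorem exists_path {x : ℝ} (hx : x ∈ Icc 0 (S.z 0)) : ∃ (n T : ℕ → ℕ) (y : ℕ → ℝ),
    (∀ k, y k ∈ Icc 0 (S.z (n k))) ∧ (∀ k, |S.f^[T k] x| = y k) ∧ (∀ k, T k ≤ T (k + 1)) ∧
    (∀ k i, T k + i * S.M (n k) < T (k + 1) → |S.f^[T k + i * S.M (n k)] x| ≤ S.pp (n k)) ∧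
    ∀ N k, n k ≤ N → x ∈ S.Vis N k 0 := by
  choose! m t χ hbr y hy hyx using fun (n : ℕ) (x : ℝ) (hx : x ∈ Icc 0 (S.z n)) => exists_br hx
  let st : ℕ → ℕ × ℕ × ℝ := fun k => (fun p => (m p.1 p.2.2, p.2.1 + t p.1 p.2.2, y p.1 p.2.2))^[k] (0, 0, x)
  have hst : ∀ k, st (k + 1) = (m (st k).1 (st k).2.2, (st k).2.1 + t (st k).1 (st k).2.2, y (st k).1 (st k).2.2) :=
    fun k => iterate_succ_apply' _ k _
  have hmem : ∀ k, (st k).2.2 ∈ Icc 0 (S.z (st k).1) := by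
    intro k
    induction k with
    | zero => exact hx
    | succ k ih => rw [hst]; exact hy _ _ ih
  have habs : ∀ k, |S.f^[(st k).2.1] x| = (st k).2.2 := by
    intro k
    induction k with
    | zero => exact abs_of_nonneg hx.1
    | succ k ih =>
      rw [hst]
      have h1 := (hbr _ _ (hmem k)).ok.dyn _ (hy _ _ (hmem k))
      rw [hyx _ _ (hmem k)] at h1
      simp only
      rw [add_comm, iterate_add_apply]
      rcases Nat.eq_zero_or_pos (t (st k).1 (st k).2.2) with h0 | h0
      · rw [h0] at h1 ⊢
        rw [iterate_zero, id] at h1 ⊢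
        rw [ih, ← h1, abs_of_nonneg (hmem k).1]
      · rw [S.iter_eq_of_abs h0 (y := (st k).2.2) (by rw [ih, abs_of_nonneg (hmem k).1]), h1]
  refine ⟨fun k => (st k).1, fun k => (st k).2.1, fun k => (st k).2.2, hmem, habs,
    fun k => by simp only; rw [hst]; exact Nat.le_add_right _ _, ?_, ?_⟩
  · intro k i hlt
    simp only at hlt ⊢
    rw [hst] at hlt
    have h2 : i * S.M (st k).1 < t (st k).1 (st k).2.2 := by
      simp only at hlt; omega
    have h1 := (hbr _ _ (hmem k)).block (hy _ _ (hmem k)) h2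
    rw [hyx _ _ (hmem k)] at h1
    rw [add_comm, iterate_add_apply]
    rcases Nat.eq_zero_or_pos (i * S.M (st k).1) with h0 | h0
    · rw [h0] at h1 ⊢
      rw [iterate_zero, id] at h1 ⊢
      rwa [habs, ← abs_of_nonneg (hmem k).1]
    · rwa [S.iter_eq_of_abs h0 (y := (st k).2.2) (by rw [habs, abs_of_nonneg (hmem k).1])]
  · intro N k hk
    have : ∀ l ≤ k, (st (k - l)).2.2 ∈ S.Vis N l (st (k - l)).1 := by
      intro l hl
      induction l with
      | zero =>
        unfold Vis
        rw [Nat.sub_zero, if_pos hk]; exact hmem k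
      | succ l ih =>
        have h1 := ih (by omega)
        have h2 : k - l = (k - (l + 1)) + 1 := by omega
        rw [h2, hst] at h1
        exact ⟨_, _, _, hbr _ _ (hmem _), _, h1, hyx _ _ (hmem _)⟩
    have h3 := this k le_rfl
    rwa [Nat.sub_self] at h3

/-- Almost every orbit shadows the orbit of the turning point. -/
theorem ae_shadow (S : Sys) : ∀ᵐ x : ℝ, x ∈ Icc 0 (S.z 0) →
    ∀ ε > 0, ∀ᶠ t in atTop, ∃ s, |S.f^[t] x - S.f^[s] 0| ≤ ε := by
  filter_upwards [ae_all_iff.2 S.ae_not_Vis] with x hv hx ε hε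
  obtain ⟨n, T, y, hy, hT, hmono, hblock, hvis⟩ := exists_path hx
  have hn : Tendsto n atTop atTop := by
    refine tendsto_atTop.2 fun N => ?_
    filter_upwards [hv N] with k hk
    by_contra! h
    exact hk (hvis N k h.le)
  obtain ⟨N, hN⟩ := eventually_atTop.1 (eventually_track (S := S) hε)
  obtain ⟨K, hK⟩ := eventually_atTop.1 (hn.eventually_ge_atTop N)
  have hTm : Monotone T := monotone_nat_of_le_succ hmono
  filter_upwards [eventually_ge_atTop (T K)] with t ht
  by_cases hex : ∃ k, K ≤ k ∧ t < T (k + 1)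
  · have hk := Nat.find_spec hex
    set k := Nat.find hex with hkd
    have hkt : T k ≤ t := by
      rcases hk.1.eq_or_lt with h | h
      · rw [← h]; exact ht
      · by_contra! h'
        obtain ⟨l, hl⟩ : ∃ l, k = l + 1 := ⟨k - 1, by omega⟩
        rw [hl] at h'
        exact Nat.find_min hex (m := l) (by omega) ⟨by omega, h'⟩
    have hM := S.M_pos (n k)
    set d := t - T k with hd
    have h1 : d % S.M (n k) + d / S.M (n k) * S.M (n k) = d := by
      rw [mul_comm]; exact Nat.mod_add_div _ _
    have h2 := hblock k (d / S.M (n k)) (by omega)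
    have h3 := hN (n k) (hK k hk.1) (d % S.M (n k)) (Nat.mod_lt _ hM) _ h2
    rw [← iterate_add_apply] at h3
    rw [show d % S.M (n k) + (T k + d / S.M (n k) * S.M (n k)) = t by omega] at h3
    exact ⟨_, h3⟩
  · push Not at hex
    obtain ⟨k, hk1, hk2⟩ := ((eventually_ge_atTop K).and (hn.eventually_ge_atTop t)).exists
    have hTt : T k ≤ t := (hmono k).trans (hex k hk1)
    have h2 : |S.f^[T k] x| ≤ S.pp (n k) := by rw [hT]; exact (hy k).2.trans (z_le_pp _)
    have h3 := hN (n k) (hK k hk1) (t - T k)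
      (lt_of_le_of_lt ((Nat.sub_le _ _).trans hk2) (lt_M _)) _ h2
    rw [← iterate_add_apply, Nat.sub_add_cancel hTt] at h3
    exact ⟨_, h3⟩

end Sys

namespace Sys

variable {S : Sys}

theorem p_lt_abs_orbit {n i : ℕ} (h0 : 0 < i) (hi : i + 1 ≤ S.q n) :
    S.p n < |S.f^[i * S.M n] 0| := by
  cases n with
  | zero =>
    have : i = 1 := le_antisymm (Nat.le_of_lt_succ hi) h0
    rw [this, one_mul, abs_iter_M]
    exact S.p_lt_a 0
  | succ j =>
    have hi' : i + 1 ≤ S.k + 2 := hi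
    obtain ⟨i, rfl⟩ : ∃ l, i = l + 1 := ⟨i - 1, by omega⟩
    obtain ⟨l, hl⟩ : ∃ l, S.k = i + l := ⟨S.k - i, by omega⟩
    have ha : S.a (j + 1) = (S.X (j + 1))^[i] ((S.X (j + 1))^[l] (S.p j)) := by
      rw [a_succ, hl, iterate_add_apply]
    have hp := S.p_nonneg j
    rw [S.iter_eq_of_abs (Nat.mul_pos h0 (S.M_pos _))
      (y := S.X (j + 1) (-((S.X (j + 1))^[i] ((S.X (j + 1))^[l] (S.p j)))))
      (by rw [← ha, S.X_neg_a]),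
      dyn_turn (S.Xiter_nonneg _ _ (S.Xiter_nonneg _ _ hp)) ha.ge fun r _ => ⟨?_, ?_⟩,
      abs_of_nonneg (S.Xiter_nonneg _ _ hp)]
    · refine (S.p_lt_a (j + 1)).trans_le ?_
      rw [a_succ]
      exact antitone_nat_of_succ_le (f := fun i => (S.X (j + 1))^[i] (S.p j))
        (fun i => S.Xiter_p_anti j i) (by omega)
    · linarith [S.Xiter_nonneg (j + 1) r (S.Xiter_nonneg (j + 1) l hp), S.a_nonneg (j + 1)]
    · rw [← iterate_add_apply]
      exact (S.Xiter_succ_le_z j _ (S.p_le_z j)).trans (S.z_le_a j)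

/-- The part of the post-critical set visited at times congruent to `r` modulo `M n`. -/
def cell (S : Sys) (n r : ℕ) : Set ℝ := closure ((fun t => S.f^[t] 0) '' {t | t ≡ r [MOD S.M n]})

theorem isClosed_cell (n r : ℕ) : IsClosed (S.cell n r) := isClosed_closure

theorem mem_cell {n r t : ℕ} (h : t ≡ r [MOD S.M n]) : S.f^[t] 0 ∈ S.cell n r :=
  subset_closure ⟨t, h, rfl⟩

theorem cell_congr {n r r' : ℕ} (h : r ≡ r' [MOD S.M n]) : S.cell n r = S.cell n r' := by
  unfold cell
  congr 2
  ext t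
  exact ⟨fun h' => h'.trans h, fun h' => h'.trans h.symm⟩

theorem iter_mem_cell {n r : ℕ} {x : ℝ} (h : x ∈ S.cell n r) (s : ℕ) : S.f^[s] x ∈ S.cell n (r + s) := by
  have h1 := image_closure_subset_closure_image (S.iter_cont s) (mem_image_of_mem S.f^[s] h)
  refine closure_mono ?_ h1
  rintro _ ⟨_, ⟨t, ht, rfl⟩, rfl⟩
  refine ⟨t + s, ht.add_right s, ?_⟩
  simp only
  rw [add_comm, iterate_add_apply]

theorem cell_subset_Om (n r : ℕ) : S.cell n r ⊆ S.Om := closure_mono (image_subset_range _ _)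

theorem isClosed_Om : IsClosed S.Om := isClosed_closure

theorem Om_subset : S.Om ⊆ Icc (-1) 1 := by
  refine closure_minimal ?_ isClosed_Icc
  rintro _ ⟨t, rfl⟩
  exact abs_le.1 (abs_iter_le (by simp) t)

theorem isCompact_Om : IsCompact S.Om := isCompact_Icc.of_isClosed_subset isClosed_Om Om_subset

theorem isCompact_cell (n r : ℕ) : IsCompact (S.cell n r) :=
  isCompact_Om.of_isClosed_subset (isClosed_cell n r) (cell_subset_Om n r)

theorem iter_mem_Om {x : ℝ} (h : x ∈ S.Om) (s : ℕ) : S.f^[s] x ∈ S.Om := by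
  have h1 := image_closure_subset_closure_image (S.iter_cont s) (mem_image_of_mem S.f^[s] h)
  refine closure_mono ?_ h1
  rintro _ ⟨_, ⟨t, rfl⟩, rfl⟩
  exact ⟨s + t, iterate_add_apply _ _ _ _⟩

theorem cell_anti {n N : ℕ} (h : n ≤ N) (r : ℕ) : S.cell N r ⊆ S.cell n r :=
  closure_mono (image_mono fun _ ht => Nat.ModEq.of_dvd (M_dvd h) ht)

theorem cell_split {n N r : ℕ} (h : n ≤ N) {x : ℝ} (hx : x ∈ S.cell n r) :
    ∃ e, e ≡ r [MOD S.M n] ∧ x ∈ S.cell N e := by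
  have hcl : IsClosed (⋃ e ∈ {e ∈ Finset.range (S.M N) | e ≡ r [MOD S.M n]}, S.cell N e) :=
    isClosed_biUnion_finset fun e _ => isClosed_cell N e
  have hsub : S.cell n r ⊆ ⋃ e ∈ {e ∈ Finset.range (S.M N) | e ≡ r [MOD S.M n]}, S.cell N e := by
    refine closure_minimal ?_ hcl
    rintro _ ⟨t, ht, rfl⟩
    refine mem_biUnion (x := t % S.M N) ?_ (mem_cell (Nat.mod_modEq _ _).symm)
    simp only [Finset.coe_filter, mem_ofPred_eq, Finset.mem_range]
    exact ⟨Nat.mod_lt _ (S.M_pos N), (Nat.ModEq.of_dvd (M_dvd h) (Nat.mod_modEq _ _)).trans ht⟩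
  have h1 := hsub hx
  simp only [mem_iUnion, Finset.mem_filter] at h1
  obtain ⟨e, he, hxe⟩ := h1
  exact ⟨e, he.2, hxe⟩

theorem exists_cell {x : ℝ} (hx : x ∈ S.Om) (n : ℕ) : ∃ r < S.M n, x ∈ S.cell n r := by
  have h0 : S.Om = S.cell 0 0 := by
    unfold Om cell
    rw [← image_univ]
    congr 2
    ext t
    simp only [mem_univ, mem_ofPred_eq, true_iff]
    exact Nat.modEq_one
  obtain ⟨e, -, he⟩ := cell_split (Nat.zero_le n) (h0 ▸ hx)
  exact ⟨e % S.M n, Nat.mod_lt _ (S.M_pos n), by rwa [cell_congr (Nat.mod_modEq e (S.M n))]⟩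

theorem abs_le_of_mem_cell {n r : ℕ} {x : ℝ} (hr : S.M n ∣ r) (hx : x ∈ S.cell n r) : |x| ≤ S.pp n := by
  have : S.cell n r ⊆ {x | |x| ≤ S.pp n} := by
    refine closure_minimal ?_ (isClosed_le continuous_abs continuous_const)
    rintro _ ⟨t, ht, rfl⟩
    exact abs_orbit_le ((ht.dvd_iff dvd_rfl).2 hr)
  exact this hx

theorem add_mul_pred (a : ℕ) {b : ℕ} (hb : 0 < b) : a + a * (b - 1) = b * a := by
  obtain ⟨c, rfl⟩ : ∃ c, b = c + 1 := ⟨b - 1, by omega⟩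
  rw [Nat.add_sub_cancel]; ring

theorem zero_mem_cell {n d : ℕ} {x : ℝ} (h0 : x ∈ S.cell n 0) (hd : x ∈ S.cell n d) :
    (0 : ℝ) ∈ S.cell n d := by
  rw [← (isClosed_cell n d).closure_eq, Metric.mem_closure_iff]
  intro ε hε
  obtain ⟨N, hN, hlt⟩ := ((eventually_ge_atTop n).and (S.tendsto_pp.eventually_lt_const hε)).exists
  obtain ⟨e, he, hx⟩ := cell_split hN h0
  refine ⟨S.f^[e * (S.M N - 1)] x, ?_, ?_⟩
  · have h1 := iter_mem_cell hd (e * (S.M N - 1))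
    rwa [cell_congr] at h1
    have : S.M n ∣ e * (S.M N - 1) := Dvd.dvd.mul_right ((Nat.modEq_zero_iff_dvd).1 he) _
    simpa using (Nat.ModEq.refl d).add ((Nat.modEq_zero_iff_dvd).2 this)
  · have h1 := iter_mem_cell hx (e * (S.M N - 1))
    rw [add_mul_pred e (S.M_pos N)] at h1
    rw [dist_zero_left, Real.norm_eq_abs]
    exact (abs_le_of_mem_cell (dvd_mul_right _ _) h1).trans_lt hlt

theorem dvd_of_mem_cell {n d : ℕ} {x : ℝ} (h0 : x ∈ S.cell n 0) (hd : x ∈ S.cell n d) : S.M n ∣ d := by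
  induction n generalizing d x with
  | zero => exact one_dvd d
  | succ n ih =>
    by_contra hnd
    have h1 : S.M n ∣ d := ih (cell_anti n.le_succ 0 h0) (cell_anti n.le_succ d hd)
    have hM := S.M_pos (n + 1)
    have hMn := S.M_pos n
    have hlt := Nat.mod_lt d hM
    set e := d % S.M (n + 1) with he
    have he0 : e ≠ 0 := fun h => hnd (Nat.dvd_of_mod_eq_zero h)
    have hed : d ≡ e [MOD S.M (n + 1)] := (Nat.mod_modEq _ _).symm
    have hne : S.M n ∣ e := (Nat.dvd_mod_iff (M_dvd_succ n)).2 h1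
    rw [cell_congr hed] at hd
    set e' := S.M (n + 1) - e with he'
    have hsum : e + e' = S.M (n + 1) := by omega
    have b1 : |S.f^[e'] 0| ≤ S.p n := by
      have := iter_mem_cell (zero_mem_cell h0 hd) e'
      rw [hsum] at this
      exact abs_le_of_mem_cell dvd_rfl this
    have b2 : |S.f^[e] 0| ≤ S.p n := by
      have m1 := iter_mem_cell h0 e'
      have m2 := iter_mem_cell hd e'
      rw [zero_add] at m1
      rw [hsum, cell_congr (r' := 0) (by simp [Nat.ModEq])] at m2
      have := iter_mem_cell (zero_mem_cell m2 m1) e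
      rw [add_comm e' e, hsum] at this
      exact abs_le_of_mem_cell dvd_rfl this
    obtain ⟨i, hi⟩ := hne
    have hMs : S.M (n + 1) = (S.q n + 1) * S.M n := rfl
    have hi0 : 0 < i := Nat.pos_of_ne_zero fun h => he0 (by rw [hi, h, mul_zero])
    have hiq : i < S.q n + 1 := by
      rw [hi, hMs, mul_comm] at hlt
      exact Nat.lt_of_mul_lt_mul_right hlt
    rcases Nat.lt_or_ge i (S.q n) with h | h
    · have := p_lt_abs_orbit hi0 (n := n) h
      rw [mul_comm, ← hi] at this
      exact absurd b2 (not_le.2 this)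
    · have hiq : i = S.q n := by omega
      have : e' = S.M n := by
        rw [he', hi, hiq, hMs, Nat.add_mul, one_mul, mul_comm, Nat.add_sub_cancel_left]
      rw [this, abs_iter_M] at b1
      exact absurd b1 (not_le.2 (S.p_lt_a n))

theorem modEq_of_mem_cell {n r r' : ℕ} {x : ℝ} (h : x ∈ S.cell n r) (h' : x ∈ S.cell n r') :
    r ≡ r' [MOD S.M n] := by
  have m1 := iter_mem_cell h (r * (S.M n - 1))
  have m2 := iter_mem_cell h' (r * (S.M n - 1))
  have hM := add_mul_pred r (S.M_pos n)
  rw [hM, cell_congr (r' := 0) (by simp [Nat.ModEq])] at m1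
  have h1 := dvd_of_mem_cell m1 m2
  refine Nat.ModEq.add_right_cancel' (r * (S.M n - 1)) ?_
  rw [hM]
  exact ((Nat.modEq_zero_iff_dvd).2 (dvd_mul_right _ _)).trans ((Nat.modEq_zero_iff_dvd).2 h1).symm

theorem eventually_cell_small {ε : ℝ} (hε : 0 < ε) : ∀ᶠ n in atTop, ∀ r, ∀ x ∈ S.cell n r,
    ∀ y ∈ S.cell n r, |x - y| ≤ ε := by
  filter_upwards [eventually_track (S := S) (half_pos hε)] with n hn r
  have : S.cell n r ⊆ Metric.closedBall (S.f^[r % S.M n] 0) (ε / 2) := by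
    refine closure_minimal ?_ Metric.isClosed_closedBall
    rintro _ ⟨t, ht, rfl⟩
    rw [Metric.mem_closedBall, Real.dist_eq]
    have h1 := hn (t % S.M n) (Nat.mod_lt _ (S.M_pos n)) (S.f^[S.M n * (t / S.M n)] 0)
      (abs_orbit_le (dvd_mul_right _ _))
    rw [← iterate_add_apply, Nat.mod_add_div] at h1
    rwa [show r % S.M n = t % S.M n from ht.symm]
  intro x hx y hy
  have h1 := this hx
  have h2 := this hy
  rw [Metric.mem_closedBall, Real.dist_eq] at h1 h2
  rw [abs_le] at *
  exact ⟨by linarith, by linarith⟩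

/-- The residue of the hitting times of a point of the post-critical set. -/
def res (S : Sys) (n : ℕ) (x : ℝ) : ℕ := if h : ∃ r < S.M n, x ∈ S.cell n r then h.choose else 0

theorem res_lt (n : ℕ) (x : ℝ) : S.res n x < S.M n := by
  unfold res
  split_ifs with h
  · exact h.choose_spec.1
  · exact S.M_pos n

theorem mem_cell_res {x : ℝ} (hx : x ∈ S.Om) (n : ℕ) : x ∈ S.cell n (S.res n x) := by
  have h := exists_cell hx n
  unfold res
  rw [dif_pos h]
  exact h.choose_spec.2

theorem res_eq {n r : ℕ} {x : ℝ} (hx : x ∈ S.cell n r) : S.res n x = r % S.M n := by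
  have h := modEq_of_mem_cell (mem_cell_res (cell_subset_Om n r hx) n) hx
  rw [← Nat.mod_eq_of_lt (res_lt n x)]
  exact h

theorem res_iter {x : ℝ} (hx : x ∈ S.Om) (n s : ℕ) :
    S.res n (S.f^[s] x) = (S.res n x + s) % S.M n :=
  res_eq (iter_mem_cell (mem_cell_res hx n) s)

theorem res_succ_mod {x : ℝ} (hx : x ∈ S.Om) (n : ℕ) : S.res (n + 1) x % S.M n = S.res n x :=
  (res_eq (cell_anti n.le_succ _ (mem_cell_res hx (n + 1)))).symm

theorem res_locally_const (S : Sys) (n : ℕ) : ∃ δ > 0, ∀ x ∈ S.Om, ∀ y ∈ S.Om, |x - y| < δ →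
    S.res n x = S.res n y := by
  have h : ∀ r, ∃ δ : ℝ, 0 < δ ∧ ∀ x ∈ S.cell n r, ∀ y ∈ S.Om, |x - y| < δ → S.res n x = S.res n y := by
    intro r
    have hcl : IsClosed (⋃ e ∈ {e ∈ Finset.range (S.M n) | ¬ e ≡ r [MOD S.M n]}, S.cell n e) :=
      isClosed_biUnion_finset fun e _ => isClosed_cell n e
    have hd : Disjoint (S.cell n r)
        (⋃ e ∈ {e ∈ Finset.range (S.M n) | ¬ e ≡ r [MOD S.M n]}, S.cell n e) := by
      rw [Set.disjoint_left]
      intro x hx h1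
      simp only [mem_iUnion, Finset.mem_filter] at h1
      obtain ⟨e, he, hxe⟩ := h1
      exact he.2 (modEq_of_mem_cell hxe hx)
    obtain ⟨δ, hδ, hsep⟩ := Metric.exists_pos_forall_lt_edist (isCompact_cell n r) hcl hd
    refine ⟨δ, hδ, fun x hx y hy hxy => ?_⟩
    have hy' : S.res n y ≡ r [MOD S.M n] := by
      by_contra hne
      have h2 := hsep x hx y (mem_biUnion (x := S.res n y) (by
        simp only [Finset.coe_filter, mem_ofPred_eq, Finset.mem_range]
        exact ⟨res_lt n y, hne⟩) (mem_cell_res hy n))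
      rw [edist_nndist, ENNReal.coe_lt_coe, ← NNReal.coe_lt_coe, coe_nndist, Real.dist_eq] at h2
      linarith
    rw [res_eq hx, ← Nat.mod_eq_of_lt (res_lt n y)]
    exact hy'.symm
  choose δ hδ hsep using h
  obtain ⟨r0, hr0, hmin⟩ := Finset.exists_min_image (Finset.range (S.M n)) δ
    ⟨0, Finset.mem_range.2 (S.M_pos n)⟩
  refine ⟨δ r0, hδ r0, fun x hx y hy hxy => ?_⟩
  exact hsep _ x (mem_cell_res hx n) y hy
    (hxy.trans_le (hmin _ (Finset.mem_range.2 (res_lt n x))))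

theorem eq_of_res_eq {x y : ℝ} (hx : x ∈ S.Om) (hy : y ∈ S.Om) (h : ∀ n, S.res n x = S.res n y) :
    x = y := by
  by_contra hne
  have hε : 0 < |x - y| / 2 := by have := abs_pos.2 (sub_ne_zero.2 hne); linarith
  obtain ⟨n, hn⟩ := (eventually_cell_small (S := S) hε).exists
  have := hn _ x (mem_cell_res hx n) y (h n ▸ mem_cell_res hy n)
  linarith

theorem equi (S : Sys) : ∀ ε > 0, ∃ δ > 0, ∀ x ∈ S.Om, ∀ y ∈ S.Om, |x - y| < δ →
    ∀ n : ℕ, |S.f^[n] x - S.f^[n] y| < ε := by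
  intro ε hε
  obtain ⟨N, hN⟩ := (eventually_cell_small (S := S) (half_pos hε)).exists
  obtain ⟨δ, hδ, h⟩ := S.res_locally_const N
  refine ⟨δ, hδ, fun x hx y hy hxy n => ?_⟩
  have h1 := iter_mem_cell (mem_cell_res hx N) n
  have h2 := iter_mem_cell (mem_cell_res hy N) n
  rw [← h x hx y hy hxy] at h2
  have := hN _ _ h1 _ h2
  linarith

theorem dig_lt (x : ℝ) (i : ℕ) : S.res (i + 1) x / S.M i < S.q i + 1 :=
  (Nat.div_lt_iff_lt_mul (S.M_pos i)).2 (res_lt (i + 1) x)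

/-- Coordinates of the post-critical set. -/
def phi (S : Sys) (x : ℝ) : ∀ i, Fin (S.q i + 1) := fun i => ⟨S.res (i + 1) x / S.M i, dig_lt x i⟩

theorem phi_continuousOn : ContinuousOn S.phi S.Om := by
  rw [continuousOn_pi]
  intro i x hx
  obtain ⟨δ, hδ, h⟩ := S.res_locally_const (i + 1)
  refine (continuousWithinAt_const (b := S.phi x i)).congr_of_eventuallyEq ?_ rfl
  rw [Filter.EventuallyEq, eventually_nhdsWithin_iff]
  filter_upwards [Metric.ball_mem_nhds x hδ] with y hy hyO
  rw [Metric.mem_ball, Real.dist_eq] at hy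
  apply Fin.ext
  simp only [phi]
  rw [h y hyO x hx hy]

theorem res_succ {x : ℝ} (hx : x ∈ S.Om) (n : ℕ) :
    S.res (n + 1) x = S.res n x + S.M n * (S.phi x n : ℕ) := by
  have := Nat.mod_add_div (S.res (n + 1) x) (S.M n)
  rw [res_succ_mod hx] at this
  exact this.symm

theorem phi_injOn : InjOn S.phi S.Om := by
  intro x hx y hy h
  refine eq_of_res_eq hx hy fun n => ?_
  induction n with
  | zero =>
    have h1 := res_lt (S := S) 0 x
    have h2 := res_lt (S := S) 0 y
    have : S.M 0 = 1 := rfl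
    omega
  | succ n ih => rw [res_succ hx, res_succ hy, ih, h]

theorem phi_image : S.phi '' S.Om = univ := by
  refine eq_univ_of_forall fun d => ?_
  let R : ℕ → ℕ := fun n => ∑ i ∈ Finset.range n, S.M i * (d i : ℕ)
  have hR : ∀ n, R (n + 1) = R n + S.M n * (d n : ℕ) := fun n => Finset.sum_range_succ _ n
  have hlt : ∀ n, R n < S.M n := by
    intro n
    induction n with
    | zero => exact S.M_pos 0
    | succ n ih =>
      rw [hR]
      have h1 : (d n : ℕ) ≤ S.q n := Nat.le_of_lt_succ (d n).2
      have h2 : S.M (n + 1) = (S.q n + 1) * S.M n := rfl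
      nlinarith
  have hanti : ∀ n, S.cell (n + 1) (R (n + 1)) ⊆ S.cell n (R n) := fun n => by
    refine (cell_anti n.le_succ _).trans (cell_congr ?_).subset
    rw [hR]
    simp
  obtain ⟨x, hx⟩ := IsCompact.nonempty_iInter_of_sequence_nonempty_isCompact_isClosed
    (fun n => S.cell n (R n)) hanti (fun n => ⟨_, mem_cell rfl⟩) (isCompact_cell _ _)
    (fun n => isClosed_cell _ _)
  rw [mem_iInter] at hx
  refine ⟨x, cell_subset_Om _ _ (hx 0), funext fun i => Fin.ext ?_⟩
  simp only [phi]
  rw [res_eq (hx (i + 1)), Nat.mod_eq_of_lt (hlt _), hR, Nat.add_mul_div_left _ _ (S.M_pos i),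
    Nat.div_eq_of_lt (hlt i), zero_add]

theorem carry {x : ℝ} (hx : x ∈ S.Om) (n : ℕ) :
    S.res n x + 1 = S.M n ↔ ∀ j < n, (S.phi x j : ℕ) = S.q j := by
  induction n with
  | zero =>
    have h1 := res_lt (S := S) 0 x
    have : S.M 0 = 1 := rfl
    simp only [not_lt_zero, false_imp_iff, implies_true, iff_true]
    omega
  | succ n ih =>
    have h1 := res_lt (S := S) n x
    have h2 : S.M (n + 1) = (S.q n + 1) * S.M n := rfl
    have h3 : (S.phi x n : ℕ) ≤ S.q n := Nat.le_of_lt_succ (S.phi x n).2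
    rw [res_succ hx, h2]
    constructor
    · intro h
      have h4 : (S.phi x n : ℕ) = S.q n := by
        by_contra hne
        have : (S.phi x n : ℕ) + 1 ≤ S.q n := by omega
        nlinarith
      rw [h4] at h
      have h5 := ih.1 (by nlinarith)
      intro j hj
      rcases Nat.lt_succ_iff_lt_or_eq.1 hj with h | rfl
      · exact h5 j h
      · exact h4
    · intro h
      have h4 := ih.2 fun j hj => h j (by omega)
      rw [h n (by omega)]
      nlinarith

theorem phi_f {x : ℝ} (hx : x ∈ S.Om) (i : ℕ) : (S.phi (S.f x) i : ℕ) =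
    if ∀ j < i, (S.phi x j : ℕ) = S.q j then
      if (S.phi x i : ℕ) = S.q i then 0 else (S.phi x i : ℕ) + 1
    else (S.phi x i : ℕ) := by
  have hM := S.M_pos i
  have h1 := res_lt (S := S) i x
  have h2 : S.M (i + 1) = (S.q i + 1) * S.M i := rfl
  have h3 : (S.phi x i : ℕ) ≤ S.q i := Nat.le_of_lt_succ (S.phi x i).2
  have h4 : (S.phi (S.f x) i : ℕ) = (S.res i x + S.M i * (S.phi x i : ℕ) + 1) % S.M (i + 1) / S.M i := by
    have := res_iter hx (i + 1) 1
    rw [iterate_one, res_succ hx] at this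
    rw [← this]; rfl
  rw [h4]
  split_ifs with c1 c2
  · have h5 := (carry hx i).2 c1
    rw [c2, h2, show S.res i x + S.M i * S.q i + 1 = (S.q i + 1) * S.M i by nlinarith, Nat.mod_self,
      Nat.zero_div]
  · have h5 := (carry hx i).2 c1
    have h6 : (S.phi x i : ℕ) + 1 < S.q i + 1 := by omega
    rw [show S.res i x + S.M i * (S.phi x i : ℕ) + 1 = ((S.phi x i : ℕ) + 1) * S.M i by nlinarith,
      Nat.mod_eq_of_lt, Nat.mul_div_cancel _ hM]
    rw [h2]; exact Nat.mul_lt_mul_of_pos_right h6 hM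
  · have h5 : S.res i x + 1 < S.M i :=
      lt_of_le_of_ne h1 fun h => c1 ((carry hx i).1 h)
    rw [Nat.mod_eq_of_lt, show S.res i x + S.M i * (S.phi x i : ℕ) + 1 =
      S.res i x + 1 + S.M i * (S.phi x i : ℕ) by ring, Nat.add_mul_div_left _ _ hM,
      Nat.div_eq_of_lt h5, zero_add]
    rw [h2]; nlinarith

theorem phi_conj (hq : ∀ i, 2 ≤ S.q i + 1) {x : ℝ} (hx : x ∈ S.Om) :
    S.phi (S.f x) = addingMachine (fun i => S.q i + 1) hq (S.phi x) := by
  funext i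
  apply Fin.ext
  rw [phi_f hx]
  have hle : ∀ j, (S.phi x j : ℕ) ≤ S.q j := fun j => Nat.le_of_lt_succ (S.phi x j).2
  unfold addingMachine
  by_cases h : ∃ l, (S.phi x l : ℕ) + 1 < S.q l + 1
  · rw [dif_pos h]
    have hf := Nat.find_spec h
    have hm : ∀ j < Nat.find h, (S.phi x j : ℕ) = S.q j := fun j hj => by
      have := Nat.find_min h hj
      have := hle j
      omega
    set l := Nat.find h
    rcases lt_trichotomy i l with h1 | h1 | h1
    · rw [if_pos fun j hj => hm j (hj.trans h1), if_pos (hm i h1), if_pos h1]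
    · rw [if_pos fun j hj => hm j (h1 ▸ hj), if_neg (by rw [h1]; omega), if_neg h1.not_lt, dif_pos h1]
    · rw [if_neg fun hj => by have := hj l h1; omega, if_neg h1.not_gt, dif_neg h1.ne']
  · rw [dif_neg h]
    push Not at h
    have hm : ∀ j, (S.phi x j : ℕ) = S.q j := fun j => by
      have := h j
      have := hle j
      omega
    rw [if_pos fun j _ => hm j, if_pos (hm i)]

theorem exists_ne_near {x : ℝ} (hx : x ∈ S.Om) {ε : ℝ} (hε : 0 < ε) :
    ∃ y ∈ S.Om, y ≠ x ∧ |y - x| ≤ ε := by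
  obtain ⟨n, hn⟩ := (eventually_cell_small (S := S) hε).exists
  have hr := mem_cell_res hx n
  set r := S.res n x
  have h1 : S.f^[r] 0 ∈ S.cell n r := mem_cell rfl
  have h2 : S.f^[r + S.M n] 0 ∈ S.cell n r := mem_cell (by simp [Nat.ModEq])
  by_cases h : S.f^[r] 0 = x
  · refine ⟨_, cell_subset_Om _ _ h2, fun h' => ?_, hn r _ h2 _ hr⟩
    have m1 : x ∈ S.cell (n + 1) r := h ▸ mem_cell rfl
    have m2 : x ∈ S.cell (n + 1) (r + S.M n) := h' ▸ mem_cell rfl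
    have h3 := (modEq_of_mem_cell m2 m1)
    have h4 : S.M (n + 1) ∣ S.M n := by
      rw [← Nat.modEq_zero_iff_dvd]
      exact Nat.ModEq.add_left_cancel' r h3
    have h5 := Nat.le_of_dvd (S.M_pos n) h4
    have h6 : S.M (n + 1) = (S.q n + 1) * S.M n := rfl
    have := q_ge_two (S := S) n
    have := S.M_pos n
    nlinarith
  · exact ⟨_, cell_subset_Om _ _ h1, h, hn r _ h1 _ hr⟩

theorem Om_subset_of_invariant {X : Set ℝ} (hX : IsClosed X) (hf : MapsTo S.f X X) {x : ℝ} (hx : x ∈ X)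
    (hxO : x ∈ S.Om) : S.Om ⊆ X := by
  have h0 : (0 : ℝ) ∈ X := by
    rw [← hX.closure_eq, Metric.mem_closure_iff]
    intro ε hε
    obtain ⟨n, hlt⟩ := (S.tendsto_pp.eventually_lt_const hε).exists
    refine ⟨_, hf.iterate (S.res n x * (S.M n - 1)) hx, ?_⟩
    have h1 := iter_mem_cell (mem_cell_res hxO n) (S.res n x * (S.M n - 1))
    rw [add_mul_pred _ (S.M_pos n)] at h1
    rw [dist_zero_left, Real.norm_eq_abs]
    exact (abs_le_of_mem_cell (dvd_mul_right _ _) h1).trans_lt hlt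
  refine closure_minimal ?_ hX
  rintro _ ⟨t, rfl⟩
  exact hf.iterate t h0

theorem Om_perfect : Perfect S.Om := by
  refine ⟨isClosed_Om, fun x hx => ?_⟩
  rw [accPt_iff_nhds]
  intro U hU
  obtain ⟨ε, hε, hb⟩ := Metric.mem_nhds_iff.1 hU
  obtain ⟨y, hy, hne, hd⟩ := exists_ne_near hx (half_pos hε)
  refine ⟨y, ⟨hb ?_, hy⟩, hne⟩
  rw [Metric.mem_ball, Real.dist_eq]; linarith

theorem Om_totallyDisconnected : IsTotallyDisconnected S.Om := by
  intro t ht hc x hx y hy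
  have h1 := hc.image _ (phi_continuousOn.mono ht)
  exact phi_injOn (ht hx) (ht hy) (h1.subsingleton ⟨x, hx, rfl⟩ ⟨y, hy, rfl⟩)

theorem zero_mem_Om : (0 : ℝ) ∈ S.Om := subset_closure ⟨0, rfl⟩

end Sys

namespace Sys

variable {S : Sys}

/-! ### Absence of renormalization -/

theorem exists_Icc_subset_image (i : ℕ) {x y : ℝ} (h : x < y) :
    ∃ x' y', x' < y' ∧ Icc x' y' ⊆ S.f^[i] '' Icc x y := by
  induction i with
  | zero => exact ⟨x, y, h, by simp⟩
  | succ i ih =>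
    obtain ⟨x', y', hlt, hsub⟩ := ih
    have hw : ∃ w₁ ∈ Icc x' y', ∃ w₂ ∈ Icc x' y', |w₁| ≠ |w₂| := by
      by_cases he : |x'| = |y'|
      · refine ⟨0, ?_, y', right_mem_Icc.2 hlt.le, ?_⟩
        · rcases abs_eq_abs.1 he with h1 | h1
          · exact absurd h1 hlt.ne
          · constructor <;> linarith
        · rcases abs_eq_abs.1 he with h1 | h1
          · exact absurd h1 hlt.ne
          · rw [abs_zero]
            exact (abs_pos.2 (by intro h2; rw [h2] at h1 hlt; linarith)).ne
      · exact ⟨x', left_mem_Icc.2 hlt.le, y', right_mem_Icc.2 hlt.le, he⟩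
    obtain ⟨w₁, hw₁, w₂, hw₂, hne⟩ := hw
    have hne' : S.f w₁ ≠ S.f w₂ := fun h => hne (abs_eq_of_f_eq h)
    refine ⟨min (S.f w₁) (S.f w₂), max (S.f w₁) (S.f w₂), min_lt_max.2 hne', ?_⟩
    rw [iterate_succ', image_comp]
    refine Subset.trans ?_ (image_mono hsub)
    refine (intermediate_value_uIcc (a := w₁) (b := w₂) S.f_cont.continuousOn).trans (image_mono ?_)
    exact uIcc_subset_Icc hw₁ hw₂

theorem not_mem_of_interior_disjoint {a b : ℝ} {i : ℕ} (hab : a < b)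
    (h : interior (Icc a b) ∩ interior (S.f^[i] '' Icc a b) = ∅) {w : ℝ}
    (hw : w ∈ S.f^[i] '' Icc a b) : w ∉ Ioo a b := by
  intro hwI
  have hK : (S.f^[i] '' Icc a b).OrdConnected :=
    (isPreconnected_Icc.image _ (S.iter_cont i).continuousOn).ordConnected
  obtain ⟨x', y', hlt, hsub⟩ := exists_Icc_subset_image (S := S) i hab
  have hu : ∃ u ∈ S.f^[i] '' Icc a b, w ≠ u := by
    by_cases h1 : w = x'
    · exact ⟨y', hsub (right_mem_Icc.2 hlt.le), by rw [h1]; exact hlt.ne⟩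
    · exact ⟨x', hsub (left_mem_Icc.2 hlt.le), h1⟩
  obtain ⟨u, hu, hne⟩ := hu
  rw [interior_Icc] at h
  rcases lt_or_gt_of_ne hne with h1 | h1
  · obtain ⟨t, ht1, ht2⟩ := exists_between (lt_min h1 hwI.2)
    refine (h.subset ⟨⟨hwI.1.trans ht1, ht2.trans_le (min_le_right _ _)⟩, ?_⟩ : t ∈ (∅ : Set ℝ))
    exact interior_maximal (Ioo_subset_Icc_self.trans (hK.out hw hu)) isOpen_Ioo
      ⟨ht1, ht2.trans_le (min_le_left _ _)⟩
  · obtain ⟨t, ht1, ht2⟩ := exists_between (max_lt h1 hwI.1)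
    refine (h.subset ⟨⟨(le_max_right _ _).trans_lt ht1, ht2.trans hwI.2⟩, ?_⟩ : t ∈ (∅ : Set ℝ))
    exact interior_maximal (Ioo_subset_Icc_self.trans (hK.out hu hw)) isOpen_Ioo
      ⟨(le_max_left _ _).trans_lt ht1, ht2⟩

theorem iter_mem_image_of_mod {I : Set ℝ} {s : ℕ} (h0 : (0 : ℝ) ∈ I) (hm : S.f^[s] '' I ⊆ I) (t : ℕ) :
    S.f^[t] 0 ∈ S.f^[t % s] '' I := by
  have hk : ∀ k, S.f^[s * k] 0 ∈ I := fun k => by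
    induction k with
    | zero => exact h0
    | succ k ih =>
      rw [Nat.mul_succ, add_comm, iterate_add_apply]
      exact hm ⟨_, ih, rfl⟩
  refine ⟨S.f^[s * (t / s)] 0, hk _, ?_⟩
  rw [← iterate_add_apply, Nat.mod_add_div]

theorem abs_iter_p (S : Sys) (j : ℕ) : |S.f^[(S.k + 1) * S.M (j + 1)] 0| = S.p j := by
  have hp : S.p j ∈ Icc 0 (S.a j) := ⟨S.p_nonneg j, (S.p_lt_a j).le⟩
  have := S.dyn_turn (n := j + 1) (i := S.k) (u := S.p j)
    (by rw [← S.a_succ]; exact S.a_nonneg _) (by rw [← S.a_succ])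
    (fun l _ => by
      have := (S.X_maps_s j).iterate l hp
      exact ⟨by linarith [this.1, S.a_nonneg (j + 1)], this.2⟩)
  rwa [← S.a_succ, S.X_neg_a, abs_of_nonneg (S.p_nonneg j)] at this

theorem not_renorm {a b : ℝ} {s : ℕ} (h0 : (0 : ℝ) ∈ Ioo a b) (hs : 2 ≤ s)
    (hd : ∀ i, 0 < i → i < s → interior (Icc a b) ∩ interior (S.f^[i] '' Icc a b) = ∅)
    (hm : S.f^[s] '' Icc a b ⊆ Icc a b) : False := by
  have hab : a < b := h0.1.trans h0.2
  have hmem : ∀ t, ¬ s ∣ t → S.f^[t] 0 ∉ Ioo a b := fun t ht =>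
    not_mem_of_interior_disjoint hab
      (hd _ (Nat.pos_of_ne_zero fun h => ht (Nat.dvd_of_mod_eq_zero h)) (Nat.mod_lt _ (by omega)))
      (iter_mem_image_of_mod (Ioo_subset_Icc_self h0) hm t)
  have hex : ∃ n, s ∣ S.M n := by
    obtain ⟨n, hn⟩ := (S.tendsto_a.eventually_lt_const (lt_min (neg_pos.2 h0.1) h0.2)).exists
    refine ⟨n, by_contra fun h => hmem _ h ?_⟩
    have := abs_lt.1 ((abs_iter_M (S := S) n).trans_lt hn)
    constructor
    · linarith [this.1, min_le_left (-a) b]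
    · linarith [this.2, min_le_right (-a) b]
  obtain ⟨j, hj⟩ : ∃ j, Nat.find hex = j + 1 := by
    refine Nat.exists_eq_add_one_of_ne_zero fun h => ?_
    have := Nat.find_spec hex
    rw [h] at this
    have h1 : S.M 0 = 1 := rfl
    rw [h1, Nat.dvd_one] at this
    omega
  have hj1 : s ∣ S.M (j + 1) := hj ▸ Nat.find_spec hex
  have hj0 : ¬ s ∣ S.M j := Nat.find_min hex (by omega)
  have hQ : ¬ s ∣ S.Q j := fun h => hj0 ((Nat.dvd_add_right h).1 (S.M_succ j ▸ hj1))
  have w1 := iter_mem_image_of_mod (Ioo_subset_Icc_self h0) hm (S.Q j)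
  have w2 := iter_mem_image_of_mod (Ioo_subset_Icc_self h0) hm (S.Q j + (S.k + 1) * S.M (j + 1))
  have hmod : (S.Q j + (S.k + 1) * S.M (j + 1)) % s = S.Q j % s := by
    obtain ⟨c, hc⟩ := hj1
    rw [hc, mul_left_comm]
    exact Nat.add_mul_mod_self_left _ _ _
  have e1 : S.f^[S.Q j] 0 = tau j * -S.v j :=
    S.dyn_Xi ⟨le_rfl, by linarith [S.v_nonneg j, S.s_nonneg j]⟩ (by rw [S.Xi_neg_v, abs_zero])
  have e2 : S.f^[S.Q j + (S.k + 1) * S.M (j + 1)] 0 = tau j * S.X j (S.v (j + 1)) := by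
    rw [iterate_add_apply]
    exact S.dyn_Xi ⟨by linarith [S.v_nonneg j, S.X0 j (S.v (j + 1))], X_v_le_s j⟩ (S.abs_iter_p j)
  rw [e1] at w1
  rw [hmod, e2] at w2
  have hK : (S.f^[S.Q j % s] '' Icc a b).OrdConnected :=
    (isPreconnected_Icc.image _ (S.iter_cont _).continuousOn).ordConnected
  have hv := S.v_nonneg j
  have hX := S.X0 j (S.v (j + 1))
  refine not_mem_of_interior_disjoint hab
    (hd _ (Nat.pos_of_ne_zero fun h => hQ (Nat.dvd_of_mod_eq_zero h)) (Nat.mod_lt _ (by omega)))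
    (hK.uIcc_subset w1 w2 ?_) h0
  rw [mem_uIcc]
  rcases le_total 0 (tau j) with ht | ht
  · left; constructor <;> nlinarith
  · right; constructor <;> nlinarith

/-! ### Cross-ratio expansion and periodic points -/

/-- Expansion of the cross-ratio of `a`, `b`, `d` under `g` with derivative `g'` at `b`. -/
def Expands (g : ℝ → ℝ) (g' a b d : ℝ) : Prop :=
  HasDerivAt g g' b ∧ 0 < (g b - g a) * (g d - g b) ∧
    |d - a| * |g b - g a| * |g d - g b| ≤ |g'| * |g d - g a| * |b - a| * |d - b|

theorem abs_sub_pos_of_between {a b d : ℝ} (h : 0 < (b - a) * (d - b)) : 0 < |d - a| := by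
  rw [abs_pos]
  intro h1
  have : d = a := by linarith
  rw [this] at h
  nlinarith [sq_nonneg (b - a)]

theorem Expands.comp {g h : ℝ → ℝ} {g' h' a b d : ℝ} (hg : Expands g g' a b d)
    (hh : Expands h h' (g a) (g b) (g d)) : Expands (h ∘ g) (h' * g') a b d := by
  refine ⟨hh.1.comp b hg.1, hh.2.1, ?_⟩
  have hpos := abs_sub_pos_of_between hg.2.1
  have h1 := mul_le_mul_of_nonneg_left hh.2.2 (abs_nonneg (d - a))
  have h2 := mul_le_mul_of_nonneg_left hg.2.2
    (mul_nonneg (abs_nonneg h') (abs_nonneg (h (g d) - h (g a))))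
  rw [abs_mul]
  refine le_of_mul_le_mul_left ?_ hpos
  simp only [Function.comp_apply]
  nlinarith

theorem expands_id {a b d : ℝ} (h : 0 < (b - a) * (d - b)) : Expands id 1 a b d := by
  refine ⟨hasDerivAt_id b, h, ?_⟩
  simp

theorem expands_sq {a b d : ℝ} (h : 0 < (b - a) * (d - b)) (hab : 0 < a * b) (hbd : 0 < b * d) :
    Expands (fun x => x ^ 2) (2 * b) a b d := by
  refine ⟨by simpa using hasDerivAt_pow 2 b, ?_, ?_⟩
  · have : (b ^ 2 - a ^ 2) * (d ^ 2 - b ^ 2) = ((b - a) * (d - b)) * ((b + a) * (d + b)) := by ring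
    rw [this]
    refine mul_pos h ?_
    have had : 0 < a * d := by
      have h1 : 0 < (a * b) * (b * d) := mul_pos hab hbd
      by_contra hc
      nlinarith [sq_nonneg b]
    nlinarith [sq_nonneg b]
  · have e1 : b ^ 2 - a ^ 2 = (b - a) * (b + a) := by ring
    have e2 : d ^ 2 - b ^ 2 = (d - b) * (d + b) := by ring
    have e3 : d ^ 2 - a ^ 2 = (d - a) * (d + a) := by ring
    rw [e1, e2, e3, abs_mul (b - a), abs_mul (d - b), abs_mul (d - a)]
    have key : |b + a| * |d + b| ≤ |2 * b| * |d + a| := by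
      rw [← abs_mul, ← abs_mul]
      have had : 0 < a * d := by
        have h1 : 0 < (a * b) * (b * d) := mul_pos hab hbd
        by_contra hc
        nlinarith [sq_nonneg b]
      rw [abs_of_pos (by nlinarith [sq_nonneg b]), abs_of_pos (by nlinarith [sq_nonneg b])]
      nlinarith
    have := mul_le_mul_of_nonneg_left key
      (mul_nonneg (mul_nonneg (abs_nonneg (d - a)) (abs_nonneg (b - a))) (abs_nonneg (d - b)))
    nlinarith

theorem expands_pow {a b d : ℝ} (h : 0 < (b - a) * (d - b)) (hab : 0 < a * b) (hbd : 0 < b * d)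
    (m : ℕ) : ∃ g', Expands (fun x => x ^ 2 ^ m) g' a b d := by
  induction m with
  | zero =>
    have e : (fun x : ℝ => x ^ 2 ^ 0) = id := by funext x; simp
    exact ⟨1, e ▸ expands_id h⟩
  | succ m ih =>
    obtain ⟨g', hg⟩ := ih
    refine ⟨2 * b ^ 2 ^ m * g', ?_⟩
    have := hg.comp (expands_sq hg.2.1 (by rw [← mul_pow]; exact pow_pos hab _)
      (by rw [← mul_pow]; exact pow_pos hbd _))
    have e : (fun x : ℝ => x ^ 2 ^ (m + 1)) = (fun x => x ^ 2) ∘ fun x => x ^ 2 ^ m := by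
      funext x
      rw [pow_succ 2 m, pow_mul]; rfl
    rw [e]
    exact this

theorem expands_affine {a b d c e : ℝ} (hc : 0 < c) (h : 0 < (b - a) * (d - b)) :
    Expands (fun x => x / c - e) (1 / c) a b d := by
  have hd : ∀ x y : ℝ, (x / c - e) - (y / c - e) = (x - y) * (1 / c) := fun x y => by ring
  refine ⟨((hasDerivAt_id b).div_const c).sub_const e, ?_, ?_⟩
  · simp only [hd]
    have : 0 < 1 / c := one_div_pos.2 hc
    have e : (b - a) * (1 / c) * ((d - b) * (1 / c)) = ((b - a) * (d - b)) * (1 / c * (1 / c)) := by ring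
    rw [e]; positivity
  · simp only [hd, abs_mul]
    apply le_of_eq; ring

theorem expands_f {a b d : ℝ} (h : 0 < (b - a) * (d - b)) (hab : 0 < a * b) (hbd : 0 < b * d) :
    ∃ g', Expands S.f g' a b d := by
  obtain ⟨g', hg⟩ := expands_pow h hab hbd S.m
  exact ⟨_, hg.comp (expands_affine (e := 1) S.B_pos hg.2.1)⟩

theorem mul_pos_of_ne_zero {g : ℝ → ℝ} (hg : Continuous g) {a b : ℝ} (hab : a ≤ b)
    (h : ∀ u ∈ Icc a b, g u ≠ 0) : 0 < g a * g b := by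
  by_contra hc
  have h0 : (0 : ℝ) ∈ uIcc (g a) (g b) := by
    rw [mem_uIcc]
    rcases le_total 0 (g a) with h1 | h1
    · have := lt_of_le_of_ne h1 (h a (left_mem_Icc.2 hab)).symm
      exact Or.inr ⟨by by_contra h2; push Not at h2; exact hc (mul_pos this h2), h1⟩
    · have := lt_of_le_of_ne h1 (h a (left_mem_Icc.2 hab))
      exact Or.inl ⟨h1, by by_contra h2; push Not at h2; exact hc (mul_pos_of_neg_of_neg this h2)⟩
  obtain ⟨u, hu, h1⟩ := intermediate_value_uIcc hg.continuousOn h0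
  rw [uIcc_of_le hab] at hu
  exact h u hu h1

theorem expands_iter {a b d : ℝ} (hab : a < b) (hbd : b < d) (n : ℕ)
    (h : ∀ u ∈ Icc a d, ∀ i < n, S.f^[i] u ≠ 0) : ∃ g', Expands S.f^[n] g' a b d := by
  induction n with
  | zero => exact ⟨1, expands_id (mul_pos (sub_pos.2 hab) (sub_pos.2 hbd))⟩
  | succ n ih =>
    obtain ⟨g', hg⟩ := ih fun u hu i hi => h u hu i (by omega)
    have hn : ∀ u ∈ Icc a d, S.f^[n] u ≠ 0 := fun u hu => h u hu n (by omega)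
    obtain ⟨h', hh⟩ := expands_f (S := S) hg.2.1
      (mul_pos_of_ne_zero (S.iter_cont n) hab.le fun u hu => hn u ⟨hu.1, hu.2.trans hbd.le⟩)
      (mul_pos_of_ne_zero (S.iter_cont n) hbd.le fun u hu => hn u ⟨hab.le.trans hu.1, hu.2⟩)
    refine ⟨h' * g', ?_⟩
    rw [iterate_succ']
    exact hg.comp hh

theorem f_differentiable (S : Sys) : Differentiable ℝ S.f := by unfold f; fun_prop

theorem not_invariant {x y : ℝ} {n : ℕ} (hn : 0 < n) (hx : |x| ≤ 1) (hxy : x < y)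
    (hmaps : MapsTo S.f^[n] (Icc x y) (Icc x y))
    (hne : ∀ u ∈ Icc x y, ∀ i < n, S.f^[i] u ≠ 0) : False := by
  obtain ⟨u, hu, r, hr⟩ := exists_iter_eq_zero' (S := S) hx hxy
  have h1 := hmaps.iterate (r / n) hu
  refine hne _ h1 (r % n) (Nat.mod_lt _ hn) ?_
  rw [← iterate_mul, ← iterate_add_apply, Nat.mod_add_div]
  exact hr

theorem mapsTo_of_injOn {g : ℝ → ℝ} {x y : ℝ} (hxy : x ≤ y) (hg : ContinuousOn g (Icc x y))
    (hinj : InjOn g (Icc x y)) (hlt : g x < g y) (h1 : x ≤ g x) (h2 : g y ≤ y) :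
    MapsTo g (Icc x y) (Icc x y) := by
  have hm : MonotoneOn g (Icc x y) := by
    rcases hg.strictMonoOn_of_injOn_Icc' hxy hinj with h | h
    · exact h.monotoneOn
    · have hx := left_mem_Icc.2 hxy
      have hy := right_mem_Icc.2 hxy
      exact absurd (h.antitoneOn hx hy hxy) (not_le.2 hlt)
  intro u hu
  exact ⟨h1.trans (hm (left_mem_Icc.2 hxy) hu hu.1), (hm hu (right_mem_Icc.2 hxy) hu.2).trans h2⟩

theorem one_lt_deriv_of_periodic {x : ℝ} (hx : |x| ≤ 1) {p : ℕ} (hp : 0 < p) (hfx : S.f^[p] x = x) :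
    1 < |deriv S.f^[p] x| := by
  have horb : ∀ i, S.f^[i] x ≠ 0 := fun i h => by
    refine iter_zero_ne (S := S) hp ?_
    rw [← h, ← iterate_add_apply, add_comm, iterate_add_apply, hfx]
  have hx1 : |x| < 1 := by
    obtain ⟨r, rfl⟩ : ∃ r, p = r + 1 := ⟨p - 1, by omega⟩
    have h1 : S.f (S.f^[r] x) = x := by rw [← iterate_succ_apply' S.f r x, hfx]
    have h2 := f_mem (S := S) (abs_iter_le (S := S) hx r)
    rw [h1] at h2
    rw [abs_lt]
    refine ⟨lt_of_le_of_ne h2.1 fun h3 => horb r ?_, h2.2.trans_lt S.v0_lt_one⟩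
    have := abs_eq_of_f_eq (h1.trans (h3.symm.trans (f_zero (S := S)).symm))
    simpa using this
  have hd1 : DifferentiableAt ℝ S.f^[p] x := (S.f_differentiable.iterate p) x
  set n := p + p with hn
  have hn0 : 0 < n := by omega
  have hgx : S.f^[n] x = x := by rw [hn, iterate_add_apply, hfx, hfx]
  have hgd : HasDerivAt S.f^[n] (deriv S.f^[p] x * deriv S.f^[p] x) x := by
    have h1 := hd1.hasDerivAt
    have h2 : HasDerivAt S.f^[p] (deriv S.f^[p] x) (S.f^[p] x) := by rw [hfx]; exact h1
    rw [hn, iterate_add]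
    exact h2.comp x h1
  have hev : ∀ᶠ u in 𝓝 x, |u| < 1 ∧ ∀ i ∈ Finset.range n, S.f^[i] u ≠ 0 := by
    refine (continuous_abs.continuousAt.eventually_lt_const hx1).and ?_
    rw [Filter.eventually_all_finset]
    exact fun i _ => (S.iter_cont i).continuousAt.eventually_ne (horb i)
  obtain ⟨δ, hδ, hball⟩ := Metric.eventually_nhds_iff.1 hev
  have hB : ∀ u, |u - x| < δ → |u| < 1 ∧ ∀ i < n, S.f^[i] u ≠ 0 := fun u hu => by
    have := hball (y := u) (by rwa [Real.dist_eq])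
    exact ⟨this.1, fun i hi => this.2 i (Finset.mem_range.2 hi)⟩
  have hsq : 0 < deriv S.f^[p] x * deriv S.f^[p] x := by
    obtain ⟨g', hg⟩ := expands_iter (S := S) (a := x - δ / 2) (b := x) (d := x + δ / 2) (by linarith)
      (by linarith) n (fun u hu => (hB u (abs_lt.2 ⟨by linarith [hu.1], by linarith [hu.2]⟩)).2)
    have h1 := hg.2.2
    rw [← hg.1.unique hgd]
    have h2 : g' ≠ 0 := by
      rintro rfl
      have h3 := hg.2.1
      have h4 : 0 < |S.f^[n] x - S.f^[n] (x - δ / 2)| * |S.f^[n] (x + δ / 2) - S.f^[n] x| := by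
        rw [← abs_mul]; exact abs_pos.2 h3.ne'
      rw [abs_zero, zero_mul, zero_mul, zero_mul, mul_assoc] at h1
      have h5 : 0 < |x + δ / 2 - (x - δ / 2)| := abs_pos.2 (by linarith [hδ] : x + δ / 2 - (x - δ / 2) ≠ 0)
      exact absurd h1 (not_le.2 (mul_pos h5 h4))
    have h3 : 0 ≤ g' := by
      rw [hg.1.unique hgd]; exact mul_self_nonneg _
    exact lt_of_le_of_ne h3 h2.symm
  have hslope := (hasDerivAt_iff_tendsto_slope.1 hgd).eventually_const_lt hsq
  rw [eventually_nhdsWithin_iff] at hslope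
  obtain ⟨δ', hδ', hball'⟩ := Metric.eventually_nhds_iff.1 hslope
  have hsl : ∀ u, |u - x| < δ' → u ≠ x → 0 < (S.f^[n] u - x) * (u - x) := fun u hu hne => by
    have := hball' (y := u) (by rwa [Real.dist_eq]) hne
    rw [slope_def_field, hgx] at this
    have h2 : u - x ≠ 0 := sub_ne_zero.2 hne
    have h3 := mul_pos this (pow_pos (abs_pos.2 h2) 2)
    rw [sq_abs] at h3
    have : (S.f^[n] u - x) / (u - x) * (u - x) ^ 2 = (S.f^[n] u - x) * (u - x) := by
      field_simp
    rwa [this] at h3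
  set ε := min δ δ' / 2 with hε
  have hε0 : 0 < ε := by have := lt_min hδ hδ'; linarith
  have hεδ : ε < δ := by have := lt_min hδ hδ'; linarith [min_le_left δ δ']
  have hεδ' : ε < δ' := by have := lt_min hδ hδ'; linarith [min_le_right δ δ']
  have hne : ∀ u ∈ Icc (x - ε) (x + ε), ∀ i < n, S.f^[i] u ≠ 0 := fun u hu =>
    (hB u (abs_lt.2 ⟨by linarith [hu.1], by linarith [hu.2]⟩)).2
  have hright : x + ε < S.f^[n] (x + ε) := by
    by_contra! hc
    have h1 := hsl (x + ε) (by rw [add_sub_cancel_left, abs_of_pos hε0]; exact hεδ') (by linarith)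
    have h2 : x < S.f^[n] (x + ε) := by
      rw [add_sub_cancel_left] at h1
      linarith [(pos_iff_pos_of_mul_pos h1).2 hε0]
    have hne' : ∀ u ∈ Icc x (x + ε), ∀ i < n, S.f^[i] u ≠ 0 := fun u hu =>
      hne u ⟨by linarith [hu.1], hu.2⟩
    refine not_invariant hn0 hx (by linarith : x < x + ε) ?_ hne'
    refine mapsTo_of_injOn (by linarith) (S.iter_cont n).continuousOn ?_ (by rwa [hgx]) hgx.ge hc
    rw [← uIcc_of_le (by linarith : x ≤ x + ε)] at hne' ⊢
    exact injOn_of_ne_zero hne'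
  have hleft : S.f^[n] (x - ε) < x - ε := by
    by_contra! hc
    have h1 := hsl (x - ε) (by rw [sub_sub_cancel_left, abs_neg, abs_of_pos hε0]; exact hεδ')
      (by linarith)
    have h2 : S.f^[n] (x - ε) < x := by
      rw [sub_sub_cancel_left] at h1
      nlinarith
    have hne' : ∀ u ∈ Icc (x - ε) x, ∀ i < n, S.f^[i] u ≠ 0 := fun u hu =>
      hne u ⟨hu.1, by linarith [hu.2]⟩
    refine not_invariant hn0 (hB (x - ε) (by rw [sub_sub_cancel_left, abs_neg, abs_of_pos hε0]; exact hεδ)).1.le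
      (by linarith : x - ε < x) ?_ hne'
    refine mapsTo_of_injOn (by linarith) (S.iter_cont n).continuousOn ?_ (by rwa [hgx]) hc hgx.le
    rw [← uIcc_of_le (by linarith : x - ε ≤ x)] at hne' ⊢
    exact injOn_of_ne_zero hne'
  obtain ⟨g', hg⟩ := expands_iter (S := S) (a := x - ε) (b := x) (d := x + ε) (by linarith)
    (by linarith) n hne
  have h1 := hg.2.2
  rw [hg.1.unique hgd, abs_of_pos hsq, hgx] at h1
  set A := S.f^[n] (x - ε) with hA
  set D := S.f^[n] (x + ε) with hD
  rw [abs_of_pos (by linarith : 0 < x + ε - (x - ε)), abs_of_pos (by linarith : 0 < x - A),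
    abs_of_pos (by linarith : 0 < D - x), abs_of_pos (by linarith : 0 < D - A),
    abs_of_pos (by linarith : 0 < x - (x - ε)), abs_of_pos (by linarith : 0 < x + ε - x)] at h1
  by_contra! hc
  have hc2 : deriv S.f^[p] x * deriv S.f^[p] x ≤ 1 := by
    rw [← abs_mul_abs_self]
    exact mul_le_one₀ hc (abs_nonneg _) hc
  have h2 : (x + ε - (x - ε)) * (x - A) * (D - x) ≤ 1 * (D - A) * (x - (x - ε)) * (x + ε - x) := by
    refine h1.trans ?_
    gcongr <;> linarith
  have h3 : 0 < x - A - ε := by linarith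
  have h4 : 0 < D - x - ε := by linarith
  nlinarith [mul_pos hε0 h3, mul_pos hε0 h4, mul_pos h3 h4, mul_pos (mul_pos hε0 h3) h4,
    mul_pos (mul_pos hε0 hε0) h3, mul_pos (mul_pos hε0 hε0) h4]

end Sys

namespace Sys

variable {S : Sys}

/-! ### The map on the unit interval -/

/-- The orientation reversing affine identification of `[0, 1]` with `[-1, 1]`. -/
def chart : ℝ ≃ₜ ℝ where
  toFun t := 1 - 2 * t
  invFun u := (1 - u) / 2
  left_inv t := by ring
  right_inv u := by ring
  continuous_toFun := by fun_prop
  continuous_invFun := by fun_prop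

theorem chart_apply (t : ℝ) : chart t = 1 - 2 * t := rfl
theorem chart_symm_apply (u : ℝ) : chart.symm u = (1 - u) / 2 := rfl

theorem abs_chart_le_iff {t : ℝ} : |chart t| ≤ 1 ↔ t ∈ Icc (0 : ℝ) 1 := by
  rw [chart_apply, abs_le, mem_Icc]
  constructor <;> rintro ⟨h1, h2⟩ <;> constructor <;> linarith

theorem chart_half : chart (1 / 2) = 0 := by rw [chart_apply]; norm_num

/-- The map `f` transported to the unit interval. -/
def F (S : Sys) (t : ℝ) : ℝ := (1 - S.f (1 - 2 * t)) / 2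

theorem chart_F (t : ℝ) : chart (S.F t) = S.f (chart t) := by
  simp only [F, chart_apply]; ring

theorem chart_iter (n : ℕ) (t : ℝ) : chart (S.F^[n] t) = S.f^[n] (chart t) :=
  (Semiconj.iterate_right (f := chart) (fun t => chart_F t) n) t

theorem iter_F (n : ℕ) : S.F^[n] = fun t => (1 - S.f^[n] (1 - 2 * t)) / 2 := by
  funext t
  rw [← chart_apply, ← chart_iter, chart_apply]; ring

theorem chart_image (n : ℕ) (I : Set ℝ) : chart '' (S.F^[n] '' I) = S.f^[n] '' (chart '' I) := by
  simp only [image_image, chart_iter]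

theorem F_lt_F {s t : ℝ} (h : |1 - 2 * t| < |1 - 2 * s|) : S.F s < S.F t := by
  have := f_lt_f (S := S) h
  unfold F; linarith

theorem F_contDiff (S : Sys) : ContDiff ℝ 3 S.F := by
  unfold F f; fun_prop

theorem f_hasDerivAt (u : ℝ) : HasDerivAt S.f (S.N * u ^ (S.N - 1) / S.B) u := by
  unfold f N
  simpa using ((hasDerivAt_pow (2 ^ S.m) u).div_const S.B).sub_const 1

theorem F_iter_hasDerivAt (n : ℕ) (t : ℝ) :
    HasDerivAt S.F^[n] (deriv S.f^[n] (1 - 2 * t)) t := by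
  rw [iter_F]
  have h1 : HasDerivAt (fun t : ℝ => 1 - 2 * t) (-2) t := by
    simpa using ((hasDerivAt_id t).const_mul 2).const_sub 1
  have h2 : HasDerivAt S.f^[n] (deriv S.f^[n] (1 - 2 * t)) (1 - 2 * t) :=
    ((S.f_differentiable.iterate n) _).hasDerivAt
  have h3 := ((h2.comp t h1).const_sub 1).div_const 2
  have e : -(deriv S.f^[n] (1 - 2 * t) * -2) / 2 = deriv S.f^[n] (1 - 2 * t) := by ring
  rw [e] at h3
  exact h3

theorem unimodal (S : Sys) : UnimodalA S.F (1 / 2) S.N where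
  cont := (S.F_contDiff).continuous.continuousOn
  maps t ht := by
    rw [← abs_chart_le_iff, chart_F]
    exact abs_f_le (abs_chart_le_iff.2 ht)
  c_mem := by constructor <;> norm_num
  mono s hs t ht hst := by
    refine F_lt_F ?_
    rw [abs_of_nonneg (by linarith [ht.2]), abs_of_nonneg (by linarith [hs.2])]
    linarith
  anti s hs t ht hst := by
    refine F_lt_F ?_
    rw [abs_of_nonpos (by linarith [hs.1]), abs_of_nonpos (by linarith [ht.1])]
    linarith
  smooth := S.F_contDiff.contDiffOn
  deriv_ne x hx := by
    have h1 := F_iter_hasDerivAt (S := S) 1 x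
    rw [iterate_one, iterate_one, (f_hasDerivAt _).deriv] at h1
    rw [h1.deriv]
    have h2 : 1 - 2 * x ≠ 0 := fun h => hx.2 (by rw [mem_singleton_iff]; linarith)
    have h3 : (S.N : ℝ) ≠ 0 := Nat.cast_ne_zero.2 S.N_ne
    exact div_ne_zero (mul_ne_zero h3 (pow_ne_zero _ h2)) S.B_pos.ne'
  ell_gt_one := by
    have h : 1 < S.N := Nat.one_lt_two_pow (by have := S.hm; omega)
    exact_mod_cast h
  nonflat := by
    have hB := S.B_pos
    refine ⟨fun x => 1 / 2 - x / 2, fun y => 1 - y / (2 * S.B), by norm_num, ?_,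
      ⟨univ, univ_mem, by fun_prop, by fun_prop⟩, ?_, ?_, 1, abs_one, Eventually.of_forall fun x => ?_⟩
    · simp only [F]
      norm_num [f_zero]
    · have : HasDerivAt (fun x : ℝ => 1 / 2 - x / 2) (-(1 / 2)) 0 :=
        ((hasDerivAt_id (0 : ℝ)).div_const 2).const_sub (1 / 2)
      rw [this.deriv]; norm_num
    · have : HasDerivAt (fun y : ℝ => 1 - y / (2 * S.B)) (-(1 / (2 * S.B))) 0 :=
        ((hasDerivAt_id (0 : ℝ)).div_const (2 * S.B)).const_sub 1
      rw [this.deriv]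
      exact neg_ne_zero.2 (one_div_ne_zero (by positivity))
    · have e : 1 - 2 * (1 / 2 - x / 2) = x := by ring
      simp only [F]
      rw [e, one_mul, Real.rpow_natCast, ← S.f_abs x]
      simp only [f, N]
      field_simp
      ring

theorem repelling (S : Sys) : AllPeriodicHyperbolicRepelling S.F := by
  intro x hx p hp h
  rw [(F_iter_hasDerivAt p x).deriv]
  refine one_lt_deriv_of_periodic (abs_chart_le_iff.2 hx) hp ?_
  rw [← chart_iter, h]

theorem not_infinitelyRenormalizable (S : Sys) : ¬ InfinitelyRenormalizable S.F (1 / 2) := by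
  intro h
  obtain ⟨I, s, -, ⟨a, b, -, rfl⟩, hc, hs, hd, hm, -⟩ := h 0
  have himg : chart '' Icc a b = Icc (1 - 2 * b) (1 - 2 * a) := by
    rw [← chart.preimage_symm]
    ext u
    simp only [mem_preimage, chart_symm_apply, mem_Icc]
    constructor <;> rintro ⟨h1, h2⟩ <;> constructor <;> linarith
  rw [interior_Icc] at hc
  refine not_renorm (S := S) (a := 1 - 2 * b) (b := 1 - 2 * a) (s := s)
    ⟨by linarith [hc.2], by linarith [hc.1]⟩ hs ?_ ?_
  · intro i h0 hi
    have := hd 0 i h0 hi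
    rw [iterate_zero, image_id] at this
    rw [← himg, ← chart_image, ← chart.image_interior, ← chart.image_interior,
      ← image_inter chart.injective, this, image_empty]
  · rw [← himg, ← chart_image]
    exact image_mono hm

theorem omegaLimitSet_F (t : ℝ) : omegaLimitSet S.F t = chart ⁻¹' omegaLimitSet S.f (chart t) := by
  unfold omegaLimitSet
  rw [preimage_iInter]
  congr 1
  funext N
  rw [chart.preimage_closure]
  congr 1
  ext u
  simp only [mem_image, mem_preimage, ← chart_iter, chart.injective.eq_iff]

theorem omegaLimitSet_zero : omegaLimitSet S.f 0 = S.Om := by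
  refine Subset.antisymm ?_ (subset_iInter fun N => ?_)
  · exact (iInter_subset _ 0).trans (closure_mono (image_subset_range _ _))
  · have hmaps : MapsTo S.f ((fun n => S.f^[n] 0) '' {n | N ≤ n}) ((fun n => S.f^[n] 0) '' {n | N ≤ n}) := by
      rintro _ ⟨n, hn, rfl⟩
      exact ⟨n + 1, Nat.le_succ_of_le hn, iterate_succ_apply' S.f n 0⟩
    exact Om_subset_of_invariant isClosed_closure (hmaps.closure S.f_cont)
      (subset_closure ⟨N, le_refl N, rfl⟩) (subset_closure ⟨N, rfl⟩)

theorem omegaLimitSet_half : omegaLimitSet S.F (1 / 2) = chart ⁻¹' S.Om := by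
  rw [omegaLimitSet_F, chart_half, omegaLimitSet_zero]

theorem omegaLimitSet_nonempty {u : ℝ} (hu : |u| ≤ 1) : (omegaLimitSet S.f u).Nonempty := by
  refine IsCompact.nonempty_iInter_of_sequence_nonempty_isCompact_isClosed _
    (fun N => closure_mono (image_mono fun n hn => (Nat.le_succ N).trans hn))
    (fun N => ⟨_, subset_closure ⟨N, le_refl N, rfl⟩⟩) ?_ (fun N => isClosed_closure)
  refine (isCompact_Icc (a := (-1 : ℝ)) (b := 1)).of_isClosed_subset isClosed_closure ?_
  refine closure_minimal ?_ isClosed_Icc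
  rintro _ ⟨n, -, rfl⟩
  exact abs_le.1 (abs_iter_le hu n)

theorem omegaLimitSet_subset {u : ℝ}
    (h : ∀ ε > 0, ∀ᶠ t in atTop, ∃ s, |S.f^[t] u - S.f^[s] 0| ≤ ε) : omegaLimitSet S.f u ⊆ S.Om := by
  intro y hy
  refine Metric.mem_closure_iff.2 fun ε hε => ?_
  obtain ⟨N, hN⟩ := eventually_atTop.1 (h (ε / 4) (by linarith))
  obtain ⟨_, ⟨n, hn, rfl⟩, hd⟩ := Metric.mem_closure_iff.1 (mem_iInter.1 hy N) (ε / 2) (by linarith)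
  obtain ⟨s, hs⟩ := hN n hn
  refine ⟨_, ⟨s, rfl⟩, (dist_triangle _ (S.f^[n] u) _).trans_lt ?_⟩
  rw [← Real.dist_eq] at hs
  linarith

theorem ae_chart {P : ℝ → Prop} (h : ∀ᵐ u : ℝ, P u) : ∀ᵐ t : ℝ, P (chart t) := by
  rw [ae_iff] at h ⊢
  have h1 : volume ((fun x : ℝ => 1 - x) ⁻¹' {u | ¬ P u}) = 0 :=
    (quasiMeasurePreserving_sub_left_of_right_invariant volume (1 : ℝ)).preimage_null h
  have h2 := Real.volume_preimage_mul_left (two_ne_zero' ℝ) ((fun x : ℝ => 1 - x) ⁻¹' {u | ¬ P u})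
  rw [h1, mul_zero] at h2
  exact h2

theorem metricAttractor (S : Sys) : IsMetricAttractor S.F (omegaLimitSet S.F (1 / 2)) := by
  rw [omegaLimitSet_half]
  refine ⟨chart.isCompact_preimage.2 isCompact_Om, ?_, ?_, ?_, ?_⟩
  · intro t ht
    exact abs_chart_le_iff.1 (abs_le.2 (Om_subset ht))
  · rintro _ ⟨t, ht, rfl⟩
    rw [mem_preimage, chart_F]
    exact iter_mem_Om ht 1
  · have hz := S.z_pos 0
    have hz1 := S.z_le_one 0
    have hpos : 0 < volume (Icc ((1 - S.z 0) / 2) (1 / 2)) := by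
      rw [Real.volume_Icc, ENNReal.ofReal_pos]; linarith
    refine hpos.trans_le (measure_mono_ae ?_)
    filter_upwards [ae_chart S.ae_shadow] with t ht hmem
    have hmem : t ∈ Icc ((1 - S.z 0) / 2) (1 / 2) := hmem
    refine ⟨⟨by linarith [hmem.1], by linarith [hmem.2]⟩, ?_⟩
    rw [omegaLimitSet_F]
    refine preimage_mono (omegaLimitSet_subset (ht ?_))
    rw [chart_apply]
    constructor <;> linarith [hmem.1, hmem.2]
  · intro X' hX' hc hinv
    convert measure_empty (μ := (volume : Measure ℝ))
    rw [eq_empty_iff_forall_notMem]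
    rintro t ⟨ht, hsub⟩
    rw [omegaLimitSet_F] at hsub
    obtain ⟨y, hy⟩ := omegaLimitSet_nonempty (S := S) (abs_chart_le_iff.2 ht)
    have hy' : chart.symm y ∈ X' := hsub (by rwa [mem_preimage, chart.apply_symm_apply])
    have hO : S.Om ⊆ chart '' X' := by
      refine Om_subset_of_invariant (chart.isClosed_image.2 hc.isClosed) ?_
        (⟨_, hy', chart.apply_symm_apply y⟩ : y ∈ chart '' X') ?_
      · rintro _ ⟨t, ht, rfl⟩
        exact ⟨S.F t, hinv ⟨t, ht, rfl⟩, chart_F t⟩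
      · have := hX'.1 hy'
        rwa [mem_preimage, chart.apply_symm_apply] at this
    refine hX'.2 fun u hu => ?_
    obtain ⟨w, hw, he⟩ := hO hu
    rwa [← chart.injective he]

theorem cantorSet (S : Sys) : IsCantorSet (omegaLimitSet S.F (1 / 2)) := by
  rw [omegaLimitSet_half]
  refine ⟨⟨1 / 2, ?_⟩, chart.isCompact_preimage.2 isCompact_Om, ⟨isClosed_Om.preimage chart.continuous, ?_⟩, ?_⟩
  · rw [mem_preimage, chart_half]
    exact zero_mem_Om
  · intro t ht
    have h1 := (Om_perfect.acc _ ht).map chart.symm.continuous.continuousAt chart.symm.injective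
    rwa [chart.symm_apply_apply, map_principal, chart.image_symm] at h1
  · refine isTotallyDisconnected_of_image chart.continuous.continuousOn chart.injective ?_
    rw [chart.image_preimage]
    exact Om_totallyDisconnected

theorem conjugate (S : Sys) : ConjugateToAddingMachine S.F (omegaLimitSet S.F (1 / 2)) := by
  rw [omegaLimitSet_half]
  have hq : ∀ i, 2 ≤ S.q i + 1 := fun i => by have := q_ge_two (S := S) i; omega
  refine ⟨fun i => S.q i + 1, hq, S.phi ∘ chart,
    phi_continuousOn.comp chart.continuous.continuousOn (mapsTo_preimage _ _),
    phi_injOn.comp chart.injective.injOn (mapsTo_preimage _ _), ?_, fun x hx => ?_⟩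
  · rw [image_comp, chart.image_preimage]
    exact phi_image
  · rw [comp_apply, chart_F, phi_conj hq hx]; rfl

theorem equicontinuous (S : Sys) : EquicontinuousOnSet S.F (omegaLimitSet S.F (1 / 2)) := by
  rw [omegaLimitSet_half]
  have hd : ∀ x y, |chart x - chart y| = 2 * |x - y| := fun x y => by
    rw [chart_apply, chart_apply, ← abs_two, ← abs_mul, abs_two, ← abs_neg]
    congr 1; ring
  intro ε hε
  obtain ⟨δ, hδ, h⟩ := S.equi (2 * ε) (by linarith)
  refine ⟨δ / 2, half_pos hδ, fun x hx y hy hxy n => ?_⟩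
  have := h _ hx _ hy (by rw [hd]; linarith) n
  rw [← chart_iter, ← chart_iter, hd] at this
  linarith

end Sys

/-- Theorem 6.1: there exists a unimodal map `f ∈ 𝒜₊` with a wild attractor `ω(c)`
(a Cantor attractor of a non-infinitely-renormalizable map) such that `f|ω(c)` is
topologically conjugate to an adding machine, hence equicontinuous. -/
theorem wild_adding_machine_exists :
    ∃ (f : ℝ → ℝ) (c ℓ : ℝ), UnimodalAStar f c ℓ ∧
      ¬ InfinitelyRenormalizable f c ∧
      IsMetricAttractor f (omegaLimitSet f c) ∧
      IsCantorSet (omegaLimitSet f c) ∧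
      ConjugateToAddingMachine f (omegaLimitSet f c) ∧
      EquicontinuousOnSet f (omegaLimitSet f c) := by
  obtain ⟨S⟩ := exists_sys
  exact ⟨S.F, 1 / 2, S.N, ⟨S.unimodal, S.repelling⟩, S.not_infinitelyRenormalizable,
    S.metricAttractor, S.cantorSet, S.conjugate, S.equicontinuous⟩
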